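/- Assume the abc conjecture. Let n ≥ 2 be an integer and let f ∈ ℤ[X] be squarefree (in ℚ[X]) with deg f > (4n−2)/(n−1). Then the following are equivalent: (i) f has no root in ℚ; (ii) there exist a real γ with 0 ≤ γ < 1, a constant c > 0 and X₀ such that for all real X ≥ X₀ the number of n-th power free integers d with |d| ≤ X for which the twist C_d : d·y^n = f(x) violates the Hasse principle is at least c·X/(log X)^γ; (iii) there exists an n-th power free integer d such that C_d violates the Hasse principle. -/

import Mathlib

open Polynomial

/-- The radical of an integer: the product of its distinct prime factors. -/
def IntRadical (m : ℤ) : ℕ := ∏ p ∈ m.natAbs.primeFactors, p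

/-- The abc conjecture of Masser–Oesterlé. -/
def ABCConjecture : Prop :=
  ∀ ε : ℝ, 0 < ε → ∃ K : ℝ, 0 < K ∧ ∀ a b c : ℤ,
    a ≠ 0 → b ≠ 0 → c ≠ 0 →
    IsCoprime a b → IsCoprime a c → IsCoprime b c →
    a + b = c →
    ((max (max |a| |b|) |c| : ℤ) : ℝ) ≤ K * (IntRadical (a * b * c) : ℝ) ^ (1 + ε)

/-- `d` is `n`-th power free. -/
def NthPowerFree (n : ℕ) (d : ℤ) : Prop :=
  d ≠ 0 ∧ ∀ p : ℕ, p.Prime → ¬ ((p : ℤ) ^ n ∣ d)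

/-- A `K`-point of the twist `C_d : d·y^n = f(x)`. -/
def HasTwistPoint (n : ℕ) (f : Polynomial ℤ) (d : ℤ) (K : Type) [CommRing K] : Prop :=
  ∃ x y : K, (d : K) * y ^ n = Polynomial.aeval x f

/-- The twist `C_d : d·y^n = f(x)` has points everywhere locally. -/
def EverywhereLocallySoluble (n : ℕ) (f : Polynomial ℤ) (d : ℤ) : Prop :=
  HasTwistPoint n f d ℝ ∧ ∀ (p : ℕ) (_ : Fact p.Prime), HasTwistPoint n f d ℚ_[p]

/-- The twist `C_d` violates the Hasse principle. -/
def ViolatesHasse (n : ℕ) (f : Polynomial ℤ) (d : ℤ) : Prop :=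
  EverywhereLocallySoluble n f d ∧ ¬ HasTwistPoint n f d ℚ

/-- `f` is weakly intersective: the primes modulo which `f` has a root have
relative natural density `1` in the primes. -/
def WeaklyIntersective (f : Polynomial ℤ) : Prop :=
  Filter.Tendsto (fun X : ℕ =>
      (Nat.card {ℓ : ℕ // ℓ ≤ X ∧ ℓ.Prime ∧ ∃ x : ZMod ℓ, Polynomial.aeval x f = 0} : ℝ) /
      (Nat.card {ℓ : ℕ // ℓ ≤ X ∧ ℓ.Prime} : ℝ))
    Filter.atTop (nhds 1)


section Stepanov

variable {F : Type*} [Field F]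

theorem sum_ne_zero_of_rootMultiplicity_injOn {ι : Type*} (s : Finset ι) (g : ι → F[X]) (ω : F)
    (hinj : ∀ i ∈ s, ∀ j ∈ s, g i ≠ 0 → g j ≠ 0 →
      rootMultiplicity ω (g i) = rootMultiplicity ω (g j) → i = j)
    (hne : ∃ i ∈ s, g i ≠ 0) : ∑ i ∈ s, g i ≠ 0 := by
  classical
  obtain ⟨i₀, hi₀, hmin⟩ := Finset.exists_min_image (s.filter fun i => g i ≠ 0)
    (fun i => rootMultiplicity ω (g i))
    (by obtain ⟨i, hi, h⟩ := hne; exact ⟨i, by simp [hi, h]⟩)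
  rw [Finset.mem_filter] at hi₀
  intro h0
  rw [← Finset.add_sum_erase s g hi₀.1] at h0
  have hdvd : (X - C ω) ^ (rootMultiplicity ω (g i₀) + 1) ∣ ∑ i ∈ s.erase i₀, g i := by
    refine Finset.dvd_sum fun i hi => ?_
    rw [Finset.mem_erase] at hi
    by_cases hz : g i = 0
    · simp [hz]
    · have h1 := hmin i (by simp [hi.2, hz])
      have h2 : rootMultiplicity ω (g i) ≠ rootMultiplicity ω (g i₀) := fun h =>
        hi.1 (hinj i hi.2 i₀ hi₀.1 hz hi₀.2 h)
      have h3 : rootMultiplicity ω (g i₀) + 1 ≤ rootMultiplicity ω (g i) := by omega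
      have h4 : (X - C ω) ^ rootMultiplicity ω (g i) ∣ g i := pow_rootMultiplicity_dvd (g i) ω
      generalize rootMultiplicity ω (g i) = a at h3 h4
      generalize rootMultiplicity ω (g i₀) + 1 = b at h3 ⊢
      exact Dvd.dvd.trans (pow_dvd_pow (X - C ω : F[X]) h3 : (X - C ω : F[X]) ^ b ∣ (X - C ω : F[X]) ^ a) h4
  have h3 : (X - C ω) ^ (rootMultiplicity ω (g i₀) + 1) ∣ g i₀ := by
    have h5 := eq_neg_of_add_eq_zero_left h0
    generalize rootMultiplicity ω (g i₀) + 1 = b at hdvd ⊢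
    rw [h5]
    exact (dvd_neg).2 hdvd
  have := (le_rootMultiplicity_iff hi₀.2).2 h3
  omega

/-- The operator describing iterated derivatives of `k * f ^ c`: it satisfies
`f ^ l * (k * f ^ c)⁽ˡ⁾ = f ^ c * twistedDerivative f c l k`. -/
noncomputable def twistedDerivative (f : F[X]) (c : F) : ℕ → (F[X] →ₗ[F] F[X])
  | 0 => LinearMap.id
  | l + 1 => LinearMap.mulLeft F f ∘ₗ derivative ∘ₗ twistedDerivative f c l +
      LinearMap.mulLeft F (C (c - l) * derivative f) ∘ₗ twistedDerivative f c l

theorem pow_mul_iterate_derivative_mul_pow (f k : F[X]) (c l : ℕ) :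
    f ^ l * derivative^[l] (k * f ^ c) = f ^ c * twistedDerivative f (c : F) l k := by
  induction l with
  | zero => simp [twistedDerivative, mul_comm]
  | succ l ih =>
    have h := congrArg derivative ih
    rw [derivative_mul, derivative_mul, ← Function.iterate_succ_apply' derivative] at h
    simp only [twistedDerivative, LinearMap.add_apply, LinearMap.comp_apply,
      LinearMap.mulLeft_apply]
    set Z := derivative^[l + 1] (k * f ^ c)
    set Y := derivative^[l] (k * f ^ c)
    set T := twistedDerivative f (c : F) l k
    have e1 : f * derivative (f ^ l) * Y = C (l : F) * derivative f * (f ^ c * T) := by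
      rw [← ih]
      rcases l with _ | l
      · simp
      · rw [derivative_pow_succ]; push_cast [map_add, map_natCast]; ring
    have e2 : f * derivative (f ^ c) = C (c : F) * derivative f * f ^ c := by
      rcases c with _ | c
      · simp
      · rw [derivative_pow_succ]; push_cast [map_add, map_natCast]; ring
    have : f ^ (l + 1) * Z = f * (derivative (f ^ c) * T + f ^ c * derivative T)
        - f * derivative (f ^ l) * Y := by rw [← h]; ring
    rw [this, e1, mul_add, ← mul_assoc, e2, C_sub]
    ring

theorem twistedDerivative_mem_degreeLT (f : F[X]) (c : F) {D K : ℕ} (hf : f.natDegree ≤ D)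
    (l : ℕ) (k : F[X]) (hk : k.natDegree < K) :
    (twistedDerivative f c l k).natDegree < K + l * D := by
  induction l with
  | zero => simpa [twistedDerivative] using hk
  | succ l ih =>
    simp only [twistedDerivative, LinearMap.add_apply, LinearMap.comp_apply,
      LinearMap.mulLeft_apply]
    set T := twistedDerivative f c l k
    have hb : K + (l + 1) * D = (K + l * D) + D := by ring
    rw [hb]
    refine lt_of_le_of_lt (natDegree_add_le _ _) (max_lt ?_ ?_)
    · refine lt_of_le_of_lt natDegree_mul_le ?_
      have := natDegree_derivative_le T
      omega
    · refine lt_of_le_of_lt natDegree_mul_le ?_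
      have h1 : (C (c - l) * derivative f).natDegree ≤ D :=
        (natDegree_C_mul_le _ _).trans ((natDegree_derivative_le f).trans (by omega))
      omega

theorem iterate_derivative_mul_of_derivative_eq_zero (A B : F[X]) (hB : derivative B = 0) (l : ℕ) :
    derivative^[l] (A * B) = derivative^[l] A * B := by
  induction l with
  | zero => rfl
  | succ l ih =>
    rw [Function.iterate_succ_apply', ih, derivative_mul, hB, Function.iterate_succ_apply']
    simp

theorem stepanov_auxiliary_ne_zero (f : F[X]) (ω : F) (hω : f.IsRoot ω)
    (hω' : (derivative f).eval ω ≠ 0) {p m e J K : ℕ} (hme : (m + 1) * e + 1 = p) (hK : K ≤ e)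
    (k : Fin (m + 1) × Fin J → F[X]) (hk : ∀ ij, (k ij).natDegree < K) (hne : ∃ ij, k ij ≠ 0) :
    ∑ ij, k ij * f ^ (e * ij.1) * (X - C ω) ^ (p * ij.2) ≠ 0 := by
  classical
  have hf0 : f ≠ 0 := by rintro rfl; simp at hω'
  have hfm : rootMultiplicity ω f = 1 := by
    have h1 : 0 < rootMultiplicity ω f := (rootMultiplicity_pos hf0).2 hω
    by_contra hcon
    have h2 : 1 < rootMultiplicity ω f := by omega
    have := (one_lt_rootMultiplicity_iff_isRoot hf0).1 h2
    exact hω' this.2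
  have hX : ∀ j, ((X - C ω) ^ j : F[X]) ≠ 0 := fun j => pow_ne_zero _ (X_sub_C_ne_zero ω)
  have hterm : ∀ ij : Fin (m + 1) × Fin J, k ij ≠ 0 →
      rootMultiplicity ω (k ij * f ^ (e * ij.1) * (X - C ω) ^ (p * ij.2)) =
        rootMultiplicity ω (k ij) + e * ij.1 + p * ij.2 := by
    intro ij h
    rw [rootMultiplicity_mul (mul_ne_zero (mul_ne_zero h (pow_ne_zero _ hf0)) (hX _)),
      rootMultiplicity_mul (mul_ne_zero h (pow_ne_zero _ hf0)), rootMultiplicity_X_sub_C_pow,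
      ← count_roots (f ^ _), roots_pow, Multiset.count_nsmul, count_roots, hfm, mul_one]
  have hlt : ∀ ij, rootMultiplicity ω (k ij) < e := fun ij => by
    by_cases h : k ij = 0
    · have := hk ij; rw [h, rootMultiplicity_zero]; omega
    · have h1 : rootMultiplicity ω (k ij) ≤ (k ij).natDegree := by
        have := natDegree_le_of_dvd (pow_rootMultiplicity_dvd (k ij) ω) h
        simpa using this
      have := hk ij; omega
  refine sum_ne_zero_of_rootMultiplicity_injOn _ _ ω ?_ ?_
  · rintro ij - ij' - h h' heq
    have hz : k ij ≠ 0 := fun hz => h (by simp [hz])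
    have hz' : k ij' ≠ 0 := fun hz => h' (by simp [hz])
    rw [hterm _ hz, hterm _ hz'] at heq
    have key : ∀ ij : Fin (m + 1) × Fin J,
        (rootMultiplicity ω (k ij) + e * ij.1 + p * ij.2) / p = ij.2 ∧
        (rootMultiplicity ω (k ij) + e * ij.1 + p * ij.2) % p / e = ij.1 := by
      intro ij
      have h1 : rootMultiplicity ω (k ij) + e * ij.1 < p := by
        have h2 := hlt ij
        have h3 : e * ij.1 ≤ e * m := Nat.mul_le_mul_left _ (Nat.le_of_lt_succ ij.1.2)
        rw [← hme]; nlinarith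
      have he : 0 < e := lt_of_le_of_lt (Nat.zero_le _) (hlt ij)
      constructor
      · rw [Nat.add_mul_div_left _ _ (by omega), Nat.div_eq_of_lt h1, zero_add]
      · rw [Nat.add_mul_mod_self_left, Nat.mod_eq_of_lt h1, Nat.add_mul_div_left _ _ he,
          Nat.div_eq_of_lt (hlt ij), zero_add]
    have h1 := key ij
    have h2 := key ij'
    rw [heq] at h1
    exact Prod.ext (Fin.ext (h1.2.symm.trans h2.2)) (Fin.ext (h1.1.symm.trans h2.1))
  · obtain ⟨ij, h⟩ := hne
    exact ⟨ij, Finset.mem_univ _, mul_ne_zero (mul_ne_zero h (pow_ne_zero _ hf0)) (hX _)⟩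

theorem exists_stepanov_coefficients (f : F[X]) (α : F) {D m e M J K : ℕ} (r : ℕ → F)
    (hf : f.natDegree ≤ D) (hK1 : 1 ≤ K)
    (hdim : m * M * (K + M * D + J) < (m + 1) * J * K) :
    ∃ k : Fin (m + 1) × Fin J → F[X], (∀ ij, (k ij).natDegree < K) ∧ (∃ ij, k ij ≠ 0) ∧
      ∀ (i : Fin m) (l : ℕ), l < M →
        ∑ j : Fin J, (X - C α) ^ (j : ℕ) *
          (twistedDerivative f ((e * i : ℕ) : F) l (k (i.castSucc, j)) +
            r i • twistedDerivative f ((e * m : ℕ) : F) l (k (Fin.last m, j))) = 0 := by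
  classical
  let pol : (ij : Fin (m + 1) × Fin J) →
      ((Fin (m + 1) × Fin J → degreeLT F K) →ₗ[F] F[X]) := fun ij =>
    (degreeLT F K).subtype ∘ₗ LinearMap.proj ij
  let G : Fin m → ℕ → ((Fin (m + 1) × Fin J → degreeLT F K) →ₗ[F] F[X]) := fun i l =>
    ∑ j : Fin J, LinearMap.mulLeft F ((X - C α) ^ (j : ℕ)) ∘ₗ
      (twistedDerivative f ((e * i : ℕ) : F) l ∘ₗ pol (i.castSucc, j) +
        r i • (twistedDerivative f ((e * m : ℕ) : F) l ∘ₗ pol (Fin.last m, j)))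
  let Φ : (Fin (m + 1) × Fin J → degreeLT F K) →ₗ[F]
      (Fin m × Fin M × Fin (K + M * D + J) → F) :=
    LinearMap.pi fun ilb => lcoeff F (ilb.2.2 : ℕ) ∘ₗ G ilb.1 ilb.2.1
  have hker : LinearMap.ker Φ ≠ ⊥ := by
    have : Module.Finite F (degreeLT F K) := Module.Finite.equiv (degreeLTEquiv F K).symm
    apply LinearMap.ker_ne_bot_of_finrank_lt
    have h1 : Module.finrank F (degreeLT F K) = K := by
      rw [LinearEquiv.finrank_eq (degreeLTEquiv F K)]; simp
    have h2 : Module.finrank F (Fin (m + 1) × Fin J → degreeLT F K) = (m + 1) * J * K := by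
      rw [Module.finrank_pi_fintype]; simp [h1]
    rw [h2, Module.finrank_fintype_fun_eq_card]
    simpa [mul_assoc] using hdim
  obtain ⟨v, hv, hv0⟩ := (Submodule.ne_bot_iff _).1 hker
  have hdeg : ∀ ij, ((v ij : degreeLT F K) : F[X]).natDegree < K := fun ij => by
    have h := mem_degreeLT.1 (v ij).2
    by_cases h0 : ((v ij : degreeLT F K) : F[X]) = 0
    · rw [h0, natDegree_zero]; omega
    · exact (natDegree_lt_iff_degree_lt h0).2 h
  refine ⟨fun ij => (v ij : F[X]), hdeg, ?_, ?_⟩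
  · by_contra hcon
    push Not at hcon
    exact hv0 (funext fun ij => Subtype.ext (hcon ij))
  · intro i l hl
    have hG : G i l v = ∑ j : Fin J, (X - C α) ^ (j : ℕ) *
          (twistedDerivative f ((e * i : ℕ) : F) l (v (i.castSucc, j)) +
            r i • twistedDerivative f ((e * m : ℕ) : F) l (v (Fin.last m, j))) := by
      simp [G, pol]
    rw [← hG]
    have hbound : (G i l v).natDegree < K + M * D + J := by
      rw [hG]
      refine lt_of_le_of_lt (b := K + M * D + J - 1) (natDegree_sum_le_of_forall_le _ _ fun j _ => ?_) (by omega)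
      refine natDegree_mul_le.trans ?_
      rw [natDegree_pow, natDegree_X_sub_C, mul_one]
      have e1 := twistedDerivative_mem_degreeLT f ((e * i : ℕ) : F) hf l _ (hdeg (i.castSucc, j))
      have e2 := twistedDerivative_mem_degreeLT f ((e * m : ℕ) : F) hf l _ (hdeg (Fin.last m, j))
      have e3 := natDegree_smul_le (r i)
        (twistedDerivative f ((e * m : ℕ) : F) l (v (Fin.last m, j)))
      have e4 : l * D ≤ M * D := Nat.mul_le_mul_right _ hl.le
      have e5 := natDegree_add_le (twistedDerivative f ((e * i : ℕ) : F) l (v (i.castSucc, j)))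
        (r i • twistedDerivative f ((e * m : ℕ) : F) l (v (Fin.last m, j)))
      have := j.2
      omega
    ext b
    by_cases hb : b < K + M * D + J
    · have := congrFun (LinearMap.mem_ker.1 hv) (i, ⟨l, hl⟩, ⟨b, hb⟩)
      simpa [Φ] using this
    · rw [coeff_eq_zero_of_natDegree_lt (by omega), coeff_zero]

end Stepanov

section StepanovBound

variable {F : Type*} [Field F]

theorem stepanov_contradiction {p : ℕ} [Fact p.Prime] [Algebra (ZMod p) F] (f : F[X]) (ω : F)
    (hω : f.IsRoot ω) (hω' : (derivative f).eval ω ≠ 0) {D m e : ℕ} (r : ℕ → F)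
    (hf : f.natDegree ≤ D) (hme : (m + 1) * e + 1 = p)
    (he : (m + 1) * ((m + 1) * D + 1) ^ 2 * (D + 1) ≤ e)
    (hr : ∀ x : ZMod p, (f.eval (algebraMap (ZMod p) F x) ^ e) ^ m =
      ∑ i : Fin m, r i * (f.eval (algebraMap (ZMod p) F x) ^ e) ^ (i : ℕ))
    (hx0 : ∀ x : ZMod p, f.eval (algebraMap (ZMod p) F x) ≠ 0) : False := by
  classical
  have hcp : CharP F p := charP_of_injective_algebraMap (algebraMap (ZMod p) F).injective p
  set M := (m + 1) * D + 1 with hM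
  set J := m * D + 1 with hJ
  set K := (m + 1) * M ^ 2 * (D + 1) with hK
  have hMJ : M = J + D := by rw [hM, hJ]; ring
  have hK1 : 1 ≤ K := by rw [hK, hM]; exact Nat.succ_le_of_lt (by positivity)
  have hdim : m * M * (K + M * D + J) < (m + 1) * J * K := by
    have h1 : (m + 1) * J * K = m * M * K + K := by rw [hM, hJ]; ring
    have h2 : m * M * (M * D + J) < K := by
      have : M * D + J ≤ M * (D + 1) := by rw [hMJ]; nlinarith
      calc m * M * (M * D + J) ≤ m * M * (M * (D + 1)) := Nat.mul_le_mul_left _ this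
        _ < K := by
          rw [hK]
          have : 0 < M ^ 2 * (D + 1) := by positivity
          nlinarith
    rw [h1]
    nlinarith
  obtain ⟨k, hkdeg, hkne, hk⟩ :=
    exists_stepanov_coefficients (e := e) f (ω ^ p) r hf hK1 hdim
  have hΨ := stepanov_auxiliary_ne_zero f ω hω hω' hme he k hkdeg hkne
  set Ψ := ∑ ij : Fin (m + 1) × Fin J, k ij * f ^ (e * ij.1) * (X - C ω) ^ (p * ij.2) with hΨdef
  have hMK : M ≤ K := by
    rw [hK]
    have h1 : 1 ≤ (m + 1) * M * (D + 1) := by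
      have : 1 ≤ M := by omega
      have := Nat.mul_le_mul (Nat.mul_le_mul (show 1 ≤ m + 1 by omega) this) (show 1 ≤ D + 1 by omega)
      simpa using this
    calc M = 1 * M := by ring
      _ ≤ ((m + 1) * M * (D + 1)) * M := Nat.mul_le_mul_right _ h1
      _ = _ := by ring
  have hKp : K < p := by nlinarith
  have hderX : ∀ j : ℕ, derivative ((X - C ω : F[X]) ^ (p * j)) = 0 := fun j => by
    rw [derivative_pow]; simp
  have hpow : ∀ x : ZMod p, ∀ j : ℕ, (algebraMap (ZMod p) F x - ω) ^ (p * j) =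
      (algebraMap (ZMod p) F x - ω ^ p) ^ j := fun x j => by
    rw [pow_mul, sub_pow_char, ← map_pow, ZMod.pow_card]
  have hmult : ∀ x : ZMod p, M ≤ rootMultiplicity (algebraMap (ZMod p) F x) Ψ := by
    intro x
    set t := algebraMap (ZMod p) F x
    have hM1 : M = (M - 1) + 1 := by omega
    rw [hM1, Nat.succ_le_iff, lt_rootMultiplicity_iff_isRoot_iterate_derivative_of_mem_nonZeroDivisors hΨ]
    · intro l hl
      have hl' : l < M := by omega
      rw [IsRoot]
      have hfl : f.eval t ^ l ≠ 0 := pow_ne_zero _ (hx0 x)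
      refine (mul_eq_zero.1 ?_).resolve_left hfl
      have e1 : f ^ l * derivative^[l] Ψ = ∑ ij : Fin (m + 1) × Fin J,
          f ^ (e * ij.1) * twistedDerivative f ((e * ij.1 : ℕ) : F) l (k ij)
            * (X - C ω) ^ (p * ij.2) := by
        rw [hΨdef, iterate_derivative_sum, Finset.mul_sum]
        refine Finset.sum_congr rfl fun ij _ => ?_
        rw [iterate_derivative_mul_of_derivative_eq_zero _ _ (hderX _), ← mul_assoc,
          pow_mul_iterate_derivative_mul_pow]
      have e2 := congrArg (eval t) e1
      rw [eval_mul, eval_pow] at e2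
      rw [e2, eval_finsetSum]
      simp only [eval_mul, eval_pow, eval_sub, eval_X, eval_C, hpow, t]
      rw [Fintype.sum_prod_type, Fin.sum_univ_castSucc]
      simp only [Fin.val_castSucc, Fin.val_last]
      have e3 : ∀ i : Fin m, ∑ j : Fin J, (t - ω ^ p) ^ (j : ℕ) *
          ((twistedDerivative f ((e * i : ℕ) : F) l (k (i.castSucc, j))).eval t +
            r i * (twistedDerivative f ((e * m : ℕ) : F) l (k (Fin.last m, j))).eval t) = 0 := by
        intro i
        have := congrArg (eval t) (hk i l hl')
        simpa [eval_finsetSum] using this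
      have e4 : ∑ i : Fin m, f.eval t ^ (e * i) * ∑ j : Fin J, (t - ω ^ p) ^ (j : ℕ) *
          ((twistedDerivative f ((e * i : ℕ) : F) l (k (i.castSucc, j))).eval t +
            r i * (twistedDerivative f ((e * m : ℕ) : F) l (k (Fin.last m, j))).eval t) = 0 :=
        Finset.sum_eq_zero fun i _ => by rw [e3 i, mul_zero]
      rw [← e4]
      have e5 : f.eval t ^ (e * m) = ∑ i : Fin m, r i * f.eval t ^ (e * i) := by
        have := hr x
        simpa [pow_mul] using this
      simp only [t] at e5 ⊢
      rw [e5]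
      simp only [Finset.sum_mul, Finset.mul_sum]
      rw [Finset.sum_comm (s := (Finset.univ : Finset (Fin J))), ← Finset.sum_add_distrib]
      refine Finset.sum_congr rfl fun i _ => ?_
      rw [← Finset.sum_add_distrib]
      refine Finset.sum_congr rfl fun j _ => ?_
      ring
    · rw [mem_nonZeroDivisors_iff_ne_zero]
      rw [Ne, CharP.cast_eq_zero_iff F p, (Fact.out : p.Prime).dvd_factorial]
      omega
  have hprod : ∏ x : ZMod p, (X - C (algebraMap (ZMod p) F x)) ^ M ∣ Ψ := by
    refine Finset.prod_dvd_of_coprime ?_ fun x _ => (le_rootMultiplicity_iff hΨ).1 (hmult x)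
    intro x _ y _ hxy
    refine IsCoprime.pow (pairwise_coprime_X_sub_C (s := fun x : ZMod p => algebraMap (ZMod p) F x)
      (algebraMap (ZMod p) F).injective hxy)
  have hd1 := natDegree_le_of_dvd hprod hΨ
  rw [natDegree_prod _ _ (fun x _ => pow_ne_zero _ (X_sub_C_ne_zero _))] at hd1
  simp only [natDegree_pow, natDegree_X_sub_C, mul_one, Finset.sum_const, Finset.card_univ,
    ZMod.card, smul_eq_mul] at hd1
  have hd2 : Ψ.natDegree ≤ K + D * p + p * (J - 1) := by
    refine natDegree_sum_le_of_forall_le _ _ fun ij _ => ?_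
    refine natDegree_mul_le.trans (Nat.add_le_add (natDegree_mul_le.trans
      (Nat.add_le_add (hkdeg ij).le ?_)) ?_)
    · refine natDegree_pow_le.trans ?_
      have h1 : e * (ij.1 : ℕ) ≤ p := by
        have : (ij.1 : ℕ) ≤ m := Nat.le_of_lt_succ ij.1.2
        nlinarith
      rw [mul_comm D]
      exact Nat.mul_le_mul h1 hf
    · rw [natDegree_pow, natDegree_X_sub_C, mul_one]
      exact Nat.mul_le_mul_left _ (by have := ij.2.2; omega)
  have h3 : p * M = p * (J - 1) + p + D * p := by
    have : J = (J - 1) + 1 := by omega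
    rw [hMJ]
    conv_lhs => rw [this]
    ring
  omega

theorem exists_bezout_of_squarefree {f : ℤ[X]} (hsf : Squarefree (f.map (Int.castRingHom ℚ))) :
    ∃ Δ : ℤ, Δ ≠ 0 ∧ ∃ u v : ℤ[X], u * f + v * derivative f = C Δ := by
  have hsep : (f.map (Int.castRingHom ℚ)).Separable := PerfectField.separable_iff_squarefree.2 hsf
  obtain ⟨a, b, hab⟩ := hsep
  obtain ⟨A, hA, hA'⟩ := IsLocalization.integerNormalization_spec (nonZeroDivisors ℤ) a
  obtain ⟨B, hB, hB'⟩ := IsLocalization.integerNormalization_spec (nonZeroDivisors ℤ) b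
  have hA0 := nonZeroDivisors.ne_zero hA
  have hB0 := nonZeroDivisors.ne_zero hB
  set a' := IsLocalization.integerNormalization (nonZeroDivisors ℤ) a
  set b' := IsLocalization.integerNormalization (nonZeroDivisors ℤ) b
  have ha : a'.map (Int.castRingHom ℚ) = C (A : ℚ) * a := by
    rw [← algebraMap_int_eq, hA', ← Int.cast_smul_eq_zsmul ℚ, smul_eq_C_mul]
  have hb : b'.map (Int.castRingHom ℚ) = C (B : ℚ) * b := by
    rw [← algebraMap_int_eq, hB', ← Int.cast_smul_eq_zsmul ℚ, smul_eq_C_mul]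
  refine ⟨A * B, mul_ne_zero hA0 hB0, C B * a', C A * b', ?_⟩
  apply map_injective (Int.castRingHom ℚ) Int.cast_injective
  rw [derivative_map] at hab
  have hC : ∀ z : ℤ, (C z).map (Int.castRingHom ℚ) = C (z : ℚ) := fun z => by rw [Polynomial.map_C]; rfl
  simp only [Polynomial.map_add, Polynomial.map_mul, hC, ha, hb, C_mul]
  calc _ = C (A : ℚ) * C (B : ℚ) * (a * map (Int.castRingHom ℚ) f + b * map (Int.castRingHom ℚ) (derivative f)) := by ring
    _ = _ := by rw [hab, mul_one]

theorem ZMod.exists_pow_eq_of_pow_div_gcd_eq_one {p : ℕ} [Fact p.Prime] {n e : ℕ}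
    (he : Nat.gcd n (p - 1) * e = p - 1) {z : ZMod p} (hz : z ^ e = 1) : ∃ w : ZMod p, w ^ n = z := by
  have hp1 : 0 < p - 1 := by have := (Fact.out : p.Prime).two_le; omega
  have he0 : e ≠ 0 := by rintro rfl; omega
  have hz0 : z ≠ 0 := by rintro rfl; simp [he0] at hz
  obtain ⟨g, hg⟩ := IsCyclic.exists_generator (α := (ZMod p)ˣ)
  obtain ⟨k, hk⟩ := Subgroup.mem_zpowers_iff.1 (hg (Units.mk0 z hz0))
  have hord : orderOf g = p - 1 := by
    rw [orderOf_eq_card_of_forall_mem_zpowers hg, Nat.card_eq_fintype_card, ZMod.card_units]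
  have h1 : g ^ (k * e) = 1 := by
    rw [zpow_mul, hk]
    ext; simpa using hz
  have h2 : ((p - 1 : ℕ) : ℤ) ∣ k * e := by
    rw [← hord]; exact orderOf_dvd_iff_zpow_eq_one.2 h1
  rw [← he] at h2
  push_cast at h2
  have h3 := Int.dvd_of_mul_dvd_mul_right (by exact_mod_cast he0) h2
  obtain ⟨t, ht⟩ := h3
  have h4 := Int.gcd_eq_gcd_ab n ((p - 1 : ℕ) : ℤ)
  have h5 : ((Int.gcd n ((p - 1 : ℕ) : ℤ) : ℕ) : ℤ) = (Nat.gcd n (p - 1) : ℤ) := by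
    rw [Int.gcd_natCast_natCast]
  rw [h5] at h4
  refine ⟨((g ^ (Int.gcdA n ((p - 1 : ℕ) : ℤ) * t) : (ZMod p)ˣ) : ZMod p), ?_⟩
  have h6 : (g ^ (Int.gcdA n ((p - 1 : ℕ) : ℤ) * t)) ^ n = Units.mk0 z hz0 := by
    rw [← hk, ht, h4, ← zpow_natCast, ← zpow_mul, add_mul, zpow_add]
    have : g ^ (((p - 1 : ℕ) : ℤ) * Int.gcdB n ((p - 1 : ℕ) : ℤ) * t) = 1 := by
      rw [mul_assoc, zpow_mul, zpow_natCast, ← hord, pow_orderOf_eq_one, one_zpow]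
    rw [this, mul_one]
    congr 1; ring
  have := congrArg (Units.val) h6
  simpa using this

/-- For all large primes, every unramified twist of a superelliptic curve has a point modulo `p`. -/
theorem exists_twist_point_zmod {n : ℕ} (hn : 1 ≤ n) {f : ℤ[X]}
    (hsf : Squarefree (f.map (Int.castRingHom ℚ))) (hdeg : 0 < f.natDegree) :
    ∃ P₀ : ℕ, ∀ p : ℕ, p.Prime → P₀ < p → ∀ u : ZMod p, u ≠ 0 →
      ∃ x y : ZMod p, u * y ^ n = aeval x f := by
  classical
  obtain ⟨Δ, hΔ, U, V, hUV⟩ := exists_bezout_of_squarefree hsf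
  set D := f.natDegree with hD
  have hlead : f.leadingCoeff ≠ 0 := by
    rw [Ne, leadingCoeff_eq_zero]; rintro rfl; simp [hD] at hdeg
  refine ⟨Δ.natAbs + f.leadingCoeff.natAbs + n * (n * (n * D + 1) ^ 2 * (D + 1)) + 1, ?_⟩
  intro p hp hpP u hu
  have := Fact.mk hp
  by_contra hcon
  push Not at hcon
  have hcast : ∀ z : ℤ, z ≠ 0 → z.natAbs < p → (z : ZMod p) ≠ 0 := fun z hz hzp h => by
    rw [ZMod.intCast_zmod_eq_zero_iff_dvd] at h
    have := Int.natAbs_dvd_natAbs.2 h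
    have := Nat.le_of_dvd (Int.natAbs_pos.2 hz) this
    simp at this; omega
  have hΔp := hcast Δ hΔ (by omega)
  have hlp := hcast _ hlead (by omega)
  have hfx : ∀ x : ZMod p, aeval x f ≠ 0 := fun x h => hcon x 0 (by
    rw [h, zero_pow (by omega), mul_zero])
  set m := Nat.gcd n (p - 1) with hm
  have hm0 : 0 < m := Nat.gcd_pos_of_pos_left _ (by omega)
  have hmn : m ≤ n := Nat.gcd_le_left _ (by omega)
  obtain ⟨e, he⟩ : m ∣ p - 1 := Nat.gcd_dvd_right _ _
  obtain ⟨m', hm'⟩ : ∃ m', m = m' + 1 := ⟨m - 1, by omega⟩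
  set F := AlgebraicClosure (ZMod p)
  set fF : F[X] := f.map (algebraMap ℤ F) with hfF
  have hfFeval : ∀ x : ZMod p, fF.eval (algebraMap (ZMod p) F x) = algebraMap (ZMod p) F (aeval x f) := by
    intro x
    rw [hfF, eval_map_algebraMap, aeval_algebraMap_apply]
  have hdegF : fF.natDegree = D := by
    apply natDegree_map_of_leadingCoeff_ne_zero
    have : (algebraMap ℤ F) f.leadingCoeff = algebraMap (ZMod p) F (f.leadingCoeff : ZMod p) := by simp
    rw [this, Ne, map_eq_zero]; exact hlp
  obtain ⟨ω, hω⟩ := IsAlgClosed.exists_root fF (by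
    rw [degree_eq_natDegree (by rintro h; rw [h] at hdegF; simp at hdegF; omega), hdegF]
    exact_mod_cast hdeg.ne')
  have hω' : (derivative fF).eval ω ≠ 0 := by
    intro h
    have := congrArg (fun q => eval ω (q.map (algebraMap ℤ F))) hUV
    simp only [Polynomial.map_add, Polynomial.map_mul, map_C, eval_add, eval_mul, eval_C] at this
    rw [← derivative_map, ← hfF, h, hω.eq_zero] at this
    simp only [mul_zero, add_zero] at this
    have h2 : (algebraMap ℤ F) Δ = algebraMap (ZMod p) F (Δ : ZMod p) := by simp
    rw [h2] at this
    exact hΔp ((map_eq_zero _).1 this.symm)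
  have hpow1 : ∀ z : ZMod p, z ≠ 0 → (z ^ e) ^ (m' + 1) = 1 := fun z hz => by
    rw [← pow_mul, mul_comm, ← hm', ← he, ZMod.pow_card_sub_one_eq_one hz]
  have hrel : ∀ x : ZMod p, ((aeval x f) ^ e) ^ m' =
      ∑ i : Fin m', (-(u ^ e) ^ (m' - i)) * ((aeval x f) ^ e) ^ (i : ℕ) := by
    intro x
    set v := (aeval x f) ^ e
    have hne : v ≠ u ^ e := by
      intro h
      have : (aeval x f * u⁻¹) ^ e = 1 := by
        rw [mul_pow, inv_pow, ← h, mul_inv_cancel₀]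
        exact pow_ne_zero _ (hfx x)
      obtain ⟨w, hw⟩ := ZMod.exists_pow_eq_of_pow_div_gcd_eq_one (n := n) he.symm this
      apply hcon x w
      rw [hw]; field_simp
    have hg := (Commute.all v (u ^ e)).geom_sum₂_mul (m' + 1)
    rw [hpow1 _ (hfx x), hpow1 _ hu, sub_self] at hg
    have hg' := (mul_eq_zero.1 hg).resolve_right (sub_ne_zero.2 hne)
    rw [Finset.sum_range_succ] at hg'
    simp only [Nat.add_sub_cancel, Nat.sub_self, pow_zero, mul_one] at hg'
    rw [eq_neg_of_add_eq_zero_right hg', ← Finset.sum_neg_distrib, Finset.sum_range]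
    exact Finset.sum_congr rfl fun i _ => by ring
  refine stepanov_contradiction (p := p) fF ω hω hω' (D := D) (m := m') (e := e)
    (fun i => algebraMap (ZMod p) F (-(u ^ e) ^ (m' - i))) hdegF.le
    (by rw [← hm', ← he]; have := hp.two_le; omega) ?_ ?_ ?_
  · have h1 : (m' + 1) * ((m' + 1) * D + 1) ^ 2 * (D + 1) ≤ n * (n * D + 1) ^ 2 * (D + 1) := by
      rw [← hm']; gcongr
    refine h1.trans ?_
    by_contra hlt
    push Not at hlt
    have : p - 1 ≤ n * (n * (n * D + 1) ^ 2 * (D + 1)) := by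
      rw [he]; exact Nat.mul_le_mul hmn hlt.le
    omega
  · intro x
    rw [hfFeval, ← map_pow, ← map_pow, hrel x, map_sum]
    exact Finset.sum_congr rfl fun i _ => by rw [map_mul, map_pow, map_pow]
  · intro x
    rw [hfFeval, Ne, map_eq_zero]
    exact hfx x

end StepanovBound


/-- There is a nonconstant rational polynomial mapping `S` into `{0, 1}` and having all its
critical values in `{0, 1}`. -/
def HasBelyiPolynomial (S : Set (AlgebraicClosure ℚ)) : Prop :=
  ∃ φ : ℚ[X], 0 < φ.natDegree ∧ (∀ s ∈ S, aeval s φ = 0 ∨ aeval s φ = 1) ∧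
    ∀ β : AlgebraicClosure ℚ, aeval β (derivative φ) = 0 → aeval β φ = 0 ∨ aeval β φ = 1

theorem HasBelyiPolynomial.mono {S T : Set (AlgebraicClosure ℚ)} (hST : S ⊆ T)
    (hT : HasBelyiPolynomial T) : HasBelyiPolynomial S := by
  obtain ⟨φ, h0, h1, h2⟩ := hT
  exact ⟨φ, h0, fun s hs => h1 s (hST hs), h2⟩

theorem HasBelyiPolynomial.of_comp {S T : Set (AlgebraicClosure ℚ)} (h : ℚ[X])
    (hh : 0 < h.natDegree) (hS : ∀ s ∈ S, aeval s h ∈ T)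
    (hcrit : ∀ β : AlgebraicClosure ℚ, aeval β (derivative h) = 0 → aeval β h ∈ T)
    (hT : HasBelyiPolynomial T) : HasBelyiPolynomial S := by
  obtain ⟨φ, h0, h1, h2⟩ := hT
  refine ⟨φ.comp h, by rw [natDegree_comp]; positivity, fun s hs => ?_, fun β hβ => ?_⟩
  · rw [aeval_comp]; exact h1 _ (hS s hs)
  · rw [derivative_comp, map_mul, aeval_comp] at hβ
    rw [aeval_comp]
    rcases mul_eq_zero.mp hβ with hβ | hβ
    · exact h1 _ (hcrit β hβ)
    · exact h2 _ hβ

theorem hasBelyiPolynomial_pair {a b : ℚ} (hab : a ≠ b) :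
    HasBelyiPolynomial (algebraMap ℚ (AlgebraicClosure ℚ) '' {a, b}) := by
  have hba : (b - a)⁻¹ ≠ 0 := inv_ne_zero (sub_ne_zero.mpr hab.symm)
  refine ⟨C (b - a)⁻¹ * (X - C a), ?_, ?_, ?_⟩
  · rw [natDegree_C_mul hba, natDegree_X_sub_C]; exact one_pos
  · rintro _ ⟨x, hx, rfl⟩
    rw [aeval_algebraMap_apply]
    rcases hx with rfl | rfl
    · left; simp
    · right
      simp [sub_ne_zero.mpr hab.symm]
  · intro β hβ
    have hba' : ((b - a : ℚ) : AlgebraicClosure ℚ) ≠ 0 := Rat.cast_ne_zero.mpr (sub_ne_zero.mpr hab.symm)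
    rw [Rat.cast_sub] at hba'
    simp [hba'] at hβ

/-- The polynomial `κ (X - a) ^ p (c - X) ^ q` used to merge three rational points. -/
theorem exists_merging_polynomial {a b c : ℚ} (hab : a < b) (hbc : b < c) :
    ∃ h : ℚ[X], 0 < h.natDegree ∧ h.eval a = 0 ∧ h.eval c = 0 ∧ h.eval b = 1 ∧
      ∀ β : AlgebraicClosure ℚ, aeval β (derivative h) = 0 → aeval β h = 0 ∨ aeval β h = 1 := by
  obtain ⟨p, q, hp, hq, hpq⟩ : ∃ p q : ℕ, 0 < p ∧ 0 < q ∧ (p : ℚ) * (c - b) = q * (b - a) := by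
    have hr : 0 < (b - a) / (c - b) := div_pos (by linarith) (by linarith)
    refine ⟨((b - a) / (c - b)).num.toNat, ((b - a) / (c - b)).den, ?_, Rat.den_pos _, ?_⟩
    · have := Rat.num_pos.mpr hr
      omega
    · have h1 : ((((b - a) / (c - b)).num.toNat : ℕ) : ℚ) = (((b - a) / (c - b)).num : ℚ) := by
        have := Int.toNat_of_nonneg (Rat.num_pos.mpr hr).le
        exact_mod_cast this
      rw [h1]
      have h2 := Rat.num_div_den ((b - a) / (c - b))
      have h3 : (((b - a) / (c - b)).den : ℚ) ≠ 0 := by exact_mod_cast Rat.den_nz _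
      have h4 : c - b ≠ 0 := by linarith
      rw [div_eq_iff h3] at h2
      rw [h2]; field_simp
  set κ : ℚ := ((b - a) ^ p * (c - b) ^ q)⁻¹ with hκ
  have hκ0 : κ ≠ 0 := by
    have h1 : 0 < b - a := by linarith
    have h2 : 0 < c - b := by linarith
    rw [hκ]; positivity
  have hba : b - a ≠ 0 := by linarith
  have hcb : c - b ≠ 0 := by linarith
  have hdeg : (C κ * ((X - C a) ^ p * (C c - X) ^ q) : ℚ[X]).natDegree = p + q := by
    have e : (C c - X : ℚ[X]) = - (X - C c) := by ring
    rw [natDegree_C_mul hκ0, natDegree_mul (pow_ne_zero _ (X_sub_C_ne_zero a))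
      (pow_ne_zero _ (by rw [e]; exact neg_ne_zero.mpr (X_sub_C_ne_zero c))), natDegree_pow,
      natDegree_pow, e, natDegree_neg, natDegree_X_sub_C, natDegree_X_sub_C]
    ring
  refine ⟨C κ * ((X - C a) ^ p * (C c - X) ^ q), by omega, by simp [hp.ne'], by simp [hq.ne'],
    ?_, fun β hβ => ?_⟩
  · simp only [eval_mul, eval_C, eval_pow, eval_sub, eval_X]
    rw [hκ]; field_simp
  · obtain ⟨p, rfl⟩ : ∃ k, p = k + 1 := ⟨p - 1, by omega⟩
    obtain ⟨q, rfl⟩ : ∃ k, q = k + 1 := ⟨q - 1, by omega⟩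
    set A : AlgebraicClosure ℚ := algebraMap ℚ _ a with hA
    set B : AlgebraicClosure ℚ := algebraMap ℚ _ b with hB
    set E : AlgebraicClosure ℚ := algebraMap ℚ _ c with hE
    have hpq' : ((p + 1 : ℕ) : AlgebraicClosure ℚ) * (E - B) = ((q + 1 : ℕ) : _) * (B - A) := by
      have := congrArg (algebraMap ℚ (AlgebraicClosure ℚ)) hpq
      simpa only [map_mul, map_sub, map_natCast] using this
    have hκ0' : algebraMap ℚ (AlgebraicClosure ℚ) κ ≠ 0 := by simpa using hκ0
    have e1 : aeval β (derivative (C κ * ((X - C a) ^ (p + 1) * (C c - X) ^ (q + 1)) : ℚ[X])) =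
        algebraMap ℚ (AlgebraicClosure ℚ) κ * ((β - A) ^ p * (E - β) ^ q *
          (((p + 1 : ℕ) : AlgebraicClosure ℚ) * (E - β) - ((q + 1 : ℕ) : _) * (β - A))) := by
      simp only [derivative_mul, derivative_pow, derivative_X,
        derivative_C, map_mul, map_add, map_sub, map_pow, aeval_X, aeval_C, map_one, map_zero,
        ← hA, ← hE, map_natCast, Nat.add_sub_cancel]
      ring
    rw [e1, mul_eq_zero, or_iff_right hκ0', mul_eq_zero, mul_eq_zero] at hβ
    have e2 : aeval β (C κ * ((X - C a) ^ (p + 1) * (C c - X) ^ (q + 1)) : ℚ[X]) =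
        algebraMap ℚ (AlgebraicClosure ℚ) κ * ((β - A) ^ (p + 1) * (E - β) ^ (q + 1)) := by
      simp only [map_mul, map_sub, map_pow, aeval_X, aeval_C, ← hA, ← hE]
    rw [e2]
    rcases hβ with (hβ | hβ) | hβ
    · left; rw [pow_succ, hβ]; ring
    · left; rw [pow_succ (E - β), hβ]; ring
    · right
      have hs : ((p + 1 : ℕ) : AlgebraicClosure ℚ) + ((q + 1 : ℕ) : _) ≠ 0 := by
        rw [← Nat.cast_add]; exact Nat.cast_ne_zero.mpr (by omega)
      have : β = B := by
        apply mul_left_cancel₀ hs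
        linear_combination hpq' - hβ
      rw [this, hA, hB, hE, ← map_sub, ← map_sub, ← map_pow, ← map_pow, ← map_mul, ← map_mul, hκ,
        inv_mul_cancel₀, map_one]
      exact mul_ne_zero (pow_ne_zero _ hba) (pow_ne_zero _ hcb)

theorem hasBelyiPolynomial_rat (T : Finset ℚ) :
    HasBelyiPolynomial (algebraMap ℚ (AlgebraicClosure ℚ) '' (T : Set ℚ)) := by
  induction hk : T.card using Nat.strong_induction_on generalizing T with
  | _ k ih =>
    by_cases h2 : T.card ≤ 2
    · obtain ⟨a, b, hab, hT⟩ : ∃ a b : ℚ, a ≠ b ∧ T ⊆ {a, b} := by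
        obtain ⟨U, hTU, hU⟩ := Infinite.exists_superset_card_eq T 2 h2
        obtain ⟨a, b, hab, rfl⟩ := Finset.card_eq_two.mp hU
        exact ⟨a, b, hab, hTU⟩
      refine (hasBelyiPolynomial_pair hab).mono (Set.image_mono ?_)
      simpa [Set.insert_subset_iff] using Finset.coe_subset.mpr hT
    · push Not at h2
      have hne : T.Nonempty := Finset.card_pos.mp (by omega)
      set a := T.min' hne with ha
      set c := T.max' hne with hc
      obtain ⟨b, hb, hba, hbc⟩ : ∃ b ∈ T, b ≠ a ∧ b ≠ c := by
        have : 0 < ((T.erase a).erase c).card := by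
          have h1 := Finset.pred_card_le_card_erase (s := T) (a := a)
          have h3 := Finset.pred_card_le_card_erase (s := T.erase a) (a := c)
          omega
        obtain ⟨b, hb⟩ := Finset.card_pos.mp this
        simp only [Finset.mem_erase] at hb
        exact ⟨b, hb.2.2, hb.2.1, hb.1⟩
      have hab : a < b := lt_of_le_of_ne (T.min'_le b hb) hba.symm
      have hbc' : b < c := lt_of_le_of_ne (T.le_max' b hb) hbc
      obtain ⟨h, hh, hha, hhc, hhb, hcrit⟩ := exists_merging_polynomial hab hbc'
      set T' : Finset ℚ := insert 0 (insert 1 ((((T.erase a).erase b).erase c).image h.eval))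
        with hT'
      have hcard : T'.card < k := by
        have h1 : (((T.erase a).erase b).erase c).card + 3 = T.card := by
          rw [Finset.card_erase_of_mem, Finset.card_erase_of_mem, Finset.card_erase_of_mem]
          · omega
          · exact T.min'_mem hne
          · exact Finset.mem_erase.mpr ⟨hba, hb⟩
          · exact Finset.mem_erase.mpr ⟨hbc.symm, Finset.mem_erase.mpr
              ⟨(hab.trans hbc').ne', T.max'_mem hne⟩⟩
        have h3 : T'.card ≤ (((T.erase a).erase b).erase c).card + 1 + 1 :=
          (Finset.card_insert_le _ _).trans (Nat.add_le_add_right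
            ((Finset.card_insert_le _ _).trans (Nat.add_le_add_right Finset.card_image_le 1)) 1)
        omega
      refine HasBelyiPolynomial.of_comp h hh ?_ ?_ (ih _ hcard T' rfl)
      · rintro _ ⟨x, hx, rfl⟩
        rw [aeval_algebraMap_apply]
        refine ⟨aeval x h, ?_, rfl⟩
        rw [coe_aeval_eq_eval]
        simp only [hT', Finset.mem_coe, Finset.mem_insert, Finset.mem_image, Finset.mem_erase]
        by_cases hxa : x = a
        · left; rw [hxa, hha]
        by_cases hxb : x = b
        · right; left; rw [hxb, hhb]
        by_cases hxc : x = c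
        · left; rw [hxc, hhc]
        · right; right
          exact ⟨x, ⟨hxc, hxb, hxa, hx⟩, rfl⟩
      · intro β hβ
        rcases hcrit β hβ with e | e
        · exact ⟨0, by simp [hT'], by rw [e, map_zero]⟩
        · exact ⟨1, by simp [hT'], by rw [e, map_one]⟩

theorem isIntegral_algebraicClosure_rat (β : AlgebraicClosure ℚ) : IsIntegral ℚ β :=
  (AlgebraicClosure.isAlgebraic ℚ).isIntegral.isIntegral β

theorem natDegree_minpoly_aeval_le (β : AlgebraicClosure ℚ) (h : ℚ[X]) :
    (minpoly ℚ (aeval β h)).natDegree ≤ (minpoly ℚ β).natDegree := by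
  have hβ : IsIntegral ℚ β := isIntegral_algebraicClosure_rat β
  have hγ : IsIntegral ℚ (aeval β h) := isIntegral_algebraicClosure_rat _
  rw [← IntermediateField.adjoin.finrank hβ, ← IntermediateField.adjoin.finrank hγ]
  have hle : IntermediateField.adjoin ℚ {aeval β h} ≤ IntermediateField.adjoin ℚ {β} := by
    rw [IntermediateField.adjoin_simple_le_iff]
    exact IntermediateField.algebra_adjoin_le_adjoin _ _ (aeval_mem_adjoin_singleton ℚ β)
  have : FiniteDimensional ℚ (IntermediateField.adjoin ℚ {β}) :=
    IntermediateField.adjoin.finiteDimensional hβ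
  exact LinearMap.finrank_le_finrank_of_injective
    (f := (IntermediateField.inclusion hle).toLinearMap)
    (IntermediateField.inclusion_injective hle)

theorem natDegree_minpoly_le_of_aeval_eq_zero {β : AlgebraicClosure ℚ} {g : ℚ[X]} (hg : g ≠ 0)
    (h : aeval β g = 0) : (minpoly ℚ β).natDegree ≤ g.natDegree :=
  natDegree_le_of_dvd (minpoly.dvd ℚ β h) hg

theorem hasBelyiPolynomial_finset (S : Finset (AlgebraicClosure ℚ)) :
    HasBelyiPolynomial (S : Set (AlgebraicClosure ℚ)) := by
  classical
  suffices H : ∀ n k : ℕ, ∀ S : Finset (AlgebraicClosure ℚ),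
      (∀ s ∈ S, (minpoly ℚ s).natDegree ≤ n + 1) →
      (S.filter fun s => (minpoly ℚ s).natDegree = n + 1).card ≤ k →
      HasBelyiPolynomial (S : Set (AlgebraicClosure ℚ)) by
    refine H (S.sup fun s => (minpoly ℚ s).natDegree) _ S (fun s hs => ?_) le_rfl
    have := Finset.le_sup (f := fun s => (minpoly ℚ s).natDegree) hs
    exact this.trans (Nat.le_succ _)
  intro n
  induction n with
  | zero =>
    intro k S hS _
    have hr : ∀ s ∈ S, s ∈ (algebraMap ℚ (AlgebraicClosure ℚ)).range := by
      intro s hs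
      have h1 : (minpoly ℚ s).natDegree = 1 := le_antisymm (hS s hs)
        (minpoly.natDegree_pos (isIntegral_algebraicClosure_rat s))
      exact minpoly.natDegree_eq_one_iff.mp h1
    obtain ⟨T, hT⟩ : ∃ T : Finset ℚ, (S : Set (AlgebraicClosure ℚ)) ⊆
        algebraMap ℚ (AlgebraicClosure ℚ) '' (T : Set ℚ) := by
      refine ⟨S.preimage (algebraMap ℚ _) (FaithfulSMul.algebraMap_injective _ _).injOn, ?_⟩
      intro s hs
      obtain ⟨q, hq⟩ := hr s hs
      exact ⟨q, by simpa [hq] using hs, hq⟩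
    exact (hasBelyiPolynomial_rat T).mono hT
  | succ n ihn =>
    intro k
    induction k with
    | zero =>
      intro S hS hk
      refine ihn _ S (fun s hs => ?_) le_rfl
      have h1 := hS s hs
      have h2 : (minpoly ℚ s).natDegree ≠ n + 1 + 1 := fun e => by
        have := Finset.card_pos.mpr
            ⟨s, Finset.mem_filter (p := fun s => (minpoly ℚ s).natDegree = n + 1 + 1).mpr ⟨hs, e⟩⟩
        omega
      omega
    | succ k ihk =>
      intro S hS hk
      by_cases hex : ∃ α ∈ S, (minpoly ℚ α).natDegree = n + 1 + 1
      swap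
      · push Not at hex
        exact ihk S hS (by rw [Finset.filter_false_of_mem hex]; simp)
      obtain ⟨α, hα, hαd⟩ := hex
      set h := minpoly ℚ α with hh
      have hh' : derivative h ≠ 0 := fun e => by
        have := derivative_eq_zero.mp e
        omega
      set T := S.image (fun s => aeval s h) ∪
        ((derivative h).aroots (AlgebraicClosure ℚ)).toFinset.image (fun s => aeval s h) with hT
      have hcritdeg : ∀ β : AlgebraicClosure ℚ, aeval β (derivative h) = 0 →
          (minpoly ℚ (aeval β h)).natDegree ≤ n + 1 := by
        intro β hβ
        have h1 := natDegree_minpoly_aeval_le β h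
        have h2 := natDegree_minpoly_le_of_aeval_eq_zero hh' hβ
        have h3 := natDegree_derivative_le h
        omega
      refine HasBelyiPolynomial.of_comp h (by omega) ?_ ?_ (ihk T ?_ ?_)
      · intro s hs
        simp only [hT, Finset.coe_union, Set.mem_union, Finset.coe_image]
        exact Or.inl ⟨s, hs, rfl⟩
      · intro β hβ
        simp only [hT, Finset.coe_union, Set.mem_union, Finset.coe_image]
        refine Or.inr ⟨β, ?_, rfl⟩
        exact Multiset.mem_toFinset.mpr (mem_aroots.mpr ⟨hh', hβ⟩)
      · intro t ht
        rcases Finset.mem_union.mp ht with ht | ht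
        · obtain ⟨s, hs, rfl⟩ := Finset.mem_image.mp ht
          exact (natDegree_minpoly_aeval_le s h).trans (hS s hs)
        · obtain ⟨s, hs, rfl⟩ := Finset.mem_image.mp ht
          have := hcritdeg s (mem_aroots.mp (Multiset.mem_toFinset.mp hs)).2
          omega
      · have hsub : T.filter (fun s => (minpoly ℚ s).natDegree = n + 1 + 1) ⊆
            ((S.filter fun s => (minpoly ℚ s).natDegree = n + 1 + 1).erase α).image
              (fun s => aeval s h) := by
          intro t ht
          obtain ⟨ht, htd⟩ := Finset.mem_filter.mp ht
          rcases Finset.mem_union.mp ht with ht | ht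
          · obtain ⟨s, hs, rfl⟩ := Finset.mem_image.mp ht
            refine Finset.mem_image.mpr ⟨s, Finset.mem_erase.mpr ⟨?_, Finset.mem_filter.mpr
              ⟨hs, ?_⟩⟩, rfl⟩
            · rintro rfl
              simp only [hh, minpoly.aeval, minpoly.zero, natDegree_X] at htd
              omega
            · have h1 := natDegree_minpoly_aeval_le s h
              have h2 := hS s hs
              omega
          · obtain ⟨s, hs, rfl⟩ := Finset.mem_image.mp ht
            have := hcritdeg s (mem_aroots.mp (Multiset.mem_toFinset.mp hs)).2
            omega
        have h1 := (Finset.card_le_card hsub).trans Finset.card_image_le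
        rw [Finset.card_erase_of_mem (Finset.mem_filter.mpr ⟨hα, hαd⟩)] at h1
        omega

theorem dvd_of_rootMultiplicity_algebraicClosure_le {p q : ℚ[X]} (hp : p ≠ 0)
    (h : ∀ β : AlgebraicClosure ℚ, rootMultiplicity β (p.map (algebraMap ℚ (AlgebraicClosure ℚ))) ≤
      rootMultiplicity β (q.map (algebraMap ℚ (AlgebraicClosure ℚ)))) : p ∣ q := by
  classical
  rw [← map_dvd_map' (algebraMap ℚ (AlgebraicClosure ℚ))]
  refine (IsAlgClosed.splits _).dvd_of_roots_le_roots ?_ ?_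
  · exact (Polynomial.map_ne_zero_iff (algebraMap ℚ (AlgebraicClosure ℚ)).injective).mpr hp
  · rw [Multiset.le_iff_count]
    intro β
    rw [count_roots, count_roots]
    exact h β

theorem rootMultiplicity_pow_of_ne_zero {R : Type*} [CommRing R] [IsDomain R] {p : R[X]}
    (hp : p ≠ 0) (x : R) (k : ℕ) :
    rootMultiplicity x (p ^ k) = k * rootMultiplicity x p := by
  induction k with
  | zero =>
    rw [pow_zero, zero_mul, rootMultiplicity_eq_zero_iff]
    intro h
    simp at h
  | succ k ih =>
    rw [pow_succ, rootMultiplicity_mul (mul_ne_zero (pow_ne_zero _ hp) hp), ih]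
    ring

theorem rootMultiplicity_le_one_of_squarefree {p : ℚ[X]} (hp : Squarefree p)
    (β : AlgebraicClosure ℚ) :
    rootMultiplicity β (p.map (algebraMap ℚ (AlgebraicClosure ℚ))) ≤ 1 := by
  classical
  have h1 : (p.map (algebraMap ℚ (AlgebraicClosure ℚ))).Separable :=
    (PerfectField.separable_iff_squarefree.mpr hp).map
  have h2 := nodup_roots h1
  rw [← count_roots]
  exact Multiset.nodup_iff_count_le_one.mp h2 β

theorem rootMultiplicity_le_natDegree_of_ne_zero {R : Type*} [CommRing R] [IsDomain R] {p : R[X]}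
    (x : R) : rootMultiplicity x p ≤ p.natDegree := by
  classical
  rw [← count_roots]
  exact (Multiset.count_le_card _ _).trans (card_roots' p)

theorem exists_belyi_factorization {f : ℚ[X]} (hsf : Squarefree f) :
    ∃ φ G E : ℚ[X], 0 < φ.natDegree ∧ G ≠ 0 ∧ f.natDegree + G.natDegree = φ.natDegree + 1 ∧
      (f * G) ^ (2 * φ.natDegree) = φ * (φ - 1) * E := by
  classical
  have hf0 : f ≠ 0 := hsf.ne_zero
  set i := algebraMap ℚ (AlgebraicClosure ℚ) with hi
  have hinj : Function.Injective i := i.injective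
  obtain ⟨φ, hN, hφf, hφc⟩ := hasBelyiPolynomial_finset
    (f.aroots (AlgebraicClosure ℚ)).toFinset
  have hφ0 : φ ≠ 0 := fun e => by simp [e] at hN
  have hφ1 : φ - 1 ≠ 0 := fun e => by
    rw [sub_eq_zero] at e
    simp [e] at hN
  have hdeg1 : (φ - 1).natDegree = φ.natDegree := by
    rw [← C_1, natDegree_sub_C]
  have hφ' : derivative φ ≠ 0 := fun e => by
    have := derivative_eq_zero.mp e
    omega
  have hΦ0 : φ * (φ - 1) ≠ 0 := mul_ne_zero hφ0 hφ1
  have hm0 : ∀ {p : ℚ[X]}, p ≠ 0 → p.map i ≠ 0 := fun hp =>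
    (Polynomial.map_ne_zero_iff hinj).mpr hp
  have hroot : ∀ (p : ℚ[X]) (β : AlgebraicClosure ℚ), (p.map i).IsRoot β ↔ aeval β p = 0 :=
    fun p β => by rw [IsRoot, eval_map, aeval_def]
  have hmul : ∀ β : AlgebraicClosure ℚ, rootMultiplicity β ((φ * (φ - 1)).map i) =
      rootMultiplicity β (φ.map i) + rootMultiplicity β ((φ - 1).map i) := fun β => by
    rw [Polynomial.map_mul, rootMultiplicity_mul (mul_ne_zero (hm0 hφ0) (hm0 hφ1))]
  have hder : ∀ β : AlgebraicClosure ℚ, aeval β φ = 0 ∨ aeval β φ = 1 →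
      rootMultiplicity β ((derivative φ).map i) + 1 =
        rootMultiplicity β ((φ * (φ - 1)).map i) := by
    intro β hβ
    rw [hmul]
    rcases hβ with hβ | hβ
    · have h1 : (φ.map i).IsRoot β := (hroot _ _).mpr hβ
      have h2 : rootMultiplicity β ((φ - 1).map i) = 0 := by
        rw [rootMultiplicity_eq_zero_iff]
        intro h
        rw [hroot, map_sub, hβ, map_one] at h
        norm_num at h
      rw [h2, ← derivative_map, derivative_rootMultiplicity_of_root h1]
      have := (rootMultiplicity_pos (hm0 hφ0)).mpr h1
      omega
    · have h1 : ((φ - 1).map i).IsRoot β := by rw [hroot, map_sub, hβ, map_one, sub_self]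
      have h2 : rootMultiplicity β (φ.map i) = 0 := by
        rw [rootMultiplicity_eq_zero_iff]
        intro h
        rw [hroot, hβ] at h
        norm_num at h
      have h3 : derivative φ = derivative (φ - 1) := by simp
      rw [h2, h3, ← derivative_map, derivative_rootMultiplicity_of_root h1]
      have := (rootMultiplicity_pos (hm0 hφ1)).mpr h1
      omega
  have hder' : ∀ β : AlgebraicClosure ℚ, ¬ (aeval β φ = 0 ∨ aeval β φ = 1) →
      rootMultiplicity β ((derivative φ).map i) = 0 := by
    intro β hβ
    rw [rootMultiplicity_eq_zero_iff]
    intro h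
    exact absurd (hφc β ((hroot _ _).mp h)) hβ
  obtain ⟨W, hW⟩ : derivative φ ∣ φ * (φ - 1) := by
    refine dvd_of_rootMultiplicity_algebraicClosure_le hφ' fun β => ?_
    rw [← hi]
    by_cases hβ : aeval β φ = 0 ∨ aeval β φ = 1
    · have := hder β hβ
      omega
    · rw [hder' β hβ]; exact Nat.zero_le _
  have hW0 : W ≠ 0 := fun e => hΦ0 (by rw [hW, e, mul_zero])
  have hWm : ∀ β : AlgebraicClosure ℚ, rootMultiplicity β ((φ * (φ - 1)).map i) =
      rootMultiplicity β ((derivative φ).map i) + rootMultiplicity β (W.map i) := fun β => by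
    rw [hW, Polynomial.map_mul, rootMultiplicity_mul (mul_ne_zero (hm0 hφ') (hm0 hW0))]
  obtain ⟨G, hG⟩ : f ∣ W := by
    refine dvd_of_rootMultiplicity_algebraicClosure_le hf0 fun β => ?_
    rw [← hi]
    by_cases hβ : aeval β f = 0
    · have h1 := hφf β (by simpa [mem_aroots] using ⟨hf0, hβ⟩)
      have h2 := hder β h1
      have h3 := hWm β
      have h4 := rootMultiplicity_le_one_of_squarefree hsf β
      rw [← hi] at h4
      omega
    · rw [rootMultiplicity_eq_zero]
      · exact Nat.zero_le _
      · rwa [hroot]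
  have hG0 : G ≠ 0 := fun e => hW0 (by rw [hG, e, mul_zero])
  have hE : φ * (φ - 1) ∣ W ^ (2 * φ.natDegree) := by
    refine dvd_of_rootMultiplicity_algebraicClosure_le hΦ0 fun β => ?_
    rw [Polynomial.map_pow, rootMultiplicity_pow_of_ne_zero (hm0 hW0)]
    by_cases hβ : aeval β φ = 0 ∨ aeval β φ = 1
    · have h2 := hder β hβ
      have h3 := hWm β
      have h4 : rootMultiplicity β (W.map i) = 1 := by omega
      rw [h4, mul_one]
      refine (rootMultiplicity_le_natDegree_of_ne_zero β).trans ?_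
      refine natDegree_map_le.trans (natDegree_mul_le.trans ?_)
      omega
    · rw [hmul, rootMultiplicity_eq_zero, rootMultiplicity_eq_zero]
      · exact Nat.zero_le _
      · rw [hroot, map_sub, map_one, sub_eq_zero]; tauto
      · rw [hroot]; tauto
  obtain ⟨E, hE⟩ := hE
  refine ⟨φ, G, E, hN, hG0, ?_, by rw [← hG, hE]⟩
  have h1 : (φ * (φ - 1)).natDegree = φ.natDegree + φ.natDegree := by
    rw [natDegree_mul hφ0 hφ1, hdeg1]
  have h2 : (derivative φ).natDegree = φ.natDegree - 1 := natDegree_derivative φ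
  rw [hW, natDegree_mul hφ' hW0, h2, hG, natDegree_mul hf0 hG0] at h1
  omega

theorem exists_int_smul_eq_map (p : ℚ[X]) :
    ∃ m : ℤ, m ≠ 0 ∧ ∃ P : ℤ[X], P.map (Int.castRingHom ℚ) = C (m : ℚ) * p := by
  obtain ⟨A, hA, hA'⟩ := IsLocalization.integerNormalization_spec (nonZeroDivisors ℤ) p
  refine ⟨A, nonZeroDivisors.ne_zero hA,
    IsLocalization.integerNormalization (nonZeroDivisors ℤ) p, ?_⟩
  rw [← algebraMap_int_eq, hA', ← Polynomial.smul_eq_C_mul, Int.cast_smul_eq_zsmul]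

/-- The integral form of the Belyi factorization: `φ` and `c - φ` are divisors of a power of
`f * G`, up to constants. -/
theorem exists_int_belyi_factorization {f : ℤ[X]}
    (hsf : Squarefree (f.map (Int.castRingHom ℚ))) :
    ∃ (c k : ℤ) (φ G E : ℤ[X]), c ≠ 0 ∧ k ≠ 0 ∧ 0 < φ.natDegree ∧ G ≠ 0 ∧
      f.natDegree + G.natDegree = φ.natDegree + 1 ∧
      C k * (f * G) ^ (2 * φ.natDegree) = φ * (C c - φ) * E := by
  obtain ⟨φ, G, E, hN, hG, hdeg, h⟩ := exists_belyi_factorization hsf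
  have hinj : Function.Injective (Int.castRingHom ℚ) := (Int.castRingHom ℚ).injective_int
  obtain ⟨c, hc, φ₁, hφ₁⟩ := exists_int_smul_eq_map φ
  obtain ⟨g, hg, G₁, hG₁⟩ := exists_int_smul_eq_map G
  obtain ⟨e, he, E₁, hE₁⟩ := exists_int_smul_eq_map E
  have hc' : (c : ℚ) ≠ 0 := Int.cast_ne_zero.mpr hc
  have hg' : (g : ℚ) ≠ 0 := Int.cast_ne_zero.mpr hg
  have hdφ : φ₁.natDegree = φ.natDegree := by
    rw [← natDegree_map_eq_of_injective hinj, hφ₁, natDegree_C_mul hc']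
  have hdG : G₁.natDegree = G.natDegree := by
    rw [← natDegree_map_eq_of_injective hinj, hG₁, natDegree_C_mul hg']
  refine ⟨c, e * c ^ 2, φ₁, G₁, C (- g ^ (2 * φ.natDegree)) * E₁, hc,
    mul_ne_zero he (pow_ne_zero _ hc), by omega, ?_, ?_, ?_⟩
  · rintro rfl
    rw [Polynomial.map_zero] at hG₁
    exact mul_ne_zero (C_ne_zero.mpr hg') hG hG₁.symm
  · rw [hdφ, hdG, ← hdeg, natDegree_map_eq_of_injective hinj]
  · apply map_injective _ hinj
    have hC : ∀ z : ℤ, (C z : ℤ[X]).map (Int.castRingHom ℚ) = C (z : ℚ) := fun z => by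
      rw [map_C, eq_intCast]
    simp only [Polynomial.map_mul, Polynomial.map_pow, Polynomial.map_sub, Polynomial.map_neg, hC, hφ₁, hG₁, hE₁,
      hdφ, C_mul, C_pow, C_neg]
    linear_combination (C (e : ℚ) * C (c : ℚ) ^ 2 * C (g : ℚ) ^ (2 * φ.natDegree)) * h

/-- The binary form attached to `P`, evaluated at the numerator and denominator of `x`. -/
def homEval (P : ℤ[X]) (x : ℚ) : ℤ :=
  ∑ i ∈ Finset.range (P.natDegree + 1), P.coeff i * x.num ^ i * (x.den : ℤ) ^ (P.natDegree - i)

/-- The multiplicative height of a rational number. -/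
def ratHeight (x : ℚ) : ℕ := max x.num.natAbs x.den

theorem one_le_ratHeight (x : ℚ) : 1 ≤ ratHeight x := le_max_of_le_right x.den_pos

theorem homEval_cast (P : ℤ[X]) (x : ℚ) :
    (homEval P x : ℚ) = (x.den : ℚ) ^ P.natDegree * aeval x P := by
  rw [homEval, aeval_eq_sum_range, Finset.mul_sum]
  push_cast
  refine Finset.sum_congr rfl fun i hi => ?_
  have hi' : i ≤ P.natDegree := by
    have := Finset.mem_range.mp hi
    omega
  have hd : (x.den : ℚ) ≠ 0 := by exact_mod_cast x.den_nz
  have hx : (x.num : ℚ) = x * x.den := (Rat.mul_den_eq_num x).symm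
  rw [zsmul_eq_mul, hx, mul_pow]
  have : (x.den : ℚ) ^ P.natDegree = (x.den : ℚ) ^ i * (x.den : ℚ) ^ (P.natDegree - i) := by
    rw [← pow_add]
    congr 1
    omega
  rw [this]
  ring

theorem homEval_ne_zero_iff (P : ℤ[X]) (x : ℚ) : homEval P x ≠ 0 ↔ aeval x P ≠ 0 := by
  have hd : (x.den : ℚ) ≠ 0 := by exact_mod_cast x.den_nz
  rw [← Int.cast_ne_zero (α := ℚ), homEval_cast, mul_ne_zero_iff]
  exact and_iff_right (pow_ne_zero _ hd)

theorem homEval_mul (P Q : ℤ[X]) (x : ℚ) : homEval (P * Q) x = homEval P x * homEval Q x := by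
  by_cases hP : P = 0
  · simp [hP, homEval]
  by_cases hQ : Q = 0
  · simp [hQ, homEval]
  apply Int.cast_injective (α := ℚ)
  rw [Int.cast_mul, homEval_cast, homEval_cast, homEval_cast, natDegree_mul hP hQ, map_mul]
  ring

theorem homEval_C (k : ℤ) (x : ℚ) : homEval (C k) x = k := by
  simp [homEval]

theorem homEval_pow (P : ℤ[X]) (k : ℕ) (x : ℚ) : homEval (P ^ k) x = homEval P x ^ k := by
  induction k with
  | zero => rw [pow_zero, pow_zero, ← C_1, homEval_C]
  | succ k ih => rw [pow_succ, pow_succ, homEval_mul, ih]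

theorem homEval_C_sub {P : ℤ[X]} (c : ℤ) (x : ℚ) :
    homEval (C c - P) x = c * (x.den : ℤ) ^ P.natDegree - homEval P x := by
  have h : (C c - P).natDegree = P.natDegree := by
    rw [natDegree_sub, natDegree_sub_C]
  apply Int.cast_injective (α := ℚ)
  push_cast
  rw [homEval_cast, homEval_cast, h, map_sub, aeval_C]
  simp
  ring

theorem abs_num_le_ratHeight (x : ℚ) : |(x.num : ℝ)| ≤ ratHeight x := by
  rw [← Int.cast_abs, Int.abs_eq_natAbs]
  exact_mod_cast le_max_left _ _

theorem den_le_ratHeight (x : ℚ) : (x.den : ℝ) ≤ ratHeight x := by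
  exact_mod_cast le_max_right x.num.natAbs x.den

theorem abs_homEval_le (P : ℤ[X]) :
    ∃ S : ℝ, 1 ≤ S ∧ ∀ x : ℚ, |(homEval P x : ℝ)| ≤ S * (ratHeight x : ℝ) ^ P.natDegree := by
  refine ⟨1 + ∑ i ∈ Finset.range (P.natDegree + 1), |(P.coeff i : ℝ)|,
    le_add_of_nonneg_right (Finset.sum_nonneg fun _ _ => abs_nonneg _), fun x => ?_⟩
  have h : |(homEval P x : ℝ)| ≤
      (∑ i ∈ Finset.range (P.natDegree + 1), |(P.coeff i : ℝ)|) *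
        (ratHeight x : ℝ) ^ P.natDegree := by
    rw [homEval, Finset.sum_mul]
    push_cast
    refine (Finset.abs_sum_le_sum_abs _ _).trans (Finset.sum_le_sum fun i hi => ?_)
    have hi' : P.natDegree = i + (P.natDegree - i) := by
      have := Finset.mem_range.mp hi
      omega
    rw [abs_mul, abs_mul, abs_pow, abs_pow, Nat.abs_cast, mul_assoc]
    refine mul_le_mul_of_nonneg_left ?_ (abs_nonneg _)
    have e : (ratHeight x : ℝ) ^ P.natDegree =
        (ratHeight x : ℝ) ^ i * (ratHeight x : ℝ) ^ (P.natDegree - i) := by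
      rw [← pow_add, ← hi']
    rw [e]
    exact mul_le_mul (pow_le_pow_left₀ (abs_nonneg _) (abs_num_le_ratHeight x) _)
      (pow_le_pow_left₀ (Nat.cast_nonneg _) (den_le_ratHeight x) _) (by positivity) (by positivity)
  refine h.trans (mul_le_mul_of_nonneg_right ?_ (by positivity))
  linarith

theorem abs_leading_sub_homEval_le (P : ℤ[X]) :
    ∃ S : ℝ, 1 ≤ S ∧ ∀ x : ℚ, |(homEval P x : ℝ) - P.leadingCoeff * (x.num : ℝ) ^ P.natDegree| ≤
      S * x.den * (ratHeight x : ℝ) ^ (P.natDegree - 1) := by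
  refine ⟨1 + ∑ i ∈ Finset.range P.natDegree, |(P.coeff i : ℝ)|,
    le_add_of_nonneg_right (Finset.sum_nonneg fun _ _ => abs_nonneg _), fun x => ?_⟩
  have h : |(homEval P x : ℝ) - P.leadingCoeff * (x.num : ℝ) ^ P.natDegree| ≤
      (∑ i ∈ Finset.range P.natDegree, |(P.coeff i : ℝ)|) *
        (x.den * (ratHeight x : ℝ) ^ (P.natDegree - 1)) := by
    rw [homEval, Finset.sum_range_succ, Finset.sum_mul]
    push_cast
    rw [Nat.sub_self, pow_zero, mul_one, leadingCoeff, add_sub_cancel_right]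
    refine (Finset.abs_sum_le_sum_abs _ _).trans (Finset.sum_le_sum fun i hi => ?_)
    have hi' := Finset.mem_range.mp hi
    rw [abs_mul, abs_mul, abs_pow, abs_pow, Nat.abs_cast, mul_assoc]
    refine mul_le_mul_of_nonneg_left ?_ (abs_nonneg _)
    have e1 : P.natDegree - i = (P.natDegree - 1 - i) + 1 := by omega
    have e2 : P.natDegree - 1 = i + (P.natDegree - 1 - i) := by omega
    have e3 : (ratHeight x : ℝ) ^ (P.natDegree - 1) =
        (ratHeight x : ℝ) ^ i * (ratHeight x : ℝ) ^ (P.natDegree - 1 - i) := by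
      rw [← pow_add, ← e2]
    rw [e1, pow_succ, e3]
    have h1 := pow_le_pow_left₀ (abs_nonneg _) (abs_num_le_ratHeight x) i
    have h2 := pow_le_pow_left₀ (Nat.cast_nonneg _) (den_le_ratHeight x) (P.natDegree - 1 - i)
    have h3 := mul_le_mul h1 h2 (by positivity) (by positivity)
    nlinarith [h3, (Nat.cast_nonneg x.den : (0 : ℝ) ≤ x.den)]
  refine h.trans ?_
  rw [mul_assoc]
  refine mul_le_mul_of_nonneg_right ?_ (by positivity)
  linarith

theorem exists_le_max_homEval {P : ℤ[X]} (hP : 0 < P.natDegree) :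
    ∃ c₀ : ℝ, 0 < c₀ ∧ ∀ x : ℚ, c₀ * (ratHeight x : ℝ) ^ P.natDegree ≤
      max |(homEval P x : ℝ)| ((x.den : ℝ) ^ P.natDegree) := by
  obtain ⟨S, hS, h⟩ := abs_leading_sub_homEval_le P
  have hS0 : 0 < S := by linarith
  refine ⟨(1 / (2 * S)) ^ P.natDegree, by positivity, fun x => ?_⟩
  set H : ℝ := (ratHeight x : ℝ) with hH
  have hH1 : 1 ≤ H := by rw [hH]; exact_mod_cast one_le_ratHeight x
  by_cases hb : H / (2 * S) ≤ x.den
  · refine le_max_of_le_right ?_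
    rw [← mul_pow]
    refine pow_le_pow_left₀ (by positivity) ?_ _
    calc 1 / (2 * S) * H = H / (2 * S) := by ring
      _ ≤ _ := hb
  · push Not at hb
    refine le_max_of_le_left ?_
    have hlt : (x.den : ℝ) < H := hb.trans_le (div_le_self (by linarith) (by linarith))
    have ha : |(x.num : ℝ)| = H := by
      have h1 : x.den < ratHeight x := by
        rw [hH] at hlt
        exact_mod_cast hlt
      have h2 : ratHeight x = x.num.natAbs := by
        unfold ratHeight at h1 ⊢
        omega
      rw [hH, h2, Nat.cast_natAbs, Int.cast_abs]
    have hl : 1 ≤ |(P.leadingCoeff : ℝ)| := by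
      rw [← Int.cast_abs]
      have : P.leadingCoeff ≠ 0 := leadingCoeff_ne_zero.mpr fun e => by simp [e] at hP
      exact_mod_cast Int.one_le_abs this
    have h1 := h x
    have h2 : |(P.leadingCoeff : ℝ) * (x.num : ℝ) ^ P.natDegree| =
        |(P.leadingCoeff : ℝ)| * H ^ P.natDegree := by
      rw [abs_mul, abs_pow, ha]
    have h3 : |(P.leadingCoeff : ℝ) * (x.num : ℝ) ^ P.natDegree| - |(homEval P x : ℝ)| ≤
        |(homEval P x : ℝ) - P.leadingCoeff * (x.num : ℝ) ^ P.natDegree| := by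
      rw [abs_sub_comm]
      exact abs_sub_abs_le_abs_sub _ _
    have h4 : S * x.den * H ^ (P.natDegree - 1) ≤ H ^ P.natDegree / 2 := by
      have e : H ^ P.natDegree = H ^ (P.natDegree - 1) * H := by
        rw [← pow_succ]
        congr 1
        omega
      rw [lt_div_iff₀ (by positivity)] at hb
      rw [e]
      nlinarith [pow_pos (by linarith : 0 < H) (P.natDegree - 1)]
    have h5 : H ^ P.natDegree ≤ |(P.leadingCoeff : ℝ)| * H ^ P.natDegree :=
      le_mul_of_one_le_left (by positivity) hl
    have h6 : (1 / (2 * S)) ^ P.natDegree ≤ 1 / 2 := by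
      have h7 : 1 / (2 * S) ≤ 1 / 2 := by
        rw [div_le_div_iff₀ (by positivity) (by norm_num)]
        linarith
      exact (pow_le_of_le_one (by positivity) (by linarith) hP.ne').trans h7
    nlinarith [pow_pos (by linarith : 0 < H) P.natDegree]

theorem gcd_homEval_dvd (P : ℤ[X]) (x : ℚ) (c g : ℤ) (hA : g ∣ homEval P x)
    (hC : g ∣ c * (x.den : ℤ) ^ P.natDegree) :
    g ∣ c * P.leadingCoeff ^ P.natDegree := by
  set N := P.natDegree
  set A := homEval P x with hAdef
  set a := x.num
  set b : ℤ := (x.den : ℤ)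
  obtain ⟨t, ht⟩ : b ∣ A - P.leadingCoeff * a ^ N := by
    rw [hAdef, homEval, Finset.sum_range_succ, Nat.sub_self, pow_zero, mul_one, leadingCoeff,
      add_sub_cancel_right]
    refine Finset.dvd_sum fun i hi => ?_
    have hi' := Finset.mem_range.mp hi
    exact dvd_mul_of_dvd_right (dvd_pow_self _ (by omega)) _
  have h1 : g ∣ c * (P.leadingCoeff * a ^ N) ^ N := by
    have e : P.leadingCoeff * a ^ N = A - b * t := by linarith
    have h2 : g ∣ c * (A - b * t) ^ N - c * (-(b * t)) ^ N := by
      rw [← mul_sub]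
      refine dvd_mul_of_dvd_right (hA.trans ?_) _
      have := sub_dvd_pow_sub_pow (A - b * t) (-(b * t)) N
      simpa using this
    have h3 : g ∣ c * (-(b * t)) ^ N := by
      have e2 : c * (-(b * t)) ^ N = (c * b ^ N) * (-t) ^ N := by
        rw [← mul_neg, mul_pow]; ring
      rw [e2]
      exact dvd_mul_of_dvd_left hC _
    rw [e]
    have := dvd_add h2 h3
    simpa using this
  have hco : IsCoprime ((a ^ N) ^ N) (b ^ N) := by
    refine IsCoprime.pow (IsCoprime.pow_left ?_)
    rw [Int.isCoprime_iff_gcd_eq_one]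
    exact x.reduced
  obtain ⟨u, v, huv⟩ := hco
  have e3 : c * P.leadingCoeff ^ N = (c * (P.leadingCoeff * a ^ N) ^ N) * u +
      (c * b ^ N) * (P.leadingCoeff ^ N * v) := by
    rw [mul_pow]
    linear_combination (-(c * P.leadingCoeff ^ N)) * huv
  rw [e3]
  exact dvd_add (dvd_mul_of_dvd_left h1 _) (dvd_mul_of_dvd_left hC _)

theorem one_le_intRadical (m : ℤ) : 1 ≤ IntRadical m :=
  Finset.one_le_prod' fun _ hp => (Nat.prime_of_mem_primeFactors hp).one_le

theorem intRadical_le_natAbs {m : ℤ} (hm : m ≠ 0) : IntRadical m ≤ m.natAbs :=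
  Nat.le_of_dvd (Int.natAbs_pos.mpr hm) (Nat.prod_primeFactors_dvd _)

theorem intRadical_le_of_prime_dvd {a b : ℤ} (hb : b ≠ 0)
    (h : ∀ p : ℕ, p.Prime → (p : ℤ) ∣ a → (p : ℤ) ∣ b) : IntRadical a ≤ IntRadical b := by
  refine Finset.prod_le_prod_of_subset_of_one_le' (fun p hp => ?_) fun p hp _ =>
    (Nat.prime_of_mem_primeFactors hp).one_le
  have h1 := Nat.mem_primeFactors.mp hp
  refine Nat.mem_primeFactors.mpr ⟨h1.1, ?_, Int.natAbs_ne_zero.mpr hb⟩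
  exact Int.natCast_dvd.mp (h p h1.1 (Int.natCast_dvd.mpr h1.2.1))

theorem intRadical_mul_le {a b : ℤ} (ha : a ≠ 0) (hb : b ≠ 0) :
    IntRadical (a * b) ≤ IntRadical a * IntRadical b := by
  classical
  unfold IntRadical
  rw [Int.natAbs_mul, Nat.primeFactors_mul (Int.natAbs_ne_zero.mpr ha) (Int.natAbs_ne_zero.mpr hb),
    ← Finset.prod_union_inter]
  exact Nat.le_mul_of_pos_right _ (Finset.prod_pos fun p hp =>
    (Nat.prime_of_mem_primeFactors (Finset.mem_inter.mp hp).1).pos)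

/-- The abc conjecture applied to triples with a controlled common divisor. -/
theorem ABCConjecture.of_gcd_dvd (habc : ABCConjecture) {ε : ℝ} (hε : 0 < ε) :
    ∃ K : ℝ, 0 < K ∧ ∀ A B C g M : ℤ, A ≠ 0 → B ≠ 0 → C ≠ 0 → g ≠ 0 → M ≠ 0 → A + B = C →
      (∀ e : ℤ, e ∣ A → e ∣ C → e ∣ g) →
      (∀ p : ℕ, p.Prime → (p : ℤ) ∣ A * B * C → (p : ℤ) ∣ M) →
      max |(A : ℝ)| |(C : ℝ)| ≤ |(g : ℝ)| * K * (IntRadical M : ℝ) ^ (1 + ε) := by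
  obtain ⟨K, hK, h⟩ := habc ε hε
  refine ⟨K, hK, fun A B C g M hA hB hC hg hM hABC hgcd hprime => ?_⟩
  obtain ⟨g₀, A', C', hg₀, hco, hA', hC'⟩ :
      ∃ g₀ A' C' : ℤ, 0 < g₀ ∧ IsCoprime A' C' ∧ A = A' * g₀ ∧ C = C' * g₀ := by
    obtain ⟨A', C', h1, h2, h3⟩ := Int.exists_gcd_one (m := A) (n := C)
      (Int.gcd_pos_of_ne_zero_left _ hA)
    exact ⟨_, A', C', by exact_mod_cast Int.gcd_pos_of_ne_zero_left _ hA,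
      Int.isCoprime_iff_gcd_eq_one.mpr h1, h2, h3⟩
  have hA'0 : A' ≠ 0 := by rintro rfl; simp at hA'; exact hA hA'
  have hC'0 : C' ≠ 0 := by rintro rfl; simp at hC'; exact hC hC'
  have hB' : B = (C' - A') * g₀ := by rw [sub_mul, ← hA', ← hC']; linarith
  have hB'0 : C' - A' ≠ 0 := fun e => hB (by rw [hB', e, zero_mul])
  have hco1 : IsCoprime A' (C' - A') := by
    have := hco.add_mul_left_right (-1)
    have e : C' + A' * -1 = C' - A' := by ring
    rwa [e] at this
  have hco2 : IsCoprime (C' - A') C' := by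
    have := (hco.symm.add_mul_left_right (-1)).neg_right
    have e : -(A' + C' * -1) = C' - A' := by ring
    rw [e] at this
    exact this.symm
  have h1 := h A' (C' - A') C' hA'0 hB'0 hC'0 hco1 hco hco2 (by ring)
  have h2 : IntRadical (A' * (C' - A') * C') ≤ IntRadical M := by
    refine intRadical_le_of_prime_dvd hM fun p hp hd => hprime p hp (hd.trans ?_)
    rw [hA', hB', hC']
    exact ⟨g₀ ^ 3, by ring⟩
  have h3 : (IntRadical (A' * (C' - A') * C') : ℝ) ^ (1 + ε) ≤ (IntRadical M : ℝ) ^ (1 + ε) :=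
    Real.rpow_le_rpow (Nat.cast_nonneg _) (by exact_mod_cast h2) (by linarith)
  have h4 : (g₀ : ℝ) ≤ |(g : ℝ)| := by
    have h5 := hgcd g₀ ⟨A', by rw [hA']; ring⟩ ⟨C', by rw [hC']; ring⟩
    have h6 := Int.le_of_dvd (abs_pos.mpr hg) ((dvd_abs _ _).mpr h5)
    rw [← Int.cast_abs]
    exact_mod_cast h6
  have hg₀' : (0 : ℝ) < g₀ := by exact_mod_cast hg₀
  have h7 : max |(A' : ℝ)| |(C' : ℝ)| ≤ K * (IntRadical M : ℝ) ^ (1 + ε) := by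
    refine le_trans ?_ (h1.trans (mul_le_mul_of_nonneg_left h3 hK.le))
    push_cast
    exact max_le_max (le_max_left _ _) le_rfl
  have h8 : max |(A : ℝ)| |(C : ℝ)| = max |(A' : ℝ)| |(C' : ℝ)| * g₀ := by
    rw [hA', hC']
    push_cast
    rw [abs_mul, abs_mul, abs_of_pos hg₀', max_mul_of_nonneg _ _ hg₀'.le]
  rw [h8]
  calc max |(A' : ℝ)| |(C' : ℝ)| * g₀ ≤ (K * (IntRadical M : ℝ) ^ (1 + ε)) * |(g : ℝ)| :=
        mul_le_mul h7 h4 hg₀'.le (by positivity)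
    _ = _ := by ring

theorem exists_ratHeight_le_of_aeval_eq_zero {P : ℤ[X]} (hP : P ≠ 0) :
    ∃ H₀ : ℕ, 1 ≤ H₀ ∧ ∀ x : ℚ, aeval x P = 0 → ratHeight x ≤ H₀ := by
  refine ⟨max 1 ((P.aroots ℚ).toFinset.sup ratHeight), le_max_left _ _, fun x hx => ?_⟩
  refine le_max_of_le_right (Finset.le_sup ?_)
  exact Multiset.mem_toFinset.mpr (mem_aroots.mpr ⟨hP, hx⟩)

/-- The abc conjecture gives lower bounds for radicals of values of squarefree binary forms. -/
theorem ratHeight_rpow_le_intRadical (habc : ABCConjecture) {f : ℤ[X]}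
    (hsf : Squarefree (f.map (Int.castRingHom ℚ))) {κ : ℝ} (hκ0 : 0 ≤ κ)
    (hκ : κ < f.natDegree - 2) :
    ∃ C₁ : ℝ, 0 < C₁ ∧ ∀ x : ℚ, aeval x f ≠ 0 →
      (ratHeight x : ℝ) ^ κ ≤ C₁ * IntRadical (homEval f x) := by
  obtain ⟨c, k, φ, G, E, hc, hk, hN, hG, hdeg, hfac⟩ := exists_int_belyi_factorization hsf
  have hφ0 : φ ≠ 0 := fun e => by simp [e] at hN
  have hcφ0 : C c - φ ≠ 0 := fun e => by
    rw [sub_eq_zero] at e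
    simp [← e] at hN
  set N := φ.natDegree with hNdef
  have hNR : (0 : ℝ) < N := by exact_mod_cast hN
  set ε : ℝ := (f.natDegree - 2 - κ) / N with hεdef
  have hε : 0 < ε := div_pos (by linarith) hNR
  obtain ⟨K, hK, hKabc⟩ := habc.of_gcd_dvd hε
  obtain ⟨H₀, hH₀1, hH₀⟩ := exists_ratHeight_le_of_aeval_eq_zero
    (mul_ne_zero (mul_ne_zero hφ0 hcφ0) hG)
  obtain ⟨c₀, hc₀, hlow⟩ := exists_le_max_homEval hN
  obtain ⟨S, hS1, hS⟩ := abs_homEval_le G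
  set ℓ : ℤ := c * φ.leadingCoeff ^ N with hℓ
  have hℓ0 : ℓ ≠ 0 := mul_ne_zero hc (pow_ne_zero _ (leadingCoeff_ne_zero.mpr hφ0))
  have hS0 : 0 < S := by linarith
  have hck : (0 : ℝ) < |((c * k : ℤ) : ℝ)| := abs_pos.mpr (Int.cast_ne_zero.mpr (mul_ne_zero hc hk))
  set C₂ : ℝ := |(ℓ : ℝ)| * K / c₀ with hC₂
  have hC₂0 : 0 < C₂ := by
    have : (0 : ℝ) < |(ℓ : ℝ)| := abs_pos.mpr (Int.cast_ne_zero.mpr hℓ0)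
    positivity
  set C₃ : ℝ := C₂ ^ (1 / (1 + ε)) * (|((c * k : ℤ) : ℝ)| * S) with hC₃
  have hC₃0 : 0 < C₃ := by positivity
  refine ⟨max C₃ ((H₀ : ℝ) ^ κ), lt_max_of_lt_left hC₃0, fun x hx => ?_⟩
  have hR1 : (1 : ℝ) ≤ IntRadical (homEval f x) := by exact_mod_cast one_le_intRadical _
  by_cases hbad : aeval x (φ * (C c - φ) * G) = 0
  · have h1 : (ratHeight x : ℝ) ≤ H₀ := by exact_mod_cast hH₀ x hbad
    have h2 := Real.rpow_le_rpow (Nat.cast_nonneg _) h1 hκ0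
    calc _ ≤ (H₀ : ℝ) ^ κ := h2
      _ ≤ max C₃ ((H₀ : ℝ) ^ κ) := le_max_right _ _
      _ ≤ _ := le_mul_of_one_le_right (le_max_of_le_left hC₃0.le) hR1
  · refine le_trans ?_ (mul_le_mul_of_nonneg_right (le_max_left _ _) (by linarith))
    rw [map_mul, map_mul, mul_eq_zero, mul_eq_zero, not_or, not_or] at hbad
    obtain ⟨⟨hA, hB⟩, hGx⟩ := hbad
    have hA := (homEval_ne_zero_iff _ _).mpr hA
    have hB := (homEval_ne_zero_iff _ _).mpr hB
    have hGx := (homEval_ne_zero_iff _ _).mpr hGx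
    have hF := (homEval_ne_zero_iff _ _).mpr hx
    have hd : (x.den : ℤ) ≠ 0 := by exact_mod_cast x.den_nz
    set A := homEval φ x
    set B := homEval (C c - φ) x with hBdef
    set F := homEval f x
    set g := homEval G x
    have hfacx : k * (F * g) ^ (2 * N) = A * B * homEval E x := by
      have := congrArg (fun P => homEval P x) hfac
      simpa only [homEval_mul, homEval_pow, homEval_C] using this
    have hBeq : A + B = c * (x.den : ℤ) ^ N := by
      rw [hBdef, homEval_C_sub]; ring
    set H : ℝ := (ratHeight x : ℝ) with hH
    have hH1 : 1 ≤ H := by rw [hH]; exact_mod_cast one_le_ratHeight x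
    have hH0 : 0 < H := by linarith
    have hM0 : c * k * (x.den : ℤ) * g ≠ 0 := mul_ne_zero (mul_ne_zero (mul_ne_zero hc hk) hd) hGx
    have habcx := hKabc A B (c * (x.den : ℤ) ^ N) ℓ (c * k * (x.den : ℤ) * g * F) hA hB
      (mul_ne_zero hc (pow_ne_zero _ hd)) hℓ0 (mul_ne_zero hM0 hF) hBeq
      (fun e he1 he2 => gcd_homEval_dvd φ x c e he1 he2) (by
        intro p hp hpd
        have hp' : Prime (p : ℤ) := Nat.prime_iff_prime_int.mp hp
        rcases hp'.dvd_or_dvd hpd with h1 | h1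
        · have h2 : (p : ℤ) ∣ k * (F * g) ^ (2 * N) := by
            rw [hfacx]; exact dvd_mul_of_dvd_left h1 _
          rcases hp'.dvd_or_dvd h2 with h3 | h3
          · exact h3.trans ⟨c * (x.den : ℤ) * g * F, by ring⟩
          · exact (hp'.dvd_of_dvd_pow h3).trans ⟨c * k * (x.den : ℤ), by ring⟩
        · rcases hp'.dvd_or_dvd h1 with h3 | h3
          · exact h3.trans ⟨k * (x.den : ℤ) * g * F, by ring⟩
          · exact (hp'.dvd_of_dvd_pow h3).trans ⟨c * k * g * F, by ring⟩)
    set R : ℝ := (IntRadical F : ℝ) with hR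
    have hR0 : 0 < R := by linarith
    have hrad : (IntRadical (c * k * (x.den : ℤ) * g * F) : ℝ) ≤
        (|((c * k : ℤ) : ℝ)| * S) * H ^ (G.natDegree + 1) * R := by
      have h1 : IntRadical (c * k * (x.den : ℤ) * g * F) ≤
          (c * k * (x.den : ℤ) * g).natAbs * IntRadical F :=
        (intRadical_mul_le hM0 hF).trans (Nat.mul_le_mul_right _ (intRadical_le_natAbs hM0))
      have h2 : ((c * k * (x.den : ℤ) * g).natAbs : ℝ) ≤
          (|((c * k : ℤ) : ℝ)| * S) * H ^ (G.natDegree + 1) := by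
        rw [Nat.cast_natAbs, Int.cast_abs, Int.cast_mul, Int.cast_mul, abs_mul, abs_mul,
          Int.cast_natCast, Nat.abs_cast, mul_assoc, mul_assoc]
        refine mul_le_mul_of_nonneg_left ?_ hck.le
        calc (x.den : ℝ) * |(g : ℝ)| ≤ H * (S * H ^ G.natDegree) :=
              mul_le_mul (den_le_ratHeight x) (hS x) (abs_nonneg _) hH0.le
          _ = _ := by ring
      calc (IntRadical (c * k * (x.den : ℤ) * g * F) : ℝ) ≤
            ((c * k * (x.den : ℤ) * g).natAbs : ℝ) * R := by rw [hR]; exact_mod_cast h1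
        _ ≤ _ := mul_le_mul_of_nonneg_right h2 hR0.le
    have hlowx : c₀ * H ^ N ≤ max |(A : ℝ)| |((c * (x.den : ℤ) ^ N : ℤ) : ℝ)| := by
      refine (hlow x).trans (max_le_max le_rfl ?_)
      push_cast
      rw [abs_mul, abs_pow, Nat.abs_cast]
      refine le_mul_of_one_le_left (by positivity) ?_
      rw [← Int.cast_abs]
      exact_mod_cast Int.one_le_abs hc
    have hmain : H ^ N ≤ C₂ * ((|((c * k : ℤ) : ℝ)| * S) * H ^ (G.natDegree + 1) * R) ^ (1 + ε) := by
      have h1 : (IntRadical (c * k * (x.den : ℤ) * g * F) : ℝ) ^ (1 + ε) ≤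
          ((|((c * k : ℤ) : ℝ)| * S) * H ^ (G.natDegree + 1) * R) ^ (1 + ε) :=
        Real.rpow_le_rpow (Nat.cast_nonneg _) hrad (by linarith)
      rw [hC₂, div_mul_eq_mul_div, le_div_iff₀ hc₀]
      calc H ^ N * c₀ = c₀ * H ^ N := mul_comm _ _
        _ ≤ _ := hlowx.trans habcx
        _ ≤ _ := mul_le_mul_of_nonneg_left h1 (by positivity)
    have hε1 : 0 < 1 + ε := by linarith
    have hroot : H ^ ((N : ℝ) / (1 + ε)) ≤ C₃ * H ^ ((G.natDegree : ℝ) + 1) * R := by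
      have h1 := Real.rpow_le_rpow (by positivity) hmain (by positivity : 0 ≤ 1 / (1 + ε))
      rw [Real.mul_rpow hC₂0.le (by positivity), ← Real.rpow_mul (by positivity),
        mul_one_div_cancel hε1.ne', Real.rpow_one, ← Real.rpow_natCast H N,
        ← Real.rpow_mul hH0.le, mul_one_div, ← Real.rpow_natCast H (G.natDegree + 1)] at h1
      push_cast at h1
      rw [hC₃]
      push_cast
      calc _ ≤ _ := h1
        _ = _ := by ring
    have hexp : κ + ((G.natDegree : ℝ) + 1) ≤ (N : ℝ) / (1 + ε) := by
      have h1 : (f.natDegree : ℝ) + G.natDegree = N + 1 := by exact_mod_cast hdeg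
      have h2 : ε * N = f.natDegree - 2 - κ := by
        rw [hεdef]; field_simp
      rw [le_div_iff₀ hε1]
      have h3 : κ + ((G.natDegree : ℝ) + 1) = N - ε * N := by linarith
      rw [h3]
      nlinarith [mul_pos hε hε]
    have h9 : H ^ κ * H ^ ((G.natDegree : ℝ) + 1) ≤ C₃ * R * H ^ ((G.natDegree : ℝ) + 1) := by
      rw [← Real.rpow_add hH0]
      calc _ ≤ H ^ ((N : ℝ) / (1 + ε)) := Real.rpow_le_rpow_of_exponent_le hH1 hexp
        _ ≤ _ := hroot
        _ = _ := by ring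
    exact le_of_mul_le_mul_right h9 (by positivity)

theorem NthPowerFree.padicValInt_lt {n : ℕ} {d : ℤ} (h : NthPowerFree n d) (p : ℕ)
    (hp : p.Prime) : padicValInt p d < n := by
  have : Fact p.Prime := ⟨hp⟩
  by_contra hlt
  push Not at hlt
  exact h.2 p hp ((padicValInt_dvd_iff n d).mpr (Or.inr hlt))

theorem NthPowerFree.natAbs_eq_of_mul_pow_eq {n : ℕ} {d₁ d₂ : ℤ} (h₁ : NthPowerFree n d₁)
    (h₂ : NthPowerFree n d₂) {y₁ y₂ : ℚ} (hy₁ : y₁ ≠ 0) (hy₂ : y₂ ≠ 0)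
    (h : (d₁ : ℚ) * y₁ ^ n = d₂ * y₂ ^ n) : d₁.natAbs = d₂.natAbs := by
  rw [Nat.eq_iff_prime_padicValNat_eq _ _ (Int.natAbs_ne_zero.mpr h₁.1)
    (Int.natAbs_ne_zero.mpr h₂.1)]
  intro p hp
  have : Fact p.Prime := ⟨hp⟩
  have hv := congrArg (padicValRat p) h
  have hd₁ : (d₁ : ℚ) ≠ 0 := Int.cast_ne_zero.mpr h₁.1
  have hd₂ : (d₂ : ℚ) ≠ 0 := Int.cast_ne_zero.mpr h₂.1
  rw [padicValRat.mul hd₁ (pow_ne_zero _ hy₁), padicValRat.mul hd₂ (pow_ne_zero _ hy₂),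
    padicValRat.pow, padicValRat.pow, padicValRat.of_int, padicValRat.of_int] at hv
  have e1 := h₁.padicValInt_lt p hp
  have e2 := h₂.padicValInt_lt p hp
  have hv2 := congrArg (· % (n : ℤ)) hv
  simp only [Int.add_mul_emod_self_left] at hv2
  rw [Int.emod_eq_of_lt (Nat.cast_nonneg _) (by exact_mod_cast e1),
    Int.emod_eq_of_lt (Nat.cast_nonneg _) (by exact_mod_cast e2)] at hv2
  exact_mod_cast hv2

theorem intRadical_homEval_pow_dvd {n : ℕ} (hn : 1 ≤ n) {f : ℤ[X]} (hf : 0 < f.natDegree) {d : ℤ}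
    (hd : NthPowerFree n d) {x y : ℚ} (hxy : (d : ℚ) * y ^ n = aeval x f) (hx : aeval x f ≠ 0) :
    (IntRadical (homEval f x) : ℤ) ^ n ∣
      (f.leadingCoeff ^ f.natDegree) ^ n * d ^ (n - 1) * homEval f x := by
  have hF := (homEval_ne_zero_iff f x).mpr hx
  have hy : y ≠ 0 := by
    rintro rfl
    rw [zero_pow (by omega), mul_zero] at hxy
    exact hx hxy.symm
  have hdQ : (d : ℚ) ≠ 0 := Int.cast_ne_zero.mpr hd.1
  unfold IntRadical
  rw [Nat.cast_prod, ← Finset.prod_pow]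
  refine Finset.prod_dvd_of_coprime (fun p hp q hq hpq => ?_) fun p hp => ?_
  · refine IsCoprime.pow (Int.isCoprime_iff_gcd_eq_one.mpr ?_)
    exact (Nat.coprime_primes (Nat.prime_of_mem_primeFactors hp)
      (Nat.prime_of_mem_primeFactors hq)).mpr hpq
  · obtain ⟨hpp, hpF, -⟩ := Nat.mem_primeFactors.mp hp
    have hpF : (p : ℤ) ∣ homEval f x := Int.natCast_dvd.mpr hpF
    have : Fact p.Prime := ⟨hpp⟩
    by_cases hb : (p : ℤ) ∣ (x.den : ℤ)
    · have h1 := gcd_homEval_dvd f x 1 p hpF (by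
        rw [one_mul]
        exact dvd_pow hb (by omega))
      rw [one_mul] at h1
      exact dvd_mul_of_dvd_left (dvd_mul_of_dvd_left (pow_dvd_pow_of_dvd h1 n) _) _
    · rw [mul_assoc]
      refine dvd_mul_of_dvd_right ?_ _
      have hdn : d ^ (n - 1) ≠ 0 := pow_ne_zero _ hd.1
      rw [padicValInt_dvd_iff]
      right
      rw [padicValInt.mul hdn hF]
      have e0 : padicValInt p (d ^ (n - 1)) = (n - 1) * padicValInt p d := by
        unfold padicValInt
        rw [Int.natAbs_pow, padicValNat.pow]
      have e1 : 1 ≤ padicValInt p (homEval f x) := by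
        have := (padicValInt_dvd_iff (p := p) 1 (homEval f x)).mp (by simpa using hpF)
        tauto
      have e2 : (padicValInt p (homEval f x) : ℤ) = padicValInt p d + n * padicValRat p y := by
        rw [← padicValRat.of_int, homEval_cast, ← hxy, padicValRat.mul, padicValRat.mul hdQ
          (pow_ne_zero _ hy), padicValRat.pow, padicValRat.pow, padicValRat.of_int]
        · have h3 : padicValRat p (x.den : ℚ) = 0 := by
            rw [padicValRat.of_nat, padicValNat.eq_zero_of_not_dvd]
            · rfl
            · exact fun h => hb (by exact_mod_cast h)
          rw [h3]; ring
        · exact pow_ne_zero _ (by exact_mod_cast x.den_nz)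
        · exact mul_ne_zero hdQ (pow_ne_zero _ hy)
      rw [e0]
      rcases Nat.eq_zero_or_pos (padicValInt p d) with h0 | h0
      · rw [h0] at e2 ⊢
        have h4 : (n : ℤ) ∣ padicValInt p (homEval f x) := ⟨padicValRat p y, by simpa using e2⟩
        have h5 : n ≤ padicValInt p (homEval f x) := Nat.le_of_dvd (by omega) (by exact_mod_cast h4)
        omega
      · have : n - 1 ≤ (n - 1) * padicValInt p d := Nat.le_mul_of_pos_right _ h0
        omega

/-- Under the abc conjecture, few twists have a rational point. -/
theorem ncard_hasTwistPoint_rat_le (habc : ABCConjecture) {n : ℕ} (hn : 2 ≤ n) {f : ℤ[X]}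
    (hsf : Squarefree (f.map (Int.castRingHom ℚ)))
    (hdeg : (4 * (n : ℝ) - 2) / ((n : ℝ) - 1) < f.natDegree)
    (hroot : ∀ x : ℚ, aeval x f ≠ 0) :
    ∃ C θ : ℝ, 0 < C ∧ 0 < θ ∧ θ < 1 ∧ ∀ X : ℝ, 1 ≤ X →
      {d : ℤ | |(d : ℝ)| ≤ X ∧ NthPowerFree n d ∧ HasTwistPoint n f d ℚ}.Finite ∧
      ({d : ℤ | |(d : ℝ)| ≤ X ∧ NthPowerFree n d ∧ HasTwistPoint n f d ℚ}.ncard : ℝ) ≤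
        C * X ^ θ := by
  have hn' : (2 : ℝ) ≤ n := by exact_mod_cast hn
  set D : ℝ := (f.natDegree : ℝ) with hD
  rw [div_lt_iff₀ (by linarith)] at hdeg
  have hDpos : 0 < f.natDegree := by
    rw [Nat.pos_iff_ne_zero]
    intro h
    rw [hD, h] at hdeg
    norm_num at hdeg
    linarith
  set μ : ℝ := (D * (n - 1) - (4 * n - 2)) / 2 with hμ
  have hμ0 : 0 < μ := by rw [hμ]; linarith
  set κ : ℝ := D - 2 - μ / n with hκdef
  have hκn : n * κ - D = 2 * (n - 1) + μ := by
    have : (n : ℝ) * (μ / n) = μ := by field_simp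
    rw [hκdef, mul_sub, this, hμ]; ring
  have hκ0 : 0 ≤ κ := by
    have : 0 ≤ (n : ℝ) * κ := by
      have : (0 : ℝ) ≤ D := Nat.cast_nonneg _
      linarith
    exact nonneg_of_mul_nonneg_right this (by linarith)
  have hκlt : κ < D - 2 := by
    have : 0 < μ / n := by positivity
    linarith
  obtain ⟨C₁, hC₁, hC⟩ := ratHeight_rpow_le_intRadical habc hsf hκ0 hκlt
  obtain ⟨S, hS1, hS⟩ := abs_homEval_le f
  set ℓ : ℝ := |((f.leadingCoeff ^ f.natDegree : ℤ) : ℝ)| with hℓ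
  have hℓ0 : 0 ≤ ℓ := abs_nonneg _
  set τ : ℝ := 2 * (n - 1) + μ with hτ
  have hτ0 : 0 < τ := by linarith
  set C₂ : ℝ := C₁ ^ n * (ℓ ^ n * S) + 1 with hC₂
  have hC₂1 : 1 ≤ C₂ := by
    have : 0 ≤ C₁ ^ n * (ℓ ^ n * S) := by positivity
    linarith
  set ρ : ℝ := (n - 1) / τ with hρ
  have hρ0 : 0 < ρ := div_pos (by linarith) hτ0
  have hheight : ∀ X : ℝ, 1 ≤ X → ∀ d : ℤ, |(d : ℝ)| ≤ X → NthPowerFree n d → ∀ x y : ℚ,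
      (d : ℚ) * y ^ n = aeval x f → (ratHeight x : ℝ) ≤ C₂ ^ (1 / τ) * X ^ ρ := by
    intro X hX d hdX hd x y hxy
    have h1 := intRadical_homEval_pow_dvd (by omega) hDpos hd hxy (hroot x)
    have hF := (homEval_ne_zero_iff f x).mpr (hroot x)
    have hf0 : f.leadingCoeff ≠ 0 := leadingCoeff_ne_zero.mpr fun e => by simp [e] at hDpos
    set R : ℝ := (IntRadical (homEval f x) : ℝ) with hR
    set H : ℝ := (ratHeight x : ℝ) with hH
    have hH1 : 1 ≤ H := by rw [hH]; exact_mod_cast one_le_ratHeight x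
    have hH0 : 0 < H := by linarith
    have h2 : R ^ n ≤ ℓ ^ n * X ^ (n - 1) * (S * H ^ f.natDegree) := by
      have h3 := Int.le_of_dvd (abs_pos.mpr (mul_ne_zero (mul_ne_zero (pow_ne_zero _
        (pow_ne_zero _ hf0)) (pow_ne_zero _ hd.1)) hF)) ((dvd_abs _ _).mpr h1)
      have h4 : R ^ n ≤ |(((f.leadingCoeff ^ f.natDegree) ^ n * d ^ (n - 1) * homEval f x : ℤ) : ℝ)| := by
        rw [hR, ← Int.cast_abs]
        exact_mod_cast h3
      refine h4.trans ?_
      rw [Int.cast_mul, Int.cast_mul, abs_mul, abs_mul, Int.cast_pow, abs_pow, ← hℓ, Int.cast_pow,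
        abs_pow]
      exact mul_le_mul (mul_le_mul_of_nonneg_left (pow_le_pow_left₀ (abs_nonneg _) hdX _)
        (by positivity)) (hS x) (abs_nonneg _) (by positivity)
    have h5 : H ^ (n * κ) ≤ C₁ ^ n * R ^ n := by
      have := pow_le_pow_left₀ (by positivity) (hC x (hroot x)) n
      rw [mul_pow, ← Real.rpow_natCast (H ^ κ), ← Real.rpow_mul hH0.le, mul_comm κ] at this
      exact this
    have h6 : H ^ τ * H ^ D ≤ (C₂ * X ^ ((n : ℝ) - 1)) * H ^ D := by
      rw [← Real.rpow_add hH0, ← hκn, sub_add_cancel]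
      have hXn : X ^ ((n : ℝ) - 1) = X ^ (n - 1) := by
        rw [← Real.rpow_natCast X (n - 1), Nat.cast_sub (by omega), Nat.cast_one]
      have hHD : H ^ D = H ^ f.natDegree := by rw [hD, Real.rpow_natCast]
      rw [hXn, hHD]
      calc H ^ (n * κ) ≤ C₁ ^ n * R ^ n := h5
        _ ≤ C₁ ^ n * (ℓ ^ n * X ^ (n - 1) * (S * H ^ f.natDegree)) :=
            mul_le_mul_of_nonneg_left h2 (by positivity)
        _ = (C₁ ^ n * (ℓ ^ n * S)) * X ^ (n - 1) * H ^ f.natDegree := by ring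
        _ ≤ _ := by
            refine mul_le_mul_of_nonneg_right (mul_le_mul_of_nonneg_right ?_ (by positivity))
              (by positivity)
            rw [hC₂]; linarith
    have h7 : H ^ τ ≤ C₂ * X ^ ((n : ℝ) - 1) := le_of_mul_le_mul_right h6 (by positivity)
    have h8 := Real.rpow_le_rpow (by positivity) h7 (by positivity : 0 ≤ 1 / τ)
    rw [← Real.rpow_mul hH0.le, mul_one_div_cancel hτ0.ne', Real.rpow_one,
      Real.mul_rpow (by linarith) (by positivity), ← Real.rpow_mul (by linarith), mul_one_div,
      ← hρ] at h8
    exact h8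
  refine ⟨18 * (C₂ ^ (1 / τ)) ^ 2, 2 * ρ, by positivity, by positivity, ?_, fun X hX => ?_⟩
  · rw [hρ, ← mul_div_assoc, div_lt_one hτ0]
    linarith
  set T₀ : ℝ := C₂ ^ (1 / τ) * X ^ ρ with hT₀
  have hT₀1 : 1 ≤ T₀ := one_le_mul_of_one_le_of_one_le
    (Real.one_le_rpow hC₂1 (by positivity)) (Real.one_le_rpow hX hρ0.le)
  set T : ℕ := ⌊T₀⌋₊ with hT
  have hT1 : 1 ≤ T := Nat.le_floor (by exact_mod_cast hT₀1)
  set E := {d : ℤ | |(d : ℝ)| ≤ X ∧ NthPowerFree n d ∧ HasTwistPoint n f d ℚ} with hE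
  have hchoice : ∀ d : ℤ, ∃ x : ℚ, d ∈ E → ∃ y : ℚ, (d : ℚ) * y ^ n = aeval x f := by
    intro d
    by_cases hd : d ∈ E
    · obtain ⟨x, y, h⟩ := hd.2.2
      exact ⟨x, fun _ => ⟨y, h⟩⟩
    · exact ⟨0, fun h => absurd h hd⟩
  choose x hx using hchoice
  let box : Finset (ℤ × ℤ × ℤ) := Finset.Icc (-(T : ℤ)) T ×ˢ (Finset.Icc (0 : ℤ) T ×ˢ
    Finset.Icc (-1 : ℤ) 1)
  have hmaps : Set.MapsTo (fun d : ℤ => ((x d).num, ((x d).den : ℤ), Int.sign d)) E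
      (box : Set (ℤ × ℤ × ℤ)) := by
    intro d hd
    obtain ⟨y, hy⟩ := hx d hd
    have h1 : ratHeight (x d) ≤ T := Nat.le_floor (hheight X hX d hd.1 hd.2.1 _ y hy)
    have h2 : (x d).num.natAbs ≤ T := (le_max_left _ _).trans h1
    have h3 : (x d).den ≤ T := (le_max_right _ _).trans h1
    simp only [box, Finset.mem_coe, Finset.mem_product, Finset.mem_Icc]
    refine ⟨⟨by omega, by omega⟩, ⟨by omega, by omega⟩, ?_⟩
    rcases Int.sign_trichotomy d with h | h | h <;> rw [h] <;> norm_num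
  have hinj : Set.InjOn (fun d : ℤ => ((x d).num, ((x d).den : ℤ), Int.sign d)) E := by
    intro d₁ h₁ d₂ h₂ h
    simp only [Prod.mk.injEq, Nat.cast_inj] at h
    have hxx : x d₁ = x d₂ := Rat.ext h.1 h.2.1
    obtain ⟨y₁, hy₁⟩ := hx d₁ h₁
    obtain ⟨y₂, hy₂⟩ := hx d₂ h₂
    have hy0 : ∀ (d : ℤ) (y : ℚ), (d : ℚ) * y ^ n = aeval (x d) f → y ≠ 0 := by
      rintro d y h rfl
      rw [zero_pow (by omega), mul_zero] at h
      exact hroot _ h.symm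
    have habs := h₁.2.1.natAbs_eq_of_mul_pow_eq h₂.2.1 (hy0 _ _ hy₁) (hy0 _ _ hy₂)
      (by rw [hy₁, hy₂, hxx])
    rw [← Int.sign_mul_natAbs d₁, ← Int.sign_mul_natAbs d₂, h.2.2, habs]
  refine ⟨Set.Finite.of_injOn hmaps hinj (Finset.finite_toSet box), ?_⟩
  have hcard : E.ncard ≤ (2 * T + 1) * ((T + 1) * 3) := by
    have h1 := Set.ncard_le_ncard_of_injOn _ hmaps hinj (Finset.finite_toSet box)
    rw [Set.ncard_coe_finset] at h1
    refine h1.trans (le_of_eq ?_)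
    simp only [box, Finset.card_product, Int.card_Icc]
    have e1 : ((T : ℤ) + 1 - -(T : ℤ)).toNat = 2 * T + 1 := by omega
    have e2 : ((T : ℤ) + 1 - 0).toNat = T + 1 := by omega
    rw [e1, e2]
    rfl
  have hTR : (T : ℝ) ≤ T₀ := Nat.floor_le (by linarith)
  have h1 : (E.ncard : ℝ) ≤ (2 * T + 1) * ((T + 1) * 3) := by exact_mod_cast hcard
  have hT1R : (1 : ℝ) ≤ T := by exact_mod_cast hT1
  have h2 : (E.ncard : ℝ) ≤ 18 * T₀ ^ 2 := by nlinarith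
  rw [mul_comm 2 ρ, Real.rpow_mul (by linarith), Real.rpow_two]
  calc (E.ncard : ℝ) ≤ 18 * T₀ ^ 2 := h2
    _ = _ := by rw [hT₀]; ring

theorem sum_mul_le_of_antitone {w g : ℕ → ℝ} {A : ℝ} (hg : ∀ k, 1 ≤ k → g (k + 1) ≤ g k)
    (hg0 : ∀ k, 0 ≤ g k) (hw : ∀ n, ∑ k ∈ Finset.Icc 1 n, w k ≤ A * n) (n : ℕ) :
    ∑ k ∈ Finset.Icc 1 n, w k * g k ≤ A * ∑ k ∈ Finset.Icc 1 n, g k := by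
  have key : ∀ m, g (m + 1) * (A * ((m + 1 : ℕ) : ℝ) - ∑ k ∈ Finset.Icc 1 (m + 1), w k) ≤
      A * ∑ k ∈ Finset.Icc 1 (m + 1), g k - ∑ k ∈ Finset.Icc 1 (m + 1), w k * g k := by
    intro m
    induction m with
    | zero =>
      simp only [zero_add, Finset.Icc_self, Finset.sum_singleton, Nat.cast_one]
      apply le_of_eq
      ring
    | succ m ih =>
      rw [Finset.sum_Icc_succ_top (by omega) w, Finset.sum_Icc_succ_top (by omega) g,
        Finset.sum_Icc_succ_top (by omega) fun k => w k * g k]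
      have h1 := hw (m + 1)
      have h2 := hg (m + 1) (by omega)
      have h3 : g (m + 1 + 1) * (A * ((m + 1 : ℕ) : ℝ) - ∑ k ∈ Finset.Icc 1 (m + 1), w k) ≤
          g (m + 1) * (A * ((m + 1 : ℕ) : ℝ) - ∑ k ∈ Finset.Icc 1 (m + 1), w k) :=
        mul_le_mul_of_nonneg_right h2 (by linarith)
      have h4 := h3.trans ih
      have h5 : ((m + 1 + 1 : ℕ) : ℝ) = ((m + 1 : ℕ) : ℝ) + 1 := by push_cast; ring
      rw [h5]
      nlinarith
  rcases n with _ | m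
  · simp
  · have h1 := key m
    have h2 : 0 ≤ g (m + 1) * (A * ((m + 1 : ℕ) : ℝ) - ∑ k ∈ Finset.Icc 1 (m + 1), w k) :=
      mul_nonneg (hg0 _) (by linarith [hw (m + 1)])
    linarith

theorem sum_rpow_sub_one_le {a : ℝ} (ha : 0 < a) (ha1 : a ≤ 1) (n : ℕ) :
    ∑ k ∈ Finset.Icc 1 n, (k : ℝ) ^ (a - 1) ≤ (n : ℝ) ^ a / a := by
  induction n with
  | zero => simp [Real.zero_rpow ha.ne']
  | succ n ih =>
    rw [Finset.sum_Icc_succ_top (by omega)]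
    have hpos : (0 : ℝ) < ((n + 1 : ℕ) : ℝ) := by positivity
    have h1 : ((n : ℝ)) ^ a ≤ ((n + 1 : ℕ) : ℝ) ^ a * (1 - a / ((n + 1 : ℕ) : ℝ)) := by
      have h := rpow_one_add_le_one_add_mul_self (s := -(((n + 1 : ℕ) : ℝ))⁻¹)
        (by
          rw [neg_le_neg_iff]
          apply inv_le_one_of_one_le₀
          push_cast
          linarith [Nat.cast_nonneg (α := ℝ) n]) ha.le ha1
      have e : (n : ℝ) = ((n + 1 : ℕ) : ℝ) * (1 + -(((n + 1 : ℕ) : ℝ))⁻¹) := by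
        field_simp
        push_cast
        ring
      rw [show ((n : ℝ)) ^ a = (((n + 1 : ℕ) : ℝ) * (1 + -(((n + 1 : ℕ) : ℝ))⁻¹)) ^ a by rw [← e],
        Real.mul_rpow hpos.le (by
          have := inv_le_one_of_one_le₀ (show (1 : ℝ) ≤ ((n + 1 : ℕ) : ℝ) by
            push_cast
            linarith [Nat.cast_nonneg (α := ℝ) n])
          linarith)]
      refine mul_le_mul_of_nonneg_left (h.trans (le_of_eq ?_)) (by positivity)
      rw [div_eq_mul_inv]
      ring
    have h2 : ((n + 1 : ℕ) : ℝ) ^ (a - 1) = ((n + 1 : ℕ) : ℝ) ^ a / ((n + 1 : ℕ) : ℝ) := by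
      rw [Real.rpow_sub_one hpos.ne']
    rw [h2]
    have h3 : (n : ℝ) ^ a / a ≤ ((n + 1 : ℕ) : ℝ) ^ a * (1 - a / ((n + 1 : ℕ) : ℝ)) / a := by
      gcongr
    have h4 : ((n + 1 : ℕ) : ℝ) ^ a * (1 - a / ((n + 1 : ℕ) : ℝ)) / a +
        ((n + 1 : ℕ) : ℝ) ^ a / ((n + 1 : ℕ) : ℝ) = ((n + 1 : ℕ) : ℝ) ^ a / a := by
      field_simp
      ring
    linarith

theorem sum_log_prime_mul_rpow_le {a : ℝ} (ha : 0 < a) (ha1 : a ≤ 1) (n : ℕ) :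
    ∑ p ∈ Finset.Icc 1 n with p.Prime, Real.log p * (p : ℝ) ^ (a - 1) ≤
      Real.log 4 / a * (n : ℝ) ^ a := by
  have h := sum_mul_le_of_antitone (w := fun k => if k.Prime then Real.log k else 0)
    (g := fun k => (k : ℝ) ^ (a - 1)) (A := Real.log 4)
    (fun k hk => Real.rpow_le_rpow_of_nonpos (by positivity) (by push_cast; linarith)
      (by linarith)) (fun k => by positivity)
    (fun m => by
      rw [← Finset.sum_filter]
      refine le_trans (le_of_eq ?_) (Chebyshev.theta_le_log4_mul_x (x := m) (by positivity))
      rw [Chebyshev.theta_eq_sum_Icc, Nat.floor_natCast]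
      refine Finset.sum_subset (fun p hp => ?_) fun p hp hp' => ?_
      · rw [Finset.mem_filter, Finset.mem_Icc] at *
        exact ⟨⟨by omega, hp.1.2⟩, hp.2⟩
      · rw [Finset.mem_filter, Finset.mem_Icc] at *
        exact absurd ⟨⟨hp.2.one_le, hp.1.2⟩, hp.2⟩ hp') n
  rw [Finset.sum_filter]
  calc _ = ∑ k ∈ Finset.Icc 1 n, (if k.Prime then Real.log k else 0) * (k : ℝ) ^ (a - 1) :=
        Finset.sum_congr rfl fun k _ => by rw [ite_mul, zero_mul]
    _ ≤ _ := h
    _ ≤ Real.log 4 * ((n : ℝ) ^ a / a) :=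
        mul_le_mul_of_nonneg_left (sum_rpow_sub_one_le ha ha1 n) (Real.log_nonneg (by norm_num))
    _ = _ := by ring

/-- The elements whose coordinates in the basis `b` are bounded by `R`. -/
noncomputable def coordBox {ι O : Type*} [Fintype ι] [CommRing O] (b : Module.Basis ι ℤ O) (R : ℕ) :
    Finset O :=
  open Classical in
  (Fintype.piFinset fun _ : ι => Finset.Icc (-(R : ℤ)) R).map b.equivFun.symm.toEquiv.toEmbedding

section CoordBox

variable {ι O : Type*} [Fintype ι] [CommRing O] (b : Module.Basis ι ℤ O)

theorem mem_coordBox {R : ℕ} {α : O} : α ∈ coordBox b R ↔ ∀ i, |b.repr α i| ≤ (R : ℤ) := by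
  classical
  simp only [coordBox, Finset.mem_map_equiv, Fintype.mem_piFinset, Finset.mem_Icc, abs_le]
  rfl

theorem card_coordBox (R : ℕ) : (coordBox b R).card = (2 * R + 1) ^ Fintype.card ι := by
  classical
  rw [coordBox, Finset.card_map, Fintype.card_piFinset, Finset.prod_const, Int.card_Icc,
    Finset.card_univ]
  congr 1
  omega

theorem add_mem_coordBox {R S : ℕ} {α β : O} (hα : α ∈ coordBox b R) (hβ : β ∈ coordBox b S) :
    α + β ∈ coordBox b (R + S) := by
  rw [mem_coordBox] at *
  intro i
  rw [map_add, Finsupp.add_apply]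
  push_cast
  exact (abs_add_le _ _).trans (add_le_add (hα i) (hβ i))

theorem neg_mem_coordBox {R : ℕ} {α : O} (hα : α ∈ coordBox b R) : -α ∈ coordBox b R := by
  rw [mem_coordBox] at *
  intro i
  rw [map_neg, Finsupp.neg_apply, abs_neg]
  exact hα i

theorem natCard_quotient_mul_card_le (J : Ideal O) {r : ℕ}
    (hcov : ∀ α : O, ∃ β ∈ J, α - β ∈ coordBox b r) (x : O) (R : ℕ) (T : Finset O)
    (hT : ∀ β ∈ T, β ∈ coordBox b R ∧ x + β ∈ J) :
    Nat.card (O ⧸ J) * T.card ≤ (2 * (R + r) + 1) ^ Fintype.card ι := by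
  classical
  choose g hgJ hgb using hcov
  have hcls : ∀ c : O ⧸ J, Ideal.Quotient.mk J (c.out - g c.out) = c := fun c => by
    rw [map_sub, Ideal.Quotient.eq_zero_iff_mem.mpr (hgJ _), sub_zero, Ideal.Quotient.mk_out]
  have hinj : Function.Injective (fun q : (O ⧸ J) × T =>
      (⟨(q.2 : O) + (q.1.out - g q.1.out),
        add_mem_coordBox b (hT _ q.2.2).1 (hgb _)⟩ : coordBox b (R + r))) := by
    rintro ⟨c, t⟩ ⟨c', t'⟩ h
    have h := congrArg Subtype.val h
    simp only at h
    have hc : c = c' := by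
      have h1 := congrArg (fun z => Ideal.Quotient.mk J (x + z)) h
      simp only [← add_assoc] at h1
      rw [map_add, map_add _ (x + (t' : O)), hcls, hcls,
        Ideal.Quotient.eq_zero_iff_mem.mpr (hT _ t.2).2,
        Ideal.Quotient.eq_zero_iff_mem.mpr (hT _ t'.2).2, zero_add, zero_add] at h1
      exact h1
    subst hc
    have := add_right_cancel h
    rw [Subtype.ext this]
  have := Nat.card_le_card_of_injective _ hinj
  rw [Nat.card_prod, Nat.card_eq_fintype_card (α := T), Fintype.card_coe,
    Nat.card_eq_fintype_card (α := coordBox b (R + r)), Fintype.card_coe, card_coordBox] at this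
  exact this

theorem le_natCard_quotient_mul_card (J : Ideal O) [Finite (O ⧸ J)] {r : ℕ}
    (hcov : ∀ α : O, ∃ β ∈ J, α - β ∈ coordBox b r) (x : O) (R : ℕ) (hr : r ≤ R) (T : Finset O)
    (hT : ∀ β ∈ coordBox b R, x + β ∈ J → β ∈ T) :
    (2 * (R - r) + 1) ^ Fintype.card ι ≤ Nat.card (O ⧸ J) * T.card := by
  classical
  choose g hgJ hgb using hcov
  have hinj : Function.Injective (fun a : coordBox b (R - r) =>
      ((Ideal.Quotient.mk J (x + a),
        ⟨(a : O) - ((Ideal.Quotient.mk J (x + a)).out - g (Ideal.Quotient.mk J (x + a)).out),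
          hT _ (by
            have := add_mem_coordBox b a.2 (neg_mem_coordBox b
              (hgb (Ideal.Quotient.mk J (x + a)).out))
            rwa [Nat.sub_add_cancel hr, ← sub_eq_add_neg] at this) (by
            rw [← Ideal.Quotient.eq_zero_iff_mem, ← add_sub_assoc, map_sub, map_sub,
              Ideal.Quotient.mk_out, Ideal.Quotient.eq_zero_iff_mem.mpr (hgJ _), sub_zero,
              sub_self])⟩) : (O ⧸ J) × T)) := by
    rintro a a' h
    rw [Prod.mk.injEq] at h
    obtain ⟨h1, h2⟩ := h
    have h2 := congrArg Subtype.val h2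
    simp only [h1] at h2
    exact Subtype.ext (sub_left_injective h2)
  have := Nat.card_le_card_of_injective _ hinj
  rw [Nat.card_prod, Nat.card_eq_fintype_card (α := T), Fintype.card_coe,
    Nat.card_eq_fintype_card (α := coordBox b (R - r)), Fintype.card_coe, card_coordBox] at this
  exact this

theorem exists_mul_mem_coordBox : ∃ C : ℕ, ∀ (R : ℕ) (α : O), α ∈ coordBox b R →
    ∀ i, α * b i ∈ coordBox b (C * R) := by
  refine ⟨∑ k, ∑ i, ∑ j, (b.repr (b k * b i) j).natAbs, fun R α hα i => ?_⟩
  rw [mem_coordBox] at *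
  intro j
  conv_lhs => rw [← b.sum_repr α]
  rw [Finset.sum_mul, map_sum, Finsupp.finsetSum_apply]
  push_cast
  rw [Finset.sum_mul]
  refine (Finset.abs_sum_le_sum_abs _ _).trans (Finset.sum_le_sum fun k _ => ?_)
  rw [smul_mul_assoc, map_smul, Finsupp.smul_apply, smul_eq_mul, abs_mul, mul_comm]
  refine mul_le_mul ?_ (hα k) (abs_nonneg _) (by positivity)
  refine le_trans ?_ (Finset.single_le_sum (f := fun i => ∑ j, |b.repr (b k * b i) j|)
    (fun i _ => Finset.sum_nonneg fun j _ => abs_nonneg _) (Finset.mem_univ i))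
  exact Finset.single_le_sum (f := fun j => |b.repr (b k * b i) j|)
    (fun j _ => abs_nonneg _) (Finset.mem_univ j)

theorem exists_sub_mul_mem_coordBox [IsDomain O] {C : ℕ} (hC : ∀ (R : ℕ) (α : O), α ∈ coordBox b R →
    ∀ i, α * b i ∈ coordBox b (C * R)) {R : ℕ} {α α' : O} {m : ℤ} (hα : α ∈ coordBox b R)
    (hm : m ≠ 0) (hαm : α * α' = m) (β : O) :
    ∃ γ, β - α * γ ∈ coordBox b (Fintype.card ι * (C * R)) := by
  refine ⟨∑ i, (b.repr (β * α') i / m) • b i, ?_⟩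
  have key : m • (β - α * ∑ i, (b.repr (β * α') i / m) • b i) =
      ∑ i, (b.repr (β * α') i % m) • (α * b i) := by
    have h1 : ∑ i, (b.repr (β * α') i % m) • b i =
        β * α' - m • ∑ i, (b.repr (β * α') i / m) • b i := by
      conv_rhs => rw [← b.sum_repr (β * α')]
      rw [Finset.smul_sum, ← Finset.sum_sub_distrib]
      refine Finset.sum_congr rfl fun i _ => ?_
      rw [b.sum_repr, smul_smul, ← sub_smul, Int.emod_def]
    have h2 : ∑ i, (b.repr (β * α') i % m) • (α * b i) =
        α * ∑ i, (b.repr (β * α') i % m) • b i := by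
      rw [Finset.mul_sum]
      exact Finset.sum_congr rfl fun i _ => by rw [mul_smul_comm]
    rw [h2, h1, zsmul_eq_mul, zsmul_eq_mul]
    linear_combination (-β) * hαm
  rw [mem_coordBox]
  intro j
  have h3 : |m| * |b.repr (β - α * ∑ i, (b.repr (β * α') i / m) • b i) j| ≤
      |m| * ((Fintype.card ι * (C * R) : ℕ) : ℤ) := by
    rw [← abs_mul, ← smul_eq_mul, ← Finsupp.smul_apply, ← map_smul, key, map_sum,
      Finsupp.finsetSum_apply]
    refine (Finset.abs_sum_le_sum_abs _ _).trans ?_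
    have : ∀ i ∈ (Finset.univ : Finset ι), |b.repr ((b.repr (β * α') i % m) • (α * b i)) j| ≤
        |m| * ((C * R : ℕ) : ℤ) := fun i _ => by
      rw [map_smul, Finsupp.smul_apply, smul_eq_mul, abs_mul]
      refine mul_le_mul ?_ ((mem_coordBox b).mp (hC R α hα i) j) (abs_nonneg _) (abs_nonneg _)
      rw [abs_of_nonneg (Int.emod_nonneg _ hm)]
      exact (Int.emod_lt_abs _ hm).le
    refine (Finset.sum_le_card_nsmul _ _ _ this).trans (le_of_eq ?_)
    rw [nsmul_eq_mul, Finset.card_univ]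
    push_cast
    ring
  exact le_of_mul_le_mul_left h3 (abs_pos.mpr hm)

end CoordBox

theorem exists_covering {ι O : Type*} [Fintype ι] [Nonempty ι] [CommRing O] [IsDedekindDomain O]
    [Module.Free ℤ O] [Module.Finite ℤ O] (b : Module.Basis ι ℤ O) :
    ∃ C : ℕ, ∀ J : Ideal O, J ≠ ⊥ → ∃ r : ℕ,
      (r : ℝ) ≤ C * (Ideal.absNorm J : ℝ) ^ ((Fintype.card ι : ℝ)⁻¹) ∧
      ∀ α : O, ∃ β ∈ J, α - β ∈ coordBox b r := by
  classical
  obtain ⟨C, hC⟩ := exists_mul_mem_coordBox b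
  refine ⟨Fintype.card ι * C, fun J hJ => ?_⟩
  have hD : Fintype.card ι ≠ 0 := Fintype.card_ne_zero
  set N := Ideal.absNorm J with hN
  have hN0 : N ≠ 0 := fun h => hJ (Ideal.absNorm_eq_zero_iff.mp h)
  have hfin : Finite (O ⧸ J) := (Ideal.absNorm_ne_zero_iff J).mp hN0
  set s := ⌊(N : ℝ) ^ ((Fintype.card ι : ℝ)⁻¹)⌋₊ with hs
  have hs1 : (s : ℝ) ≤ (N : ℝ) ^ ((Fintype.card ι : ℝ)⁻¹) := Nat.floor_le (by positivity)
  have hs2 : N < (s + 1) ^ Fintype.card ι := by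
    have h := Nat.lt_floor_add_one ((N : ℝ) ^ ((Fintype.card ι : ℝ)⁻¹))
    have h2 := pow_lt_pow_left₀ h (by positivity) hD
    rw [Real.rpow_inv_natCast_pow (by positivity) hD] at h2
    exact_mod_cast h2
  have := Fintype.ofFinite (O ⧸ J)
  obtain ⟨c, c', hne, hcc⟩ := Fintype.exists_ne_map_eq_of_card_lt
    (fun c : ι → Fin (s + 1) => Ideal.Quotient.mk J (∑ i, ((c i : ℕ) : ℤ) • b i)) (by
      rw [Fintype.card_fun, Fintype.card_fin, ← Nat.card_eq_fintype_card]
      exact hs2)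
  set α := ∑ i, ((c i : ℕ) : ℤ) • b i - ∑ i, ((c' i : ℕ) : ℤ) • b i with hα
  have hαJ : α ∈ J := by
    rw [← Ideal.Quotient.eq_zero_iff_mem, hα, map_sub, hcc, sub_self]
  have hrep : ∀ i, b.repr α i = (c i : ℕ) - (c' i : ℕ) := fun i => by
    rw [hα, map_sub, Finsupp.sub_apply, b.repr_sum_self, b.repr_sum_self]
  have hα0 : α ≠ 0 := fun h => hne (funext fun i => by
    have := hrep i
    rw [h, map_zero, Finsupp.zero_apply] at this
    ext
    omega)
  have hαs : α ∈ coordBox b s := by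
    rw [mem_coordBox]
    intro i
    rw [hrep, abs_le]
    have := (c i).isLt
    have := (c' i).isLt
    omega
  obtain ⟨α', hα'⟩ := Ideal.mem_span_singleton.mp (Ideal.absNorm_mem (Ideal.span {α}))
  refine ⟨Fintype.card ι * (C * s), ?_, fun β => ?_⟩
  · push_cast
    rw [← mul_assoc]
    gcongr
  · obtain ⟨γ, hγ⟩ := exists_sub_mul_mem_coordBox b hC (m := (Ideal.absNorm (Ideal.span {α}) : ℤ))
      hαs (by
        rw [Nat.cast_ne_zero]
        intro h
        exact hα0 (Ideal.span_singleton_eq_bot.mp (Ideal.absNorm_eq_zero_iff.mp h)))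
      (by rw [Int.cast_natCast]; exact hα'.symm) β
    exact ⟨α * γ, J.mul_mem_right _ hαJ, hγ⟩

section NormBounds

open NumberField

variable {K : Type*} [Field K] [NumberField K]

theorem absNorm_span_eq_prod (α : 𝓞 K) :
    (Ideal.absNorm (Ideal.span {α}) : ℝ) = ∏ σ : K →+* ℂ, ‖σ α‖ := by
  rw [Ideal.absNorm_span_singleton]
  have h := Algebra.norm_eq_prod_embeddings ℚ ℂ (α : K)
  have h2 : ((Algebra.norm ℤ α : ℤ) : ℚ) = Algebra.norm ℚ (α : K) := Algebra.coe_norm_int α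
  rw [← h2] at h
  have h3 := congrArg norm h
  rw [eq_ratCast, Rat.cast_intCast, Complex.norm_intCast, norm_prod] at h3
  rw [Nat.cast_natAbs, Int.cast_abs, h3]
  exact Fintype.prod_equiv (RingHom.equivRatAlgHom K ℂ).symm _ _ fun σ => rfl

variable {ι : Type*} [Fintype ι] (b : Module.Basis ι ℤ (𝓞 K))

theorem exists_norm_embedding_le : ∃ B : ℕ, ∀ (R : ℕ) (α : 𝓞 K), α ∈ coordBox b R →
    ∀ σ : K →+* ℂ, ‖σ α‖ ≤ B * R := by
  refine ⟨⌈∑ σ : K →+* ℂ, ∑ i, ‖σ (b i)‖⌉₊, fun R α hα σ => ?_⟩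
  have h1 : (α : K) = ∑ i, (b.repr α i : K) * (b i : K) := by
    conv_lhs => rw [← b.sum_repr α]
    rw [RingOfIntegers.coe_eq_algebraMap, map_sum]
    exact Finset.sum_congr rfl fun i _ => by rw [zsmul_eq_mul, map_mul, map_intCast]
  have h2 : ‖σ α‖ ≤ ∑ i, R * ‖σ (b i)‖ := by
    rw [h1, map_sum]
    refine (norm_sum_le _ _).trans (Finset.sum_le_sum fun i _ => ?_)
    rw [map_mul, norm_mul, map_intCast, Complex.norm_intCast]
    gcongr
    exact_mod_cast (mem_coordBox b).mp hα i
  rw [← Finset.mul_sum, mul_comm] at h2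
  refine h2.trans ?_
  gcongr
  refine le_trans ?_ (Nat.le_ceil _)
  exact Finset.single_le_sum (f := fun σ : K →+* ℂ => ∑ i, ‖σ (b i)‖)
    (fun σ _ => by positivity) (Finset.mem_univ σ)

theorem exists_absNorm_bounds : ∃ M C : ℕ, 0 < C ∧ ∀ (R : ℕ) (α : 𝓞 K), α ∈ coordBox b R →
    R ^ Module.finrank ℚ K ≤ Ideal.absNorm (Ideal.span {((M * R : ℕ) : 𝓞 K) + α}) ∧
    Ideal.absNorm (Ideal.span {((M * R : ℕ) : 𝓞 K) + α}) ≤ C * R ^ Module.finrank ℚ K := by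
  obtain ⟨B, hB⟩ := exists_norm_embedding_le b
  refine ⟨B + 1, (2 * B + 1) ^ Module.finrank ℚ K, by positivity, fun R α hα => ?_⟩
  have hcard : Fintype.card (K →+* ℂ) = Module.finrank ℚ K := Embeddings.card K ℂ
  have hval : ∀ σ : K →+* ℂ, σ ((((B + 1) * R : ℕ) : 𝓞 K) + α : 𝓞 K) =
      (((B + 1) * R : ℕ) : ℂ) + σ α := fun σ => by
    rw [RingOfIntegers.coe_eq_algebraMap, map_add, map_natCast, map_add, map_natCast]
  have hn : ‖((((B + 1) * R : ℕ)) : ℂ)‖ = (B + 1) * R := by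
    rw [Complex.norm_natCast]; push_cast; ring
  have e := absNorm_span_eq_prod ((((B + 1) * R : ℕ) : 𝓞 K) + α)
  constructor
  · have : ((R : ℝ)) ^ Module.finrank ℚ K ≤
        (Ideal.absNorm (Ideal.span {(((B + 1) * R : ℕ) : 𝓞 K) + α}) : ℝ) := by
      rw [e, ← hcard, ← Finset.card_univ, ← Finset.prod_const]
      refine Finset.prod_le_prod (fun _ _ => by positivity) fun σ _ => ?_
      rw [hval]
      have h1 := hB R α hα σ
      have h2 := norm_sub_le_norm_add ((((B + 1) * R : ℕ)) : ℂ) (σ α)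
      rw [hn] at h2
      linarith
    exact_mod_cast this
  · have : (Ideal.absNorm (Ideal.span {(((B + 1) * R : ℕ) : 𝓞 K) + α}) : ℝ) ≤
        ((2 * B + 1) * R : ℝ) ^ Module.finrank ℚ K := by
      rw [e, ← hcard, ← Finset.card_univ, ← Finset.prod_const]
      refine Finset.prod_le_prod (fun _ _ => by positivity) fun σ _ => ?_
      rw [hval]
      have h1 := hB R α hα σ
      have h2 := norm_add_le ((((B + 1) * R : ℕ)) : ℂ) (σ α)
      rw [hn] at h2
      linarith
    rw [mul_pow] at this
    exact_mod_cast this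

end NormBounds

section PrimeIdeals

variable {O : Type*} [CommRing O] [IsDedekindDomain O] [Module.Free ℤ O] [Module.Finite ℤ O]

open Classical in
theorem log_absNorm_eq_sum {I : Ideal O} (hI : I ≠ ⊥) (s : Finset (Ideal O)) {k₀ : ℕ}
    (hk₀ : Ideal.absNorm I ≤ k₀) (hs : ∀ P ∈ s, P.IsPrime ∧ P ≠ ⊥)
    (hIs : ∀ P : Ideal O, P.IsPrime → I ≤ P → P ∈ s) :
    Real.log (Ideal.absNorm I) =
      ∑ P ∈ s, ∑ k ∈ Finset.Icc 1 k₀, if I ≤ P ^ k then Real.log (Ideal.absNorm P) else 0 := by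
  have hprime : ∀ P ∈ s, Prime P := fun P hP => Ideal.prime_of_isPrime (hs P hP).2 (hs P hP).1
  have hN1 : ∀ P ∈ s, 2 ≤ Ideal.absNorm P := fun P hP => by
    have h0 : Ideal.absNorm P ≠ 0 := fun h => (hs P hP).2 (Ideal.absNorm_eq_zero_iff.mp h)
    have h1 : Ideal.absNorm P ≠ 1 := fun h => (hs P hP).1.ne_top (Ideal.absNorm_eq_one_iff.mp h)
    omega
  have hle : ∀ P ∈ s, ∀ k, I ≤ P ^ k ↔
      k ≤ (UniqueFactorizationMonoid.normalizedFactors I).count P := fun P hP k => by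
    rw [← Ideal.dvd_iff_le, pow_dvd_iff_le_emultiplicity,
      UniqueFactorizationMonoid.emultiplicity_eq_count_normalizedFactors
        (hprime P hP).irreducible hI, normalize_eq, Nat.cast_le]
  have hcount : ∀ P ∈ s, (UniqueFactorizationMonoid.normalizedFactors I).count P ≤ k₀ :=
    fun P hP => by
    have h1 := (hle P hP _).mpr le_rfl
    have h2 := Ideal.absNorm_dvd_absNorm_of_le h1
    rw [map_pow] at h2
    have h3 : Ideal.absNorm I ≠ 0 := fun h => hI (Ideal.absNorm_eq_zero_iff.mp h)
    have h4 := Nat.le_of_dvd (Nat.pos_of_ne_zero h3) h2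
    have h5 := Nat.lt_pow_self (n := (UniqueFactorizationMonoid.normalizedFactors I).count P)
      (hN1 P hP)
    omega
  have hprod : Ideal.absNorm I =
      ∏ P ∈ s, Ideal.absNorm P ^ (UniqueFactorizationMonoid.normalizedFactors I).count P := by
    conv_lhs => rw [← associated_iff_eq.mp (UniqueFactorizationMonoid.prod_normalizedFactors hI)]
    rw [map_multiset_prod, Finset.prod_multiset_map_count]
    refine Finset.prod_subset (fun P hP => ?_) fun P hP hP' => ?_
    · rw [Multiset.mem_toFinset] at hP
      have h1 := UniqueFactorizationMonoid.prime_of_normalized_factor P hP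
      exact hIs P (Ideal.isPrime_of_prime h1)
        (Ideal.dvd_iff_le.mp (UniqueFactorizationMonoid.dvd_of_mem_normalizedFactors hP))
    · rw [Multiset.mem_toFinset] at hP'
      rw [Multiset.count_eq_zero_of_notMem hP', pow_zero]
  rw [hprod]
  push_cast
  rw [Real.log_prod (fun P hP => by have := hN1 P hP; positivity)]
  refine Finset.sum_congr rfl fun P hP => ?_
  rw [Real.log_pow, ← Finset.sum_filter, Finset.sum_const, nsmul_eq_mul]
  congr 2
  have : (Finset.Icc 1 k₀).filter (fun k => I ≤ P ^ k) =
      Finset.Icc 1 ((UniqueFactorizationMonoid.normalizedFactors I).count P) := by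
    ext k
    rw [Finset.mem_filter, Finset.mem_Icc, Finset.mem_Icc, hle P hP]
    have := hcount P hP
    omega
  rw [this, Nat.card_Icc, Nat.add_sub_cancel]

theorem card_primes_over_le {p : ℕ} (hp : p.Prime) (s : Finset (Ideal O))
    (hs : ∀ P ∈ s, P.IsPrime ∧ P ≠ ⊥ ∧ p ∣ Ideal.absNorm P) (hs' : ∀ P ∈ s, (p : O) ∈ P) :
    s.card ≤ Module.finrank ℤ O := by
  have h1 : ∏ P ∈ s, P ∣ Ideal.span {(p : O)} :=
    Finset.prod_primes_dvd _ (fun P hP => Ideal.prime_of_isPrime (hs P hP).2.1 (hs P hP).1)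
      fun P hP => Ideal.dvd_iff_le.mpr ((Ideal.span_singleton_le_iff_mem _).mpr (hs' P hP))
  have h2 := Ideal.absNorm_dvd_absNorm_of_le (Ideal.dvd_iff_le.mp h1)
  rw [map_prod, Ideal.absNorm_span_natCast] at h2
  have h3 : p ^ s.card ∣ ∏ P ∈ s, Ideal.absNorm P := by
    rw [← Finset.prod_const]
    exact Finset.prod_dvd_prod_of_dvd _ _ fun P hP => (hs P hP).2.2
  exact (Nat.pow_dvd_pow_iff_le_right hp.one_lt).mp (h3.trans h2)

theorem minFac_absNorm_mem {P : Ideal O} (hP : P.IsPrime) (h0 : P ≠ ⊥) :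
    ((Ideal.absNorm P).minFac : O) ∈ P ∧ (Ideal.absNorm P).minFac.Prime := by
  have h1 : Ideal.absNorm P ≠ 1 := fun h => hP.ne_top (Ideal.absNorm_eq_one_iff.mp h)
  have hmax := hP.isMaximal h0
  obtain ⟨p, n, hn0, hpP, hp, hn⟩ := Ideal.exists_prime_and_absNorm_eq_pow P
  rw [hn, hp.pow_minFac hn0.ne']
  exact ⟨hpP, hp⟩

end PrimeIdeals

theorem nonempty_ringHom_zmod {O : Type*} [CommRing O] [IsDedekindDomain O]
    [Module.Free ℤ O] {P : Ideal O} (hP : (Ideal.absNorm P).Prime) :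
    Nonempty (O →+* ZMod (Ideal.absNorm P)) := by
  have hc : Nat.card (O ⧸ P) = Ideal.absNorm P := rfl
  have := Fact.mk hP
  have hfin : Finite (O ⧸ P) := (Ideal.absNorm_ne_zero_iff P).mp hP.ne_zero
  have := Fintype.ofFinite (O ⧸ P)
  exact ⟨((ZMod.ringEquivOfPrime (O ⧸ P) hP (by
    rw [← Nat.card_eq_fintype_card, hc])).symm : (O ⧸ P) →+* _).comp (Ideal.Quotient.mk P)⟩

theorem exists_one_add_pow_le (D : ℕ) {U : ℝ} (hU : 0 ≤ U) :
    ∃ A : ℝ, 0 ≤ A ∧ ∀ u : ℝ, 0 ≤ u → u ≤ U → (1 + u) ^ D ≤ 1 + A * u := by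
  induction D with
  | zero => exact ⟨0, le_rfl, fun u _ _ => by simp⟩
  | succ D ih =>
    obtain ⟨A, hA, h⟩ := ih
    refine ⟨A + 1 + A * U, by positivity, fun u hu huU => ?_⟩
    rw [pow_succ]
    have h1 := h u hu huU
    have h2 : (1 + u) ^ D * (1 + u) ≤ (1 + A * u) * (1 + u) := by gcongr
    have h3 : A * u * u ≤ A * u * U := by gcongr
    nlinarith

section BoxCount

open NumberField

variable {K : Type*} [Field K] [NumberField K] {ι : Type*} [Fintype ι]

/-- The number of elements of a shifted box that lie in the ideal `J`. -/
noncomputable def boxCount (b : Module.Basis ι ℤ (𝓞 K)) (M R : ℕ) (J : Ideal (𝓞 K)) : ℕ :=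
  open Classical in ((coordBox b R).filter fun β => ((M * R : ℕ) : 𝓞 K) + β ∈ J).card

theorem exists_boxCount_bounds [Nonempty ι] (b : Module.Basis ι ℤ (𝓞 K)) {D M C₀ : ℕ}
    (hD : Fintype.card ι = D)
    (hM : ∀ (R : ℕ) (α : 𝓞 K), α ∈ coordBox b R →
      Ideal.absNorm (Ideal.span {((M * R : ℕ) : 𝓞 K) + α}) ≤ C₀ * R ^ D)
    (hM0 : ∀ (R : ℕ) (α : 𝓞 K), 1 ≤ R → α ∈ coordBox b R → ((M * R : ℕ) : 𝓞 K) + α ≠ 0) :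
    ∃ C : ℝ, 1 ≤ C ∧ ∀ (R : ℕ), 1 ≤ R → ∀ J : Ideal (𝓞 K), J ≠ ⊥ →
      (2 * R + 1 : ℝ) ^ D * (1 - C * (Ideal.absNorm J : ℝ) ^ ((D : ℝ)⁻¹) / R) ≤
        Ideal.absNorm J * boxCount b M R J ∧
      (Ideal.absNorm J * boxCount b M R J : ℝ) ≤
        (2 * R + 1 : ℝ) ^ D * (1 + C * (Ideal.absNorm J : ℝ) ^ ((D : ℝ)⁻¹) / R) ∧
      (Ideal.absNorm J * boxCount b M R J : ℝ) ≤ (2 * R + 1 : ℝ) ^ D * C := by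
  classical
  obtain ⟨C, hC⟩ := exists_covering b
  have hD0 : D ≠ 0 := hD ▸ Fintype.card_ne_zero
  set W : ℝ := (C₀ : ℝ) ^ ((D : ℝ)⁻¹) with hW
  have hW0 : 0 ≤ W := by positivity
  obtain ⟨A, hA, hpow⟩ := exists_one_add_pow_le D (U := C * W) (by positivity)
  refine ⟨1 + D * C + C + A * C + A * (C * W), by
    have : 0 ≤ D * C + C + A * C + A * (C * W) := by positivity
    linarith, fun R hR J hJ => ?_⟩
  set C' : ℝ := 1 + D * C + C + A * C + A * (C * W) with hC'
  obtain ⟨r, hr, hcov⟩ := hC J hJ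
  rw [hD] at hr
  set N := Ideal.absNorm J with hN
  set t : ℝ := (N : ℝ) ^ ((D : ℝ)⁻¹) with ht
  have ht0 : 0 ≤ t := by positivity
  have hN0 : N ≠ 0 := fun h => hJ (Ideal.absNorm_eq_zero_iff.mp h)
  have hfin : Finite (𝓞 K ⧸ J) := (Ideal.absNorm_ne_zero_iff J).mp hN0
  have hR0 : (0 : ℝ) < R := by exact_mod_cast hR
  have hcardN : Nat.card (𝓞 K ⧸ J) = N := rfl
  have hup : (N * boxCount b M R J : ℝ) ≤ (2 * R + 1 : ℝ) ^ D * (1 + C * t / R) ^ D := by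
    have h := natCard_quotient_mul_card_le b J hcov ((M * R : ℕ) : 𝓞 K) R
      ((coordBox b R).filter fun β => ((M * R : ℕ) : 𝓞 K) + β ∈ J)
      (fun β hβ => Finset.mem_filter.mp hβ)
    rw [hD, hcardN] at h
    have h' : (N * boxCount b M R J : ℝ) ≤ ((2 * (R + r) + 1 : ℕ) : ℝ) ^ D := by exact_mod_cast h
    rw [← mul_pow]
    refine h'.trans (pow_le_pow_left₀ (by positivity) ?_ D)
    have h2 : (r : ℝ) ≤ R * (C * t / R) := by
      rw [mul_div_cancel₀ _ hR0.ne']; exact hr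
    have h3 : 0 ≤ C * t / R := by positivity
    push_cast
    nlinarith
  have hcase : boxCount b M R J = 0 ∨ t ≤ W * R := by
    by_cases h0 : boxCount b M R J = 0
    · exact Or.inl h0
    right
    obtain ⟨β, hβ⟩ := Finset.card_pos.mp (Nat.pos_of_ne_zero h0)
    rw [Finset.mem_filter] at hβ
    have h1 : N ∣ Ideal.absNorm (Ideal.span {((M * R : ℕ) : 𝓞 K) + β}) :=
      Ideal.absNorm_dvd_absNorm_of_le ((Ideal.span_singleton_le_iff_mem _).mpr hβ.2)
    have h2 : Ideal.absNorm (Ideal.span {((M * R : ℕ) : 𝓞 K) + β}) ≠ 0 := fun h =>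
      hM0 R β hR hβ.1 (Ideal.span_singleton_eq_bot.mp (Ideal.absNorm_eq_zero_iff.mp h))
    have h3 := (Nat.le_of_dvd (Nat.pos_of_ne_zero h2) h1).trans (hM R β hβ.1)
    have h4 : (N : ℝ) ≤ C₀ * (R : ℝ) ^ D := by exact_mod_cast h3
    have h5 := Real.rpow_le_rpow (by positivity) h4 (show (0 : ℝ) ≤ (D : ℝ)⁻¹ by positivity)
    rwa [Real.mul_rpow (by positivity) (by positivity),
      Real.pow_rpow_inv_natCast (by positivity) hD0] at h5
  have hV : (0 : ℝ) < (2 * R + 1 : ℝ) ^ D := by positivity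
  refine ⟨?_, ?_, ?_⟩
  · by_cases hrR : r ≤ R
    · have h := le_natCard_quotient_mul_card b J hcov ((M * R : ℕ) : 𝓞 K) R hrR
        ((coordBox b R).filter fun β => ((M * R : ℕ) : 𝓞 K) + β ∈ J)
        (fun β hβ hβ' => Finset.mem_filter.mpr ⟨hβ, hβ'⟩)
      rw [hD, hcardN] at h
      have h' : ((2 * (R - r : ℕ) + 1 : ℕ) : ℝ) ^ D ≤ (N * boxCount b M R J : ℝ) := by
        exact_mod_cast h
      refine le_trans ?_ h'
      have hrR' : (r : ℝ) / R ≤ 1 := by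
        rw [div_le_one hR0]; exact_mod_cast hrR
      have h1 : (2 * R + 1 : ℝ) * (1 + -(r / R)) ≤ ((2 * (R - r : ℕ) + 1 : ℕ) : ℝ) := by
        push_cast [Nat.cast_sub hrR]
        have e : (R : ℝ) * (r / R) = r := mul_div_cancel₀ _ hR0.ne'
        have : 0 ≤ (r : ℝ) / R := by positivity
        nlinarith
      refine le_trans ?_ (pow_le_pow_left₀ (by
        have : 0 ≤ 1 + -((r : ℝ) / R) := by linarith
        positivity) h1 D)
      rw [mul_pow]
      refine mul_le_mul_of_nonneg_left ?_ hV.le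
      refine le_trans ?_ (one_add_mul_le_pow (by linarith) D)
      have h2 : (D : ℝ) * (r / R) ≤ C' * t / R := by
        rw [← mul_div_assoc]
        refine div_le_div_of_nonneg_right ?_ hR0.le
        calc (D : ℝ) * r ≤ D * (C * t) := by gcongr
          _ = (D * C) * t := by ring
          _ ≤ C' * t := by
            gcongr
            have : 0 ≤ C + A * C + A * (C * W) := by positivity
            linarith
      linarith
    · push Not at hrR
      have h1 : (1 : ℝ) ≤ C' * t / R := by
        rw [one_le_div hR0]
        calc (R : ℝ) ≤ r := by exact_mod_cast hrR.le
          _ ≤ C * t := hr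
          _ ≤ C' * t := by
            gcongr
            have : 0 ≤ 1 + D * C + A * C + A * (C * W) := by positivity
            linarith
      have h2 : (2 * R + 1 : ℝ) ^ D * (1 - C' * t / R) ≤ 0 :=
        mul_nonpos_of_nonneg_of_nonpos hV.le (by linarith)
      exact h2.trans (by positivity)
  · rcases hcase with h0 | htW
    · rw [h0, Nat.cast_zero, mul_zero]
      positivity
    · refine hup.trans (mul_le_mul_of_nonneg_left ?_ hV.le)
      have h1 : C * t / R ≤ C * W := by
        rw [div_le_iff₀ hR0, mul_assoc]
        gcongr
      refine (hpow _ (by positivity) h1).trans ?_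
      rw [← mul_div_assoc, ← mul_assoc]
      gcongr
      have : 0 ≤ 1 + D * C + C + A * (C * W) := by positivity
      linarith
  · rcases hcase with h0 | htW
    · rw [h0, Nat.cast_zero, mul_zero]
      positivity
    · refine hup.trans (mul_le_mul_of_nonneg_left ?_ hV.le)
      have h1 : C * t / R ≤ C * W := by
        rw [div_le_iff₀ hR0, mul_assoc]
        gcongr
      refine (hpow _ (by positivity) h1).trans ?_
      have h2 : A * (C * t / R) ≤ A * (C * W) := by gcongr
      have : 0 ≤ D * C + C + A * C := by positivity
      linarith

end BoxCount

theorem sum_inv_pow_le {x : ℝ} (hx0 : 0 ≤ x) (hx : 2 * x ≤ 1) (a n : ℕ) :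
    ∑ k ∈ Finset.Icc a n, x ^ k ≤ 2 * x ^ a := by
  have key : ∀ m, ∑ k ∈ Finset.Ico a (a + m), x ^ k ≤ 2 * x ^ a - 2 * x ^ (a + m) := by
    intro m
    induction m with
    | zero => simp
    | succ m ih =>
      rw [← add_assoc, Finset.sum_Ico_succ_top (by omega), pow_succ x (a + m)]
      have : 0 ≤ x ^ (a + m) := by positivity
      nlinarith
  rcases le_or_gt a (n + 1) with h | h
  · obtain ⟨m, hm⟩ := Nat.exists_eq_add_of_le h
    have e : Finset.Icc a n = Finset.Ico a (a + m) := by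
      ext k
      rw [Finset.mem_Icc, Finset.mem_Ico]
      omega
    rw [e]
    have : 0 ≤ x ^ (a + m) := by positivity
    linarith [key m]
  · rw [Finset.Icc_eq_empty (by omega), Finset.sum_empty]
    positivity

theorem sum_log_mul_sub_le {p f : ℕ} (hp : p.Prime) (hf : 0 < f) {c : ℕ → ℝ} {W : ℝ} (hW : 0 ≤ W)
    (hc : ∀ k, (((p ^ f : ℕ) : ℝ)) ^ k * c k ≤ W) {n : ℕ} (hn : 1 ≤ n) :
    ∑ k ∈ Finset.Icc 1 n, Real.log ((p ^ f : ℕ) : ℝ) * c k -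
      (if (p ^ f).Prime then Real.log ((p ^ f : ℕ) : ℝ) * c 1 else 0) ≤
      W * (8 * (p : ℝ) ^ (-(3 / 2) : ℝ)) := by
  have hp2 : (2 : ℝ) ≤ p := by exact_mod_cast hp.two_le
  have hp0 : (0 : ℝ) < p := by linarith
  set q : ℕ := p ^ f with hq
  have hqp : p ≤ q := Nat.le_self_pow hf.ne' p
  have hq2 : (2 : ℝ) ≤ q := hp2.trans (by exact_mod_cast hqp)
  have hq0 : (0 : ℝ) < q := by linarith
  have hlog : 0 ≤ Real.log (q : ℝ) := Real.log_nonneg (by linarith)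
  have hterm : ∀ k, Real.log (q : ℝ) * c k ≤ Real.log q * W * ((q : ℝ)⁻¹) ^ k := fun k => by
    rw [mul_assoc]
    refine mul_le_mul_of_nonneg_left ?_ hlog
    rw [inv_pow, ← div_eq_mul_inv, le_div_iff₀ (by positivity), mul_comm]
    exact hc k
  have hgeom : ∀ a, ∑ k ∈ Finset.Icc a n, Real.log (q : ℝ) * c k ≤
      Real.log q * W * (2 * ((q : ℝ)⁻¹) ^ a) := fun a => by
    refine (Finset.sum_le_sum fun k _ => hterm k).trans ?_
    rw [← Finset.mul_sum]
    refine mul_le_mul_of_nonneg_left (sum_inv_pow_le (by positivity) ?_ a n) (by positivity)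
    rw [← div_eq_mul_inv, div_le_one hq0]
    exact hq2
  by_cases hprime : q.Prime
  · have hf1 : f = 1 := (Nat.Prime.eq_one_of_pow (hq ▸ hprime))
    have hqp' : (q : ℝ) = p := by rw [hq, hf1, pow_one]
    have h0 : Finset.Icc 1 n = insert 1 (Finset.Icc 2 n) := (Finset.insert_Icc_succ_left_eq_Icc hn).symm
    rw [if_pos hprime, h0, Finset.sum_insert (by simp)]
    have h1 := hgeom 2
    have h2 : Real.log (q : ℝ) ≤ (q : ℝ) ^ (1 / 2 : ℝ) / (1 / 2) :=
      Real.log_le_rpow_div hq0.le (by norm_num)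
    have h3 : Real.log (q : ℝ) * W * (2 * ((q : ℝ)⁻¹) ^ 2) ≤
        ((q : ℝ) ^ (1 / 2 : ℝ) / (1 / 2)) * W * (2 * ((q : ℝ)⁻¹) ^ 2) := by gcongr
    have h4 : ((q : ℝ)⁻¹) ^ 2 = (q : ℝ) ^ (-2 : ℝ) := by
      rw [Real.rpow_neg hq0.le, Real.rpow_ofNat, inv_pow]
    have h5 : ((q : ℝ) ^ (1 / 2 : ℝ) / (1 / 2)) * W * (2 * ((q : ℝ)⁻¹) ^ 2) =
        W * (4 * (p : ℝ) ^ (-(3 / 2) : ℝ)) := by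
      rw [h4, show (-(3 / 2) : ℝ) = 1 / 2 + -2 by norm_num, ← hqp', Real.rpow_add hq0]
      ring
    have h6 : 0 ≤ W * (p : ℝ) ^ (-(3 / 2) : ℝ) := by positivity
    linarith
  · have hf2 : 2 ≤ f := by
      by_contra h
      have : f = 1 := by omega
      exact hprime (by rw [hq, this, pow_one]; exact hp)
    rw [if_neg hprime, sub_zero]
    have h1 := hgeom 1
    have h2 : Real.log (q : ℝ) ≤ (q : ℝ) ^ (1 / 4 : ℝ) / (1 / 4) :=
      Real.log_le_rpow_div hq0.le (by norm_num)
    have h3 : Real.log (q : ℝ) * W * (2 * ((q : ℝ)⁻¹) ^ 1) ≤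
        ((q : ℝ) ^ (1 / 4 : ℝ) / (1 / 4)) * W * (2 * ((q : ℝ)⁻¹) ^ 1) := by gcongr
    have h4 : ((q : ℝ)⁻¹) ^ 1 = (q : ℝ) ^ (-1 : ℝ) := by
      rw [pow_one, Real.rpow_neg_one]
    have h5 : ((q : ℝ) ^ (1 / 4 : ℝ) / (1 / 4)) * W * (2 * ((q : ℝ)⁻¹) ^ 1) =
        W * (8 * (q : ℝ) ^ (-(3 / 4) : ℝ)) := by
      rw [h4, show (-(3 / 4) : ℝ) = 1 / 4 + -1 by norm_num, Real.rpow_add hq0]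
      ring
    have h6 : (q : ℝ) ^ (-(3 / 4) : ℝ) ≤ (p : ℝ) ^ (-(3 / 2) : ℝ) := by
      have h7 : ((p : ℝ) ^ (2 : ℕ)) ≤ q := by
        rw [hq]; push_cast
        exact pow_le_pow_right₀ (by linarith) hf2
      have h8 := Real.rpow_le_rpow_of_nonpos (by positivity) h7
        (show (-(3 / 4) : ℝ) ≤ 0 by norm_num)
      refine h8.trans (le_of_eq ?_)
      rw [← Real.rpow_natCast, ← Real.rpow_mul hp0.le]
      norm_num
    have h9 : W * (8 * (q : ℝ) ^ (-(3 / 4) : ℝ)) ≤ W * (8 * (p : ℝ) ^ (-(3 / 2) : ℝ)) := by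
      gcongr
    linarith

theorem sum_minFac_absNorm_le {O : Type*} [CommRing O] [IsDedekindDomain O] [Module.Free ℤ O]
    [Module.Finite ℤ O] (s : Finset (Ideal O)) (hs : ∀ P ∈ s, P.IsPrime ∧ P ≠ ⊥) (T : Finset ℕ)
    (hT : ∀ P ∈ s, (Ideal.absNorm P).minFac ∈ T) {g : ℕ → ℝ} (hg : ∀ p ∈ T, 0 ≤ g p) :
    ∑ P ∈ s, g (Ideal.absNorm P).minFac ≤ Module.finrank ℤ O * ∑ p ∈ T, g p := by
  classical
  rw [← Finset.sum_fiberwise_of_maps_to hT, Finset.mul_sum]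
  refine Finset.sum_le_sum fun p hp => ?_
  have h1 : ∑ P ∈ s with (Ideal.absNorm P).minFac = p, g (Ideal.absNorm P).minFac =
      ({P ∈ s | (Ideal.absNorm P).minFac = p} : Finset (Ideal O)).card * g p := by
    rw [← nsmul_eq_mul, ← Finset.sum_const]
    exact Finset.sum_congr rfl fun P hP => by rw [(Finset.mem_filter.mp hP).2]
  rw [h1]
  refine mul_le_mul_of_nonneg_right ?_ (hg p hp)
  rw [Nat.cast_le]
  rcases Finset.eq_empty_or_nonempty {P ∈ s | (Ideal.absNorm P).minFac = p} with h | ⟨P₀, hP₀⟩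
  · rw [h, Finset.card_empty]
    exact Nat.zero_le _
  · rw [Finset.mem_filter] at hP₀
    have hp : p.Prime := hP₀.2 ▸ (minFac_absNorm_mem (hs _ hP₀.1).1 (hs _ hP₀.1).2).2
    refine card_primes_over_le hp _ (fun P hP => ?_) fun P hP => ?_
    · rw [Finset.mem_filter] at hP
      exact ⟨(hs P hP.1).1, (hs P hP.1).2, hP.2 ▸ Nat.minFac_dvd _⟩
    · rw [Finset.mem_filter] at hP
      exact hP.2 ▸ (minFac_absNorm_mem (hs _ hP.1).1 (hs _ hP.1).2).1

section PrimeIdealSums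

open NumberField

variable {K : Type*} [Field K] [NumberField K] {ι : Type*} [Fintype ι]

/-- The nonzero prime ideals of norm at most `y`. -/
noncomputable def primeIdealsUpTo (K : Type*) [Field K] [NumberField K] (y : ℕ) :
    Finset (Ideal (𝓞 K)) :=
  open Classical in
  (Ideal.finite_setOfPred_absNorm_le (S := 𝓞 K) y).toFinset.filter fun P => P.IsPrime ∧ P ≠ ⊥

theorem mem_primeIdealsUpTo {y : ℕ} {P : Ideal (𝓞 K)} :
    P ∈ primeIdealsUpTo K y ↔ Ideal.absNorm P ≤ y ∧ P.IsPrime ∧ P ≠ ⊥ := by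
  classical
  rw [primeIdealsUpTo, Finset.mem_filter, Set.Finite.mem_toFinset]
  rfl

theorem sum_log_mul_boxCount (b : Module.Basis ι ℤ (𝓞 K)) {D M C₀ : ℕ}
    (hD : Fintype.card ι = D) (hC₀ : 0 < C₀)
    (hM : ∀ (R : ℕ) (α : 𝓞 K), α ∈ coordBox b R →
      R ^ D ≤ Ideal.absNorm (Ideal.span {((M * R : ℕ) : 𝓞 K) + α}) ∧
      Ideal.absNorm (Ideal.span {((M * R : ℕ) : 𝓞 K) + α}) ≤ C₀ * R ^ D) {R : ℕ} (hR : 1 ≤ R) :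
    (2 * R + 1 : ℝ) ^ D * (D * Real.log R) ≤
      ∑ P ∈ primeIdealsUpTo K (C₀ * R ^ D), ∑ k ∈ Finset.Icc 1 (C₀ * R ^ D),
        Real.log (Ideal.absNorm P) * boxCount b M R (P ^ k) ∧
    ∑ P ∈ primeIdealsUpTo K (C₀ * R ^ D), ∑ k ∈ Finset.Icc 1 (C₀ * R ^ D),
        Real.log (Ideal.absNorm P) * boxCount b M R (P ^ k) ≤
      (2 * R + 1 : ℝ) ^ D * (D * Real.log R + Real.log C₀) := by
  classical
  have hR0 : (0 : ℝ) < R := by exact_mod_cast hR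
  have hne : ∀ β ∈ coordBox b R, Ideal.absNorm (Ideal.span {((M * R : ℕ) : 𝓞 K) + β}) ≠ 0 :=
    fun β hβ h => by
      have := (hM R β hβ).1
      rw [h] at this
      have : 0 < R ^ D := by positivity
      omega
  have htot : ∑ P ∈ primeIdealsUpTo K (C₀ * R ^ D), ∑ k ∈ Finset.Icc 1 (C₀ * R ^ D),
        Real.log (Ideal.absNorm P) * boxCount b M R (P ^ k) =
      ∑ β ∈ coordBox b R, Real.log (Ideal.absNorm (Ideal.span {((M * R : ℕ) : 𝓞 K) + β})) := by
    have h1 : ∀ β ∈ coordBox b R,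
        Real.log (Ideal.absNorm (Ideal.span {((M * R : ℕ) : 𝓞 K) + β})) =
        ∑ P ∈ primeIdealsUpTo K (C₀ * R ^ D), ∑ k ∈ Finset.Icc 1 (C₀ * R ^ D),
          if ((M * R : ℕ) : 𝓞 K) + β ∈ P ^ k then Real.log (Ideal.absNorm P) else 0 := by
      intro β hβ
      rw [log_absNorm_eq_sum (fun h => hne β hβ (Ideal.absNorm_eq_zero_iff.mpr h))
        (primeIdealsUpTo K (C₀ * R ^ D)) (hM R β hβ).2
        (fun P hP => (mem_primeIdealsUpTo.mp hP).2) (fun P hP hle => ?_)]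
      · simp only [Ideal.span_singleton_le_iff_mem]
      · have hd := Nat.le_of_dvd (Nat.pos_of_ne_zero (hne β hβ))
          (Ideal.absNorm_dvd_absNorm_of_le hle)
        refine mem_primeIdealsUpTo.mpr ⟨hd.trans (hM R β hβ).2, hP, ?_⟩
        rintro rfl
        exact hne β hβ (Ideal.absNorm_eq_zero_iff.mpr (le_bot_iff.mp hle))
    rw [Finset.sum_congr rfl h1]
    refine Eq.trans ?_ Finset.sum_comm
    refine Finset.sum_congr rfl fun P _ => ?_
    refine Eq.trans ?_ Finset.sum_comm
    refine Finset.sum_congr rfl fun k _ => ?_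
    rw [← Finset.sum_filter, Finset.sum_const, nsmul_eq_mul, mul_comm]
    congr 2
  have hcard : ((coordBox b R).card : ℝ) = (2 * R + 1 : ℝ) ^ D := by
    rw [card_coordBox, hD]; push_cast; rfl
  rw [htot, ← hcard]
  constructor
  · rw [← nsmul_eq_mul]
    refine Finset.card_nsmul_le_sum _ _ _ fun β hβ => ?_
    rw [← Real.log_pow]
    refine Real.log_le_log (by positivity) ?_
    exact_mod_cast (hM R β hβ).1
  · rw [← nsmul_eq_mul]
    refine Finset.sum_le_card_nsmul _ _ _ fun β hβ => ?_
    have e : D * Real.log R + Real.log C₀ = Real.log (C₀ * (R : ℝ) ^ D) := by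
      rw [Real.log_mul (by positivity) (by positivity), Real.log_pow, add_comm]
    rw [e]
    refine Real.log_le_log ?_ ?_
    · exact_mod_cast Nat.pos_of_ne_zero (hne β hβ)
    · exact_mod_cast (hM R β hβ).2

end PrimeIdealSums

section DegreeOne

open NumberField

variable {K : Type*} [Field K] [NumberField K]

/-- The prime ideals of prime norm at most `y`. -/
noncomputable def degreeOneUpTo (K : Type*) [Field K] [NumberField K] (y : ℕ) :
    Finset (Ideal (𝓞 K)) :=
  (primeIdealsUpTo K y).filter fun P => (Ideal.absNorm P).Prime

theorem mem_degreeOneUpTo {y : ℕ} {P : Ideal (𝓞 K)} :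
    P ∈ degreeOneUpTo K y ↔
      (Ideal.absNorm P ≤ y ∧ P.IsPrime ∧ P ≠ ⊥) ∧ (Ideal.absNorm P).Prime := by
  rw [degreeOneUpTo, Finset.mem_filter, mem_primeIdealsUpTo]

open Classical in
theorem sum_degreeOneUpTo_le (y : ℕ) {g : ℕ → ℝ} (hg : ∀ p, p.Prime → 0 ≤ g p) :
    ∑ P ∈ degreeOneUpTo K y, g (Ideal.absNorm P) ≤
      Module.finrank ℤ (𝓞 K) * ∑ p ∈ Finset.Icc 1 y with p.Prime ∧ Nonempty (𝓞 K →+* ZMod p),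
        g p := by
  have h1 : ∑ P ∈ degreeOneUpTo K y, g (Ideal.absNorm P) =
      ∑ P ∈ degreeOneUpTo K y, g (Ideal.absNorm P).minFac :=
    Finset.sum_congr rfl fun P hP => by rw [(mem_degreeOneUpTo.mp hP).2.minFac_eq]
  rw [h1]
  refine sum_minFac_absNorm_le _ (fun P hP => (mem_degreeOneUpTo.mp hP).1.2) _ (fun P hP => ?_)
    fun p hp => hg p (Finset.mem_filter.mp hp).2.1
  have h2 := mem_degreeOneUpTo.mp hP
  rw [h2.2.minFac_eq, Finset.mem_filter, Finset.mem_Icc]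
  exact ⟨⟨h2.2.one_le, h2.1.1⟩, h2.2, nonempty_ringHom_zmod h2.2⟩

theorem sum_degreeOneUpTo_rpow_le {D : ℕ} (hD : 0 < D) (R : ℕ) :
    ∑ P ∈ degreeOneUpTo K (R ^ D), Real.log (Ideal.absNorm P) *
        (Ideal.absNorm P : ℝ) ^ ((D : ℝ)⁻¹ - 1) ≤
      Module.finrank ℤ (𝓞 K) * (Real.log 4 * D) * R := by
  classical
  have hnn : ∀ p : ℕ, p.Prime → 0 ≤ Real.log p * (p : ℝ) ^ ((D : ℝ)⁻¹ - 1) := fun p _ => by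
    have := Real.log_natCast_nonneg p
    positivity
  have h1 := sum_degreeOneUpTo_le (K := K) (R ^ D)
    (g := fun p => Real.log p * (p : ℝ) ^ ((D : ℝ)⁻¹ - 1)) hnn
  have hD1 : (1 : ℝ) ≤ D := by exact_mod_cast hD
  have h2 := sum_log_prime_mul_rpow_le (a := (D : ℝ)⁻¹) (by positivity)
    (inv_le_one_of_one_le₀ hD1) (R ^ D)
  have h3 : (((R ^ D : ℕ) : ℝ)) ^ ((D : ℝ)⁻¹) = R := by
    push_cast
    exact Real.pow_rpow_inv_natCast (by positivity) hD.ne'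
  rw [h3, div_inv_eq_mul] at h2
  refine h1.trans ?_
  rw [mul_assoc]
  refine mul_le_mul_of_nonneg_left ?_ (by positivity)
  refine le_trans (Finset.sum_le_sum_of_subset_of_nonneg ?_ ?_) h2
  · intro p hp
    rw [Finset.mem_filter] at hp ⊢
    exact ⟨hp.1, hp.2.1⟩
  · intro p hp _
    exact hnn p (Finset.mem_filter.mp hp).2

variable {ι : Type*} [Fintype ι]

theorem sum_log_div_absNorm_le (b : Module.Basis ι ℤ (𝓞 K)) {D M C₀ : ℕ} (hD : 0 < D)
    (hC₀ : 0 < C₀) {C : ℝ} (hC : 0 ≤ C)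
    (hlow : ∀ (R : ℕ), 1 ≤ R → ∀ J : Ideal (𝓞 K), J ≠ ⊥ →
      (2 * R + 1 : ℝ) ^ D * (1 - C * (Ideal.absNorm J : ℝ) ^ ((D : ℝ)⁻¹) / R) ≤
        Ideal.absNorm J * boxCount b M R J)
    (htot : ∀ R : ℕ, 1 ≤ R →
      ∑ P ∈ primeIdealsUpTo K (C₀ * R ^ D), ∑ k ∈ Finset.Icc 1 (C₀ * R ^ D),
        Real.log (Ideal.absNorm P) * boxCount b M R (P ^ k) ≤
      (2 * R + 1 : ℝ) ^ D * (D * Real.log R + Real.log C₀)) {R : ℕ} (hR : 1 ≤ R) :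
    ∑ P ∈ degreeOneUpTo K (R ^ D), Real.log (Ideal.absNorm P) / Ideal.absNorm P ≤
      D * Real.log R + (Real.log C₀ + C * (Module.finrank ℤ (𝓞 K) * (Real.log 4 * D))) := by
  classical
  have hR0 : (0 : ℝ) < R := by exact_mod_cast hR
  set V : ℝ := (2 * R + 1 : ℝ) ^ D with hV
  have hV0 : 0 < V := by positivity
  set n := C₀ * R ^ D with hn
  have hn1 : 1 ≤ n := Nat.succ_le_of_lt (by positivity)
  have hle : R ^ D ≤ n := Nat.le_mul_of_pos_left _ hC₀
  have h1 : ∑ P ∈ degreeOneUpTo K (R ^ D), V * (Real.log (Ideal.absNorm P) / Ideal.absNorm P -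
      C / R * (Real.log (Ideal.absNorm P) * (Ideal.absNorm P : ℝ) ^ ((D : ℝ)⁻¹ - 1))) ≤
      ∑ P ∈ primeIdealsUpTo K n, ∑ k ∈ Finset.Icc 1 n,
        Real.log (Ideal.absNorm P) * boxCount b M R (P ^ k) := by
    refine le_trans (Finset.sum_le_sum fun P hP => ?_)
      (Finset.sum_le_sum_of_subset_of_nonneg (s := degreeOneUpTo K (R ^ D)) ?_ ?_)
    · have hP' := mem_degreeOneUpTo.mp hP
      have hN0 : (0 : ℝ) < Ideal.absNorm P := by exact_mod_cast hP'.2.pos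
      have hl : 0 ≤ Real.log (Ideal.absNorm P : ℝ) := Real.log_natCast_nonneg _
      have h2 : Real.log (Ideal.absNorm P) * boxCount b M R P ≤
          ∑ k ∈ Finset.Icc 1 n, Real.log (Ideal.absNorm P) * boxCount b M R (P ^ k) := by
        have := Finset.single_le_sum (s := Finset.Icc 1 n)
          (f := fun k => Real.log (Ideal.absNorm P) * (boxCount b M R (P ^ k) : ℝ))
          (fun k _ => by positivity) (Finset.mem_Icc.mpr ⟨le_rfl, hn1⟩)
        simpa using this
      refine le_trans ?_ h2
      have h3 := hlow R hR P hP'.1.2.2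
      rw [Real.rpow_sub_one hN0.ne']
      have h4 := mul_le_mul_of_nonneg_left h3 (div_nonneg hl hN0.le)
      refine (le_of_eq ?_).trans (h4.trans (le_of_eq ?_))
      · rw [hV]; ring
      · field_simp
    · intro P hP
      have hP' := mem_degreeOneUpTo.mp hP
      exact mem_primeIdealsUpTo.mpr ⟨hP'.1.1.trans hle, hP'.1.2⟩
    · intro P _ _
      refine Finset.sum_nonneg fun k _ => ?_
      have := Real.log_natCast_nonneg (Ideal.absNorm P)
      positivity
  rw [← Finset.mul_sum, Finset.sum_sub_distrib, ← Finset.mul_sum] at h1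
  have h5 := le_of_mul_le_mul_left (h1.trans (htot R hR)) hV0
  have h6 := mul_le_mul_of_nonneg_left (sum_degreeOneUpTo_rpow_le (K := K) hD R)
    (show 0 ≤ C / R by positivity)
  have h7 : C / R * (Module.finrank ℤ (𝓞 K) * (Real.log 4 * D) * R) =
      C * (Module.finrank ℤ (𝓞 K) * (Real.log 4 * D)) := by
    field_simp
  linarith

theorem exists_sum_log_degreeOneUpTo_ge (b : Module.Basis ι ℤ (𝓞 K)) {D M C₀ : ℕ} (hD : 0 < D)
    (hC₀ : 0 < C₀) {C : ℝ} (hC : 1 ≤ C)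
    (hbox : ∀ (R : ℕ), 1 ≤ R → ∀ J : Ideal (𝓞 K), J ≠ ⊥ →
      (2 * R + 1 : ℝ) ^ D * (1 - C * (Ideal.absNorm J : ℝ) ^ ((D : ℝ)⁻¹) / R) ≤
        Ideal.absNorm J * boxCount b M R J ∧
      (Ideal.absNorm J * boxCount b M R J : ℝ) ≤
        (2 * R + 1 : ℝ) ^ D * (1 + C * (Ideal.absNorm J : ℝ) ^ ((D : ℝ)⁻¹) / R) ∧
      (Ideal.absNorm J * boxCount b M R J : ℝ) ≤ (2 * R + 1 : ℝ) ^ D * C)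
    (htot : ∀ R : ℕ, 1 ≤ R →
      (2 * R + 1 : ℝ) ^ D * (D * Real.log R) ≤
        ∑ P ∈ primeIdealsUpTo K (C₀ * R ^ D), ∑ k ∈ Finset.Icc 1 (C₀ * R ^ D),
          Real.log (Ideal.absNorm P) * boxCount b M R (P ^ k) ∧
      ∑ P ∈ primeIdealsUpTo K (C₀ * R ^ D), ∑ k ∈ Finset.Icc 1 (C₀ * R ^ D),
        Real.log (Ideal.absNorm P) * boxCount b M R (P ^ k) ≤
      (2 * R + 1 : ℝ) ^ D * (D * Real.log R + Real.log C₀)) :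
    ∃ E : ℕ, 1 ≤ E ∧ ∀ R : ℕ, 1 ≤ R →
      (R : ℝ) ^ D ≤ C * ∑ P ∈ degreeOneUpTo K (C₀ * (E * R) ^ D), Real.log (Ideal.absNorm P) := by
  classical
  set G : ℝ := Module.finrank ℤ (𝓞 K) * (Real.log 4 * D) with hG
  have hG0 : 0 ≤ G := by have := Real.log_nonneg (show (1 : ℝ) ≤ 4 by norm_num); positivity
  set S : ℝ := ∑' p : ℕ, (p : ℝ) ^ (-(3 / 2) : ℝ) with hS
  have hsum : Summable fun p : ℕ => (p : ℝ) ^ (-(3 / 2) : ℝ) :=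
    Real.summable_nat_rpow.mpr (by norm_num)
  set B : ℝ := Real.log C₀ + C * G + C * G + Module.finrank ℤ (𝓞 K) * (C * (8 * S)) + 1 with hB
  have hD1 : (1 : ℝ) ≤ D := by exact_mod_cast hD
  obtain ⟨E, hE⟩ := exists_nat_ge (Real.exp B)
  have hE0 : (0 : ℝ) < E := (Real.exp_pos B).trans_le hE
  have hE1 : 1 ≤ E := by exact_mod_cast hE0
  have hlogE : B ≤ Real.log E := by
    rw [← Real.log_exp B]
    exact Real.log_le_log (Real.exp_pos B) hE
  have hlogE' : B ≤ D * Real.log E := by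
    have : 0 ≤ Real.log (E : ℝ) := Real.log_natCast_nonneg E
    nlinarith
  refine ⟨E, hE1, fun R' hR' => ?_⟩
  have hR'0 : (0 : ℝ) < R' := by exact_mod_cast hR'
  set R := E * R' with hRdef
  have hR : 1 ≤ R := Nat.succ_le_of_lt (by positivity)
  have hR0 : (0 : ℝ) < R := by exact_mod_cast hR
  have hR'R : (R' : ℝ) ≤ R := by exact_mod_cast Nat.le_mul_of_pos_left R' hE1
  set n := C₀ * R ^ D with hn
  have hn1 : 1 ≤ n := Nat.succ_le_of_lt (by positivity)
  have hyn : R' ^ D ≤ n :=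
    (Nat.pow_le_pow_left (Nat.le_mul_of_pos_left R' hE1) D).trans (Nat.le_mul_of_pos_left _ hC₀)
  set V : ℝ := (2 * R + 1 : ℝ) ^ D with hV
  have hV0 : 0 < V := by positivity
  set L : Ideal (𝓞 K) → ℝ := fun P => Real.log (Ideal.absNorm P) with hL
  have hL0 : ∀ P, 0 ≤ L P := fun P => Real.log_natCast_nonneg _
  have hstep1 : ∑ P ∈ primeIdealsUpTo K n, ∑ k ∈ Finset.Icc 1 n, L P * boxCount b M R (P ^ k) ≤
      ∑ P ∈ degreeOneUpTo K n, L P * boxCount b M R P +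
      Module.finrank ℤ (𝓞 K) * (V * C * (8 * S)) := by
    have h1 : ∀ P ∈ primeIdealsUpTo K n,
        ∑ k ∈ Finset.Icc 1 n, L P * boxCount b M R (P ^ k) ≤
        (if (Ideal.absNorm P).Prime then L P * boxCount b M R P else 0) +
        V * C * (8 * ((Ideal.absNorm P).minFac : ℝ) ^ (-(3 / 2) : ℝ)) := by
      intro P hP
      have hP' := mem_primeIdealsUpTo.mp hP
      have := hP'.2.1.isMaximal hP'.2.2
      obtain ⟨p, f, hf0, hpP, hp, hf⟩ := Ideal.exists_prime_and_absNorm_eq_pow P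
      have h2 := sum_log_mul_sub_le hp hf0 (c := fun k => (boxCount b M R (P ^ k) : ℝ))
        (W := V * C) (by positivity) (fun k => ?_) hn1
      · rw [← hf, pow_one] at h2
        rw [show (Ideal.absNorm P).minFac = p by rw [hf, hp.pow_minFac hf0.ne']]
        linarith
      · have h3 := (hbox R hR (P ^ k) (pow_ne_zero k hP'.2.2)).2.2
        rw [map_pow, hf] at h3
        rw [Nat.cast_pow] at h3
        exact h3
    refine (Finset.sum_le_sum h1).trans ?_
    rw [Finset.sum_add_distrib, ← Finset.sum_filter]
    refine add_le_add le_rfl ?_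
    have hS' : ∑ p ∈ Finset.range (n + 1), V * C * (8 * (p : ℝ) ^ (-(3 / 2) : ℝ)) ≤
        V * C * (8 * S) := by
      rw [← Finset.mul_sum, ← Finset.mul_sum]
      have := hsum.sum_le_tsum (Finset.range (n + 1)) (fun p _ => by positivity)
      gcongr
    refine (sum_minFac_absNorm_le (primeIdealsUpTo K n)
      (fun P hP => (mem_primeIdealsUpTo.mp hP).2) (Finset.range (n + 1)) (fun P hP => ?_)
      (g := fun p => V * C * (8 * (p : ℝ) ^ (-(3 / 2) : ℝ))) fun p _ => by positivity).trans ?_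
    · have hP' := mem_primeIdealsUpTo.mp hP
      have h0 : 0 < Ideal.absNorm P :=
        Nat.pos_of_ne_zero fun h => hP'.2.2 (Ideal.absNorm_eq_zero_iff.mp h)
      exact Finset.mem_range.mpr (Nat.lt_succ_of_le ((Nat.minFac_le h0).trans hP'.1))
    · exact mul_le_mul_of_nonneg_left hS' (by positivity)
  have hstep2 : ∑ P ∈ degreeOneUpTo K n, L P * boxCount b M R P ≤
      V * (∑ P ∈ degreeOneUpTo K (R' ^ D), (L P / Ideal.absNorm P +
        C / R' * (L P * (Ideal.absNorm P : ℝ) ^ ((D : ℝ)⁻¹ - 1)))) +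
      V * (C / R' ^ D * ∑ P ∈ degreeOneUpTo K n, L P) := by
    rw [← Finset.sum_filter_add_sum_filter_not (degreeOneUpTo K n)
      (fun P => Ideal.absNorm P ≤ R' ^ D)]
    refine add_le_add ?_ ?_
    · have e : (degreeOneUpTo K n).filter (fun P => Ideal.absNorm P ≤ R' ^ D) =
          degreeOneUpTo K (R' ^ D) := by
        ext P
        rw [Finset.mem_filter, mem_degreeOneUpTo, mem_degreeOneUpTo]
        constructor
        · rintro ⟨⟨⟨_, h2⟩, h3⟩, h4⟩
          exact ⟨⟨h4, h2⟩, h3⟩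
        · rintro ⟨⟨h4, h2⟩, h3⟩
          exact ⟨⟨⟨h4.trans hyn, h2⟩, h3⟩, h4⟩
      rw [e, Finset.mul_sum]
      refine Finset.sum_le_sum fun P hP => ?_
      have hP' := mem_degreeOneUpTo.mp hP
      have hN0 : (0 : ℝ) < Ideal.absNorm P := by exact_mod_cast hP'.2.pos
      have h3 := (hbox R hR P hP'.1.2.2).2.1
      have h4 : V * (1 + C * (Ideal.absNorm P : ℝ) ^ ((D : ℝ)⁻¹) / R) ≤
          V * (1 + C * (Ideal.absNorm P : ℝ) ^ ((D : ℝ)⁻¹) / R') := by gcongr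
      have h5 := mul_le_mul_of_nonneg_left (h3.trans h4) (div_nonneg (hL0 P) hN0.le)
      rw [Real.rpow_sub_one hN0.ne']
      refine (le_of_eq ?_).trans (h5.trans (le_of_eq ?_))
      · field_simp
      · ring
    · rw [Finset.mul_sum, Finset.mul_sum]
      refine (Finset.sum_le_sum fun P hP => ?_).trans
        (Finset.sum_le_sum_of_subset_of_nonneg (Finset.filter_subset _ _) fun P _ _ => ?_)
      · rw [Finset.mem_filter] at hP
        have hP' := mem_degreeOneUpTo.mp hP.1
        have hN0 : (0 : ℝ) < Ideal.absNorm P := by exact_mod_cast hP'.2.pos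
        have hNy : (R' : ℝ) ^ D ≤ Ideal.absNorm P := by exact_mod_cast (not_le.mp hP.2).le
        have h3 := (hbox R hR P hP'.1.2.2).2.2
        have h4 : (boxCount b M R P : ℝ) ≤ V * C / R' ^ D := by
          rw [le_div_iff₀ (by positivity)]
          refine le_trans ?_ h3
          rw [mul_comm]
          gcongr
        refine (mul_le_mul_of_nonneg_left h4 (hL0 P)).trans (le_of_eq ?_)
        ring
      · have := hL0 P
        positivity
  have hstep3 : ∑ P ∈ degreeOneUpTo K (R' ^ D), (L P / Ideal.absNorm P +
        C / R' * (L P * (Ideal.absNorm P : ℝ) ^ ((D : ℝ)⁻¹ - 1))) ≤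
      D * Real.log R' + (Real.log C₀ + C * G) + C * G := by
    rw [Finset.sum_add_distrib, ← Finset.mul_sum]
    refine add_le_add ?_ ?_
    · exact sum_log_div_absNorm_le b hD hC₀ (by linarith) (fun R hR J hJ => (hbox R hR J hJ).1)
        (fun R hR => (htot R hR).2) hR'
    · have h6 := mul_le_mul_of_nonneg_left (sum_degreeOneUpTo_rpow_le (K := K) hD R')
        (show 0 ≤ C / R' by positivity)
      refine h6.trans (le_of_eq ?_)
      rw [hG]
      field_simp
  have h8 := ((htot R hR).1.trans hstep1).trans (add_le_add_left hstep2 _)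
  set tot := ∑ P ∈ degreeOneUpTo K n, L P with htot'
  have h9 : V * (D * Real.log R) ≤ V * ((D * Real.log R' + (Real.log C₀ + C * G) + C * G) +
      C / R' ^ D * tot + Module.finrank ℤ (𝓞 K) * (C * (8 * S))) := by
    have h10 := mul_le_mul_of_nonneg_left hstep3 hV0.le
    linarith
  have h11 := le_of_mul_le_mul_left h9 hV0
  have h12 : Real.log R = Real.log E + Real.log R' := by
    rw [hRdef, Nat.cast_mul, Real.log_mul hE0.ne' hR'0.ne']
  have h13 : 1 ≤ C / R' ^ D * tot := by
    rw [h12] at h11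
    linarith
  rw [div_mul_eq_mul_div, le_div_iff₀ (by positivity), one_mul] at h13
  exact h13

end DegreeOne

open NumberField in
open Classical in
theorem exists_mul_le_sum_log_prime (K : Type*) [Field K] [NumberField K] :
    ∃ c : ℝ, 0 < c ∧ ∃ N₀ : ℕ, ∀ n : ℕ, N₀ ≤ n →
      c * n ≤ ∑ p ∈ Finset.Icc 1 n with p.Prime ∧ Nonempty (𝓞 K →+* ZMod p), Real.log p := by
  set b := RingOfIntegers.basis K with hb
  set D := Module.finrank ℚ K with hD
  have hD0 : 0 < D := Module.finrank_pos
  have hrank : Module.finrank ℤ (𝓞 K) = D := RingOfIntegers.rank K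
  have hcard : Fintype.card (Module.Free.ChooseBasisIndex ℤ (𝓞 K)) = D := by
    rw [← hrank, Module.finrank_eq_card_basis b]
  have : Nonempty (Module.Free.ChooseBasisIndex ℤ (𝓞 K)) :=
    Fintype.card_pos_iff.mp (hcard ▸ hD0)
  obtain ⟨M, C₀, hC₀, hM⟩ := exists_absNorm_bounds b
  obtain ⟨C, hC, hbox⟩ := exists_boxCount_bounds b hcard (fun R α hα => (hM R α hα).2)
    (fun R α hR hα h0 => by
      have h1 := (hM R α hα).1
      rw [h0, Ideal.span_singleton_zero, ← Submodule.zero_eq_bot] at h1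
      have h2 : 0 < R ^ Module.finrank ℚ K := by positivity
      simp at h1
      omega)
  obtain ⟨E, hE, hge⟩ := exists_sum_log_degreeOneUpTo_ge b hD0 hC₀ hC hbox
    (fun R hR => sum_log_mul_boxCount b hcard hC₀ hM hR)
  have hD1 : (1 : ℝ) ≤ D := by exact_mod_cast hD0
  set A : ℕ := C₀ * E ^ D with hA
  have hA0 : 0 < A := by positivity
  have hA0' : (0 : ℝ) < A := by exact_mod_cast hA0
  refine ⟨(C * D * A * 2 ^ D)⁻¹, by positivity, A, fun n hn => ?_⟩
  set x : ℝ := ((n : ℝ) / A) ^ ((D : ℝ)⁻¹) with hx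
  have hxD : x ^ D = (n : ℝ) / A := Real.rpow_inv_natCast_pow (by positivity) hD0.ne'
  have hx1 : 1 ≤ x := by
    refine Real.one_le_rpow ?_ (by positivity)
    rw [one_le_div hA0']
    exact_mod_cast hn
  set R := ⌊x⌋₊ with hR
  have hR1 : 1 ≤ R := Nat.one_le_floor_iff x |>.mpr hx1
  have hRx : (R : ℝ) ≤ x := Nat.floor_le (by linarith)
  have hxR : x ≤ 2 * R := by
    have h1 := Nat.lt_floor_add_one x
    have h2 : (1 : ℝ) ≤ R := by exact_mod_cast hR1
    rw [← hR] at h1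
    linarith
  have hn' : C₀ * (E * R) ^ D ≤ n := by
    have h1 : (R : ℝ) ^ D ≤ n / A := hxD ▸ pow_le_pow_left₀ (by positivity) hRx D
    rw [le_div_iff₀ hA0'] at h1
    have h2 : R ^ D * A ≤ n := by exact_mod_cast h1
    calc C₀ * (E * R) ^ D = R ^ D * A := by rw [hA, mul_pow]; ring
      _ ≤ n := h2
  have h1 := hge R hR1
  have h2 := sum_degreeOneUpTo_le (K := K) (C₀ * (E * R) ^ D) (g := fun p => Real.log p)
    (fun p _ => Real.log_natCast_nonneg p)
  rw [hrank] at h2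
  have h3 : ∑ p ∈ Finset.Icc 1 (C₀ * (E * R) ^ D) with p.Prime ∧ Nonempty (𝓞 K →+* ZMod p),
      Real.log p ≤ ∑ p ∈ Finset.Icc 1 n with p.Prime ∧ Nonempty (𝓞 K →+* ZMod p), Real.log p :=
    Finset.sum_le_sum_of_subset_of_nonneg
      (Finset.filter_subset_filter _ (Finset.Icc_subset_Icc_right hn'))
      fun p _ _ => Real.log_natCast_nonneg p
  set T := ∑ p ∈ Finset.Icc 1 n with p.Prime ∧ Nonempty (𝓞 K →+* ZMod p), Real.log (p : ℝ) with hT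
  have h4 : (R : ℝ) ^ D ≤ C * (D * T) := by
    refine h1.trans (mul_le_mul_of_nonneg_left ?_ (by linarith))
    exact h2.trans (mul_le_mul_of_nonneg_left h3 (by positivity))
  have h5 : (n : ℝ) / A ≤ 2 ^ D * R ^ D := by
    rw [← hxD, ← mul_pow]
    exact pow_le_pow_left₀ (by linarith) hxR D
  rw [inv_mul_le_iff₀ (by positivity)]
  rw [div_le_iff₀ hA0'] at h5
  calc (n : ℝ) ≤ 2 ^ D * R ^ D * A := h5
    _ ≤ 2 ^ D * (C * (D * T)) * A := by gcongr
    _ = C * D * A * 2 ^ D * T := by ring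

theorem log_sub_log_le_sum_div {w : ℕ → ℝ} (hw0 : ∀ k, 0 ≤ w k) {c : ℝ} (hc : 0 ≤ c) {N₀ : ℕ}
    (hN₀ : 1 ≤ N₀) (hw : ∀ n, N₀ ≤ n → c * n ≤ ∑ k ∈ Finset.Icc 1 n, w k) {n : ℕ} (hn : N₀ ≤ n) :
    c * (Real.log (n + 1) - Real.log (N₀ + 1)) ≤ ∑ k ∈ Finset.Icc 1 n, w k / k := by
  have key : ∀ m, N₀ ≤ m → c * (Real.log (m + 1) - Real.log (N₀ + 1)) ≤
      ∑ k ∈ Finset.Icc 1 m, w k / k - (∑ k ∈ Finset.Icc 1 m, w k) / m := by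
    intro m hm
    induction m, hm using Nat.le_induction with
    | base =>
      rw [sub_self, mul_zero, sub_nonneg, Finset.sum_div]
      refine Finset.sum_le_sum fun k hk => ?_
      rw [Finset.mem_Icc] at hk
      have h1 : (0 : ℝ) < k := by exact_mod_cast hk.1
      have h2 : (k : ℝ) ≤ N₀ := by exact_mod_cast hk.2
      exact div_le_div_of_nonneg_left (hw0 k) h1 h2
    | succ m hm ih =>
      have hm0 : (0 : ℝ) < m := by exact_mod_cast (hN₀.trans hm)
      rw [Finset.sum_Icc_succ_top (by omega), Finset.sum_Icc_succ_top (by omega)]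
      set T := ∑ k ∈ Finset.Icc 1 m, w k with hT
      have h1 : c * m ≤ T := hw m hm
      have h2 : Real.log ((m + 1 : ℕ) + 1) - Real.log (m + 1) ≤ 1 / (m + 1) := by
        push_cast
        rw [← Real.log_div (by positivity) (by positivity)]
        refine (Real.log_le_sub_one_of_pos (by positivity)).trans (le_of_eq ?_)
        field_simp
        ring
      have h3 : c * (Real.log ((m + 1 : ℕ) + 1) - Real.log (m + 1)) ≤ c * (1 / (m + 1)) :=
        mul_le_mul_of_nonneg_left h2 hc
      have h4 : c * (1 / ((m : ℝ) + 1)) ≤ T / m - T / (m + 1) := by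
        rw [div_sub_div _ _ (by positivity) (by positivity), mul_one_div,
          div_le_div_iff₀ (by positivity) (by positivity)]
        nlinarith [mul_le_mul_of_nonneg_right h1 (show 0 ≤ (m : ℝ) + 1 by positivity)]
      have h5 : (T + w (m + 1)) / ((m + 1 : ℕ) : ℝ) =
          T / (m + 1) + w (m + 1) / ((m + 1 : ℕ) : ℝ) := by
        push_cast
        rw [add_div]
      rw [h5]
      linarith
  have h1 := key n hn
  have h2 : 0 ≤ (∑ k ∈ Finset.Icc 1 n, w k) / n :=
    div_nonneg (Finset.sum_nonneg fun k _ => hw0 k) (by positivity)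
  linarith

theorem sum_div_le_mul_one_add_log {w : ℕ → ℝ} {A : ℝ} (hA : 0 ≤ A)
    (hw : ∀ n : ℕ, ∑ k ∈ Finset.Icc 1 n, w k ≤ A * n) (n : ℕ) :
    ∑ k ∈ Finset.Icc 1 n, w k / k ≤ A * (1 + Real.log n) := by
  have h1 := sum_mul_le_of_antitone (w := w) (g := fun k => (k : ℝ)⁻¹) (A := A)
    (fun k hk => by
      have : (0 : ℝ) < k := by exact_mod_cast hk
      exact inv_anti₀ this (by push_cast; linarith)) (fun k => by positivity) hw n
  have h2 := harmonic_le_one_add_log n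
  rw [harmonic_eq_sum_Icc] at h2
  push_cast at h2
  simp only [div_eq_mul_inv]
  exact h1.trans (mul_le_mul_of_nonneg_left h2 hA)

section SetOfPrimes

variable {S : ℕ → Prop}

open Classical in
theorem sum_log_filter_le (hS : ∀ p, S p → p.Prime) (n : ℕ) :
    ∑ p ∈ Finset.Icc 1 n, (if S p then Real.log p else 0) ≤ Real.log 4 * n := by
  rw [← Finset.sum_filter]
  have h1 := Chebyshev.theta_le_log4_mul_x (x := (n : ℝ)) (by positivity)
  rw [Chebyshev.theta_eq_sum_Icc, Nat.floor_natCast] at h1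
  refine le_trans (Finset.sum_le_sum_of_subset_of_nonneg (fun p hp => ?_)
    fun p _ _ => Real.log_natCast_nonneg p) h1
  rw [Finset.mem_filter, Finset.mem_Icc] at hp ⊢
  exact ⟨⟨by omega, hp.1.2⟩, hS p hp.2⟩

open Classical in
theorem exists_le_sum_inv (hS : ∀ p, S p → p.Prime) {c : ℝ} (hc : 0 < c) {N₀ : ℕ}
    (hT : ∀ n, N₀ ≤ n → c * n ≤ ∑ p ∈ Finset.Icc 1 n, (if S p then Real.log p else 0)) :
    ∃ B z₀ : ℕ, 1 ≤ B ∧ ∀ z, z₀ ≤ z →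
      (B : ℝ)⁻¹ ≤ ∑ p ∈ Finset.Ioc z (z ^ B) with S p, (p : ℝ)⁻¹ := by
  have hl4 : 0 ≤ Real.log 4 := Real.log_nonneg (by norm_num)
  set w : ℕ → ℝ := fun p => if S p then Real.log p else 0 with hw
  have hw0 : ∀ k, 0 ≤ w k := fun k => by
    simp only [hw]
    split_ifs
    · exact Real.log_natCast_nonneg k
    · exact le_rfl
  obtain ⟨B, hB⟩ := exists_nat_ge ((Real.log 4 + 2) / c)
  rw [div_le_iff₀ hc] at hB
  have hB0 : (0 : ℝ) < B := by
    by_contra h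
    have : (B : ℝ) * c ≤ 0 := mul_nonpos_of_nonpos_of_nonneg (not_lt.mp h) hc.le
    linarith
  have hB1 : 1 ≤ B := by exact_mod_cast hB0
  set N₁ := max N₀ 1 with hN₁
  set C : ℝ := c * Real.log (N₁ + 1) + Real.log 4 with hC
  obtain ⟨z₀, hz₀⟩ := exists_nat_ge (Real.exp C)
  refine ⟨B, max z₀ (max N₁ 2), hB1, fun z hz => ?_⟩
  have hz2 : 2 ≤ z := (le_max_right _ _).trans ((le_max_right _ _).trans hz)
  have hzN : N₁ ≤ z := (le_max_left _ _).trans ((le_max_right _ _).trans hz)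
  have hz0 : (0 : ℝ) < z := by positivity
  have hlogz : C ≤ Real.log z := by
    rw [← Real.log_exp C]
    exact Real.log_le_log (Real.exp_pos C)
      (hz₀.trans (by exact_mod_cast (le_max_left _ _).trans hz))
  have hlz0 : 0 < Real.log z := Real.log_pos (by exact_mod_cast hz2)
  have hzB : z ≤ z ^ B := Nat.le_self_pow (by omega) z
  have h1 := log_sub_log_le_sum_div hw0 hc.le (le_max_right N₀ 1)
    (fun n hn => hT n ((le_max_left _ _).trans hn)) (hzN.trans hzB)
  have h2 := sum_div_le_mul_one_add_log hl4 (sum_log_filter_le hS) z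
  have h3 : Real.log ((z ^ B : ℕ) : ℝ) ≤ Real.log (((z ^ B : ℕ) : ℝ) + 1) :=
    Real.log_le_log (by positivity) (by linarith)
  have h4 : Real.log ((z ^ B : ℕ) : ℝ) = B * Real.log z := by
    push_cast
    rw [Real.log_pow]
  have h5 : ∑ k ∈ Finset.Icc 1 (z ^ B), w k / k =
      ∑ k ∈ Finset.Icc 1 z, w k / k + ∑ k ∈ Finset.Ioc z (z ^ B), w k / k := by
    rw [← Finset.sum_union]
    · congr 1
      ext k
      rw [Finset.mem_union, Finset.mem_Icc, Finset.mem_Icc, Finset.mem_Ioc]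
      omega
    · rw [Finset.disjoint_left]
      intro k hk hk'
      rw [Finset.mem_Icc] at hk
      rw [Finset.mem_Ioc] at hk'
      omega
  have h6 : ∑ k ∈ Finset.Ioc z (z ^ B), w k / k ≤
      (B * Real.log z) * ∑ p ∈ Finset.Ioc z (z ^ B) with S p, (p : ℝ)⁻¹ := by
    rw [Finset.sum_filter, Finset.mul_sum]
    refine Finset.sum_le_sum fun k hk => ?_
    rw [Finset.mem_Ioc] at hk
    simp only [hw]
    split_ifs
    · rw [div_eq_mul_inv]
      refine mul_le_mul_of_nonneg_right ?_ (by positivity)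
      rw [← h4]
      have hk0 : (0 : ℝ) < k := by exact_mod_cast (by omega : 0 < k)
      exact Real.log_le_log hk0 (by exact_mod_cast hk.2)
    · simp
  have h7 : Real.log z ≤ (B * Real.log z) * ∑ p ∈ Finset.Ioc z (z ^ B) with S p, (p : ℝ)⁻¹ := by
    refine le_trans ?_ h6
    have h8 : c * (B * Real.log z) ≤ c * Real.log (((z ^ B : ℕ) : ℝ) + 1) := by
      rw [← h4]
      exact mul_le_mul_of_nonneg_left h3 hc.le
    have h9 : (Real.log 4 + 2) * Real.log z ≤ B * c * Real.log z :=
      mul_le_mul_of_nonneg_right hB hlz0.le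
    have h10 : ∑ k ∈ Finset.Icc 1 z, w k / k ≤ Real.log 4 * (1 + Real.log z) := h2
    nlinarith
  rw [inv_le_iff_one_le_mul₀' hB0]
  have h11 : Real.log z * 1 ≤
      Real.log z * (B * ∑ p ∈ Finset.Ioc z (z ^ B) with S p, (p : ℝ)⁻¹) := by linarith
  exact le_of_mul_le_mul_left h11 hlz0

end SetOfPrimes

open Classical in
/-- The squarefree numbers in `[1, z]` all of whose prime factors satisfy `S`. -/
noncomputable def squarefreeUpTo (S : ℕ → Prop) (z : ℕ) : Finset ℕ :=
  (Finset.Icc 1 z).filter fun m => Squarefree m ∧ ∀ p, p.Prime → p ∣ m → S p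

section SquarefreeUpTo

variable {S : ℕ → Prop}

theorem mem_squarefreeUpTo {z m : ℕ} : m ∈ squarefreeUpTo S z ↔
    (1 ≤ m ∧ m ≤ z) ∧ Squarefree m ∧ ∀ p, p.Prime → p ∣ m → S p := by
  classical
  rw [squarefreeUpTo, Finset.mem_filter, Finset.mem_Icc]

theorem mul_mem_squarefreeUpTo (hS : ∀ p, S p → p.Prime) {z y m p : ℕ}
    (hm : m ∈ squarefreeUpTo S z) (hp : S p) (hzp : z < p) (hy : m * p ≤ y) :
    m * p ∈ squarefreeUpTo S y := by
  rw [mem_squarefreeUpTo] at hm ⊢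
  have hpp := hS p hp
  have hcop : Nat.Coprime m p := by
    refine Nat.Coprime.symm ((Nat.Prime.coprime_iff_not_dvd hpp).mpr fun h => ?_)
    have := Nat.le_of_dvd hm.1.1 h
    omega
  refine ⟨⟨Nat.mul_pos hm.1.1 hpp.pos, hy⟩,
    (Nat.squarefree_mul hcop).mpr ⟨hm.2.1, hpp.prime.squarefree⟩, fun q hq hqd => ?_⟩
  rcases (Nat.Prime.dvd_mul hq).mp hqd with h | h
  · exact hm.2.2 q hq h
  · rwa [(Nat.prime_dvd_prime_iff_eq hq hpp).mp h]

theorem eq_of_mul_prime_eq {z m m' p p' : ℕ} (hm' : 1 ≤ m' ∧ m' ≤ z)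
    (hp : p.Prime) (hp' : p'.Prime) (hzp : z < p) (h : m * p = m' * p') :
    m = m' ∧ p = p' := by
  have h1 : p ∣ m' * p' := h ▸ Dvd.intro_left m rfl
  rcases (Nat.Prime.dvd_mul hp).mp h1 with h2 | h2
  · have := Nat.le_of_dvd hm'.1 h2
    omega
  · have h3 := (Nat.prime_dvd_prime_iff_eq hp hp').mp h2
    subst h3
    exact ⟨Nat.eq_of_mul_eq_mul_right hp.pos h, rfl⟩

open Classical in
theorem sum_inv_squarefreeUpTo_mul_le (hS : ∀ p, S p → p.Prime) (z y : ℕ) :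
    (∑ m ∈ squarefreeUpTo S z, (m : ℝ)⁻¹) * (1 + ∑ p ∈ Finset.Ioc z y with S p, (p : ℝ)⁻¹) ≤
      ∑ m ∈ squarefreeUpTo S (z * max y 1), (m : ℝ)⁻¹ := by
  set Q := (Finset.Ioc z y).filter S with hQ
  have hmemQ : ∀ p ∈ Q, (z < p ∧ p ≤ y) ∧ S p := fun p hp => by
    rw [hQ, Finset.mem_filter, Finset.mem_Ioc] at hp
    exact hp
  have hinj : Set.InjOn (fun q : ℕ × ℕ => q.1 * q.2) (squarefreeUpTo S z ×ˢ Q : Finset (ℕ × ℕ)) := by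
    rintro ⟨m, p⟩ h ⟨m', p'⟩ h' he
    rw [Finset.mem_coe, Finset.mem_product] at h h'
    have h1 := hmemQ p h.2
    have h2 := hmemQ p' h'.2
    obtain ⟨e1, e2⟩ := eq_of_mul_prime_eq (mem_squarefreeUpTo.mp h'.1).1 (hS p h1.2) (hS p' h2.2) h1.1.1 he
    exact Prod.ext e1 e2
  have hprod : (∑ m ∈ squarefreeUpTo S z, (m : ℝ)⁻¹) * ∑ p ∈ Q, (p : ℝ)⁻¹ =
      ∑ m ∈ (squarefreeUpTo S z ×ˢ Q).image (fun q : ℕ × ℕ => q.1 * q.2), (m : ℝ)⁻¹ := by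
    rw [Finset.sum_image hinj, Finset.sum_mul_sum, ← Finset.sum_product']
    refine Finset.sum_congr rfl fun q _ => ?_
    push_cast
    rw [mul_inv]
  have hdisj : Disjoint (squarefreeUpTo S z)
      ((squarefreeUpTo S z ×ˢ Q).image (fun q : ℕ × ℕ => q.1 * q.2)) := by
    rw [Finset.disjoint_left]
    intro m hm hm'
    obtain ⟨⟨m', p⟩, hq, rfl⟩ := Finset.mem_image.mp hm'
    rw [Finset.mem_product] at hq
    have h1 : m' * p ≤ z := (mem_squarefreeUpTo.mp hm).1.2
    have h2 : 1 ≤ m' := (mem_squarefreeUpTo.mp hq.1).1.1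
    have h3 : z < p := (hmemQ p hq.2).1.1
    have h4 := Nat.le_mul_of_pos_left p h2
    omega
  rw [mul_add, mul_one, hprod, ← Finset.sum_union hdisj]
  refine Finset.sum_le_sum_of_subset_of_nonneg (fun m hm => ?_) fun m _ _ => by positivity
  rcases Finset.mem_union.mp hm with h | h
  · rw [mem_squarefreeUpTo] at h ⊢
    exact ⟨⟨h.1.1, h.1.2.trans (Nat.le_mul_of_pos_right z (by positivity))⟩, h.2⟩
  · obtain ⟨⟨m', p⟩, hq, rfl⟩ := Finset.mem_image.mp h
    rw [Finset.mem_product] at hq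
    have h3 := hmemQ p hq.2
    refine mul_mem_squarefreeUpTo hS hq.1 h3.2 h3.1.1 ?_
    exact Nat.mul_le_mul (mem_squarefreeUpTo.mp hq.1).1.2 (h3.1.2.trans (le_max_left _ _))

theorem sum_inv_squarefreeUpTo_mono {z y : ℕ} (h : z ≤ y) :
    ∑ m ∈ squarefreeUpTo S z, (m : ℝ)⁻¹ ≤ ∑ m ∈ squarefreeUpTo S y, (m : ℝ)⁻¹ := by
  refine Finset.sum_le_sum_of_subset_of_nonneg (fun m hm => ?_) fun m _ _ => by positivity
  rw [mem_squarefreeUpTo] at hm ⊢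
  exact ⟨⟨hm.1.1, hm.1.2.trans h⟩, hm.2⟩

theorem one_le_sum_inv_squarefreeUpTo {z : ℕ} (h : 1 ≤ z) :
    1 ≤ ∑ m ∈ squarefreeUpTo S z, (m : ℝ)⁻¹ := by
  have h1 : 1 ∈ squarefreeUpTo S z := by
    rw [mem_squarefreeUpTo]
    refine ⟨⟨le_rfl, h⟩, squarefree_one, fun p hp hp1 => ?_⟩
    exact absurd (Nat.dvd_one.mp hp1) hp.ne_one
  have := Finset.single_le_sum (f := fun m : ℕ => (m : ℝ)⁻¹) (fun m _ => by positivity) h1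
  simpa using this

theorem exists_rpow_log_le_sum_inv (hS : ∀ p, S p → p.Prime) {B z₀ : ℕ} (hB : 1 ≤ B)
    (h : open Classical in ∀ z, z₀ ≤ z →
      (B : ℝ)⁻¹ ≤ ∑ p ∈ Finset.Ioc z (z ^ B) with S p, (p : ℝ)⁻¹) :
    ∃ η a : ℝ, 0 < η ∧ η ≤ 1 ∧ 0 < a ∧ ∃ z₁ : ℕ, ∀ z, z₁ ≤ z →
      a * Real.log z ^ η ≤ ∑ m ∈ squarefreeUpTo S z, (m : ℝ)⁻¹ := by
  classical
  have hB0 : (0 : ℝ) < B := by exact_mod_cast hB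
  set L : ℕ → ℝ := fun z => ∑ m ∈ squarefreeUpTo S z, (m : ℝ)⁻¹ with hL
  set q : ℝ := 1 + (B : ℝ)⁻¹ with hq
  have hq1 : 1 < q := by
    have : 0 < (B : ℝ)⁻¹ := by positivity
    linarith
  have hstep : ∀ z, z₀ ≤ z → 1 ≤ z → L z * q ≤ L (z ^ (B + 1)) := fun z hz hz1 => by
    have h1 := sum_inv_squarefreeUpTo_mul_le hS z (z ^ B)
    rw [max_eq_left (Nat.one_le_pow _ _ hz1), ← pow_succ'] at h1
    refine le_trans ?_ h1
    refine mul_le_mul_of_nonneg_left ?_ (Finset.sum_nonneg fun m _ => by positivity)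
    have := h z hz
    linarith
  set z₁ := max z₀ 2 with hz₁
  have hz₁2 : 2 ≤ z₁ := le_max_right _ _
  have hiter : ∀ k, q ^ k ≤ L (z₁ ^ ((B + 1) ^ k)) := fun k => by
    induction k with
    | zero =>
      simp only [pow_zero, pow_one]
      exact one_le_sum_inv_squarefreeUpTo (by omega)
    | succ k ih =>
      have h1 : z₁ ≤ z₁ ^ ((B + 1) ^ k) := Nat.le_self_pow (by positivity) z₁
      have h2 := hstep _ ((le_max_left _ _).trans h1) (by omega)
      rw [← pow_mul, ← pow_succ] at h2
      rw [pow_succ]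
      exact (mul_le_mul_of_nonneg_right ih (by linarith)).trans h2
  have hQ1 : (1 : ℝ) < (B + 1 : ℕ) := by push_cast; linarith
  have hlQ : 0 < Real.log (B + 1 : ℕ) := Real.log_pos hQ1
  have hlq : 0 < Real.log q := Real.log_pos hq1
  have hlz₁ : 0 < Real.log z₁ := Real.log_pos (by exact_mod_cast hz₁2)
  set η : ℝ := Real.log q / Real.log (B + 1 : ℕ) with hη
  have hη0 : 0 < η := div_pos hlq hlQ
  have hQη : ((B + 1 : ℕ) : ℝ) ^ η = q := by
    rw [Real.rpow_def_of_pos (by positivity), hη, mul_div_cancel₀ _ hlQ.ne',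
      Real.exp_log (by linarith)]
  have hη1 : η ≤ 1 := by
    rw [hη, div_le_one hlQ]
    refine Real.log_le_log (by linarith) ?_
    have : (B : ℝ)⁻¹ ≤ 1 := inv_le_one_of_one_le₀ (by exact_mod_cast hB)
    have : (1 : ℝ) ≤ B := by exact_mod_cast hB
    push_cast
    linarith
  refine ⟨η, (((B + 1 : ℕ) : ℝ) * Real.log z₁)⁻¹ ^ η, hη0, hη1, by positivity, z₁, fun z hz => ?_⟩
  have hz0 : (0 : ℝ) < z := by exact_mod_cast (by omega : 0 < z)
  set u := Nat.log z₁ z with hu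
  have hu1 : 1 ≤ u := Nat.log_pos (by omega) hz
  set k := Nat.log (B + 1) u with hk
  have h1 : (B + 1) ^ k ≤ u := Nat.pow_log_le_self _ (by omega)
  have h2 : u + 1 ≤ (B + 1) ^ (k + 1) := Nat.lt_pow_succ_log_self (by omega) u
  have h3 : z₁ ^ ((B + 1) ^ k) ≤ z :=
    (Nat.pow_le_pow_right (by omega) h1).trans (Nat.pow_log_le_self _ (by omega))
  have h4 : z ≤ z₁ ^ ((B + 1) ^ (k + 1)) :=
    (Nat.lt_pow_succ_log_self (by omega) z).le.trans (Nat.pow_le_pow_right (by omega) h2)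
  have h5 : Real.log z ≤ ((B + 1 : ℕ) : ℝ) ^ (k + 1) * Real.log z₁ := by
    have : (z : ℝ) ≤ (z₁ : ℝ) ^ ((B + 1) ^ (k + 1)) := by exact_mod_cast h4
    refine (Real.log_le_log hz0 this).trans (le_of_eq ?_)
    rw [Real.log_pow]
    push_cast
    rfl
  have h6 := (hiter k).trans (sum_inv_squarefreeUpTo_mono h3)
  refine le_trans ?_ h6
  have hlz : 0 ≤ Real.log (z : ℝ) := Real.log_natCast_nonneg z
  rw [← Real.mul_rpow (by positivity) hlz]
  have h7 : (((B + 1 : ℕ) : ℝ) * Real.log z₁)⁻¹ * Real.log z ≤ ((B + 1 : ℕ) : ℝ) ^ k := by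
    rw [inv_mul_le_iff₀ (by positivity)]
    refine h5.trans (le_of_eq ?_)
    ring
  refine (Real.rpow_le_rpow (by positivity) h7 hη0.le).trans (le_of_eq ?_)
  rw [← hQη, ← Real.rpow_natCast, ← Real.rpow_mul (by positivity), mul_comm,
    Real.rpow_mul (by positivity), Real.rpow_natCast]

end SquarefreeUpTo

open Classical in
theorem exists_card_squarefreeUpTo_ge {S : ℕ → Prop} (hS : ∀ p, S p → p.Prime) {c : ℝ}
    (hc : 0 < c) {N₀ : ℕ}
    (hT : ∀ n, N₀ ≤ n → c * n ≤ ∑ p ∈ Finset.Icc 1 n, (if S p then Real.log p else 0)) :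
    ∃ γ a : ℝ, 0 ≤ γ ∧ γ < 1 ∧ 0 < a ∧ ∃ N₁ : ℕ, ∀ N, N₁ ≤ N →
      a * N / Real.log N ^ γ ≤ ((squarefreeUpTo S N).card : ℝ) := by
  obtain ⟨B, z₀, hB, hinv⟩ := exists_le_sum_inv hS hc hT
  obtain ⟨η, a, hη0, hη1, ha, z₁, hL⟩ := exists_rpow_log_le_sum_inv hS hB hinv
  have hl4 : 0 < Real.log 4 := Real.log_pos (by norm_num)
  obtain ⟨K, hK⟩ := exists_nat_ge (2 * Real.log 4 / c)
  rw [div_le_iff₀ hc] at hK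
  have hK0 : (0 : ℝ) < K := by
    by_contra h
    have : (K : ℝ) * c ≤ 0 := mul_nonpos_of_nonpos_of_nonneg (not_lt.mp h) hc.le
    linarith
  have hK1 : 1 ≤ K := by exact_mod_cast hK0
  set Z := max (max z₁ N₀) 2 with hZ
  refine ⟨1 - η, c / 4 * (a * (1 / 4) ^ η), by linarith, by linarith, by positivity,
    max (Z ^ 2 * K) (16 * K ^ 2), fun N hN => ?_⟩
  set w := Nat.sqrt (N / K) with hw
  have hN1 := (le_max_left _ _).trans hN
  have hN2 := (le_max_right _ _).trans hN
  have hwZ : Z ≤ w := by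
    rw [hw, Nat.le_sqrt, ← pow_two, Nat.le_div_iff_mul_le hK1]
    exact hN1
  have hw2 : 2 ≤ w := (le_max_right _ _).trans hwZ
  have hwz₁ : z₁ ≤ w := (le_max_left _ _).trans ((le_max_left _ _).trans hwZ)
  have hwN₀ : N₀ ≤ w := (le_max_right _ _).trans ((le_max_left _ _).trans hwZ)
  have hwK : w * w * K ≤ N := by
    have h1 : w * w ≤ N / K := Nat.sqrt_le _
    exact (Nat.le_div_iff_mul_le hK1).mp h1
  have hNw : N ≤ w ^ 4 := by
    have h1 : N / K < (w + 1) * (w + 1) := Nat.lt_succ_sqrt _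
    rw [Nat.div_lt_iff_lt_mul hK1] at h1
    have h2 : (w + 1) * (w + 1) ≤ 4 * w ^ 2 := by nlinarith
    have h3 : N ≤ 4 * w ^ 2 * K := h1.le.trans (Nat.mul_le_mul_right K h2)
    have h4 : N * N ≤ 16 * K ^ 2 * w ^ 4 := by
      refine (Nat.mul_le_mul h3 h3).trans (le_of_eq ?_)
      ring
    have h5 : 0 < N := by
      have : 0 < 16 * K ^ 2 := by positivity
      omega
    have h6 : N * N ≤ N * w ^ 4 := h4.trans (Nat.mul_le_mul_right _ hN2)
    exact Nat.le_of_mul_le_mul_left h6 h5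
  have hw0 : (0 : ℝ) < w := by exact_mod_cast (by omega : 0 < w)
  have hwN : w ≤ N := by
    have h1 : w * 1 ≤ w * (w * K) :=
      Nat.mul_le_mul_left w (Nat.succ_le_of_lt (Nat.mul_pos (by omega) hK1))
    calc w = w * 1 := (mul_one w).symm
      _ ≤ w * (w * K) := h1
      _ = w * w * K := by ring
      _ ≤ N := hwK
  have hN0 : (0 : ℝ) < N := by exact_mod_cast (by omega : 0 < N)
  have hlN : 0 < Real.log N := Real.log_pos (by exact_mod_cast (by omega : 1 < N))
  set Q : ℕ → Finset ℕ := fun m => (Finset.Ioc w (N / m)).filter S with hQ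
  have hcount : ∀ m ∈ squarefreeUpTo S w, c / 4 * N / Real.log N * (m : ℝ)⁻¹ ≤ (Q m).card := by
    intro m hm
    have hm' := (mem_squarefreeUpTo.mp hm).1
    have hm0 : (0 : ℝ) < m := by exact_mod_cast hm'.1
    have hx : K * w ≤ N / m := by
      rw [Nat.le_div_iff_mul_le hm'.1]
      calc K * w * m ≤ K * w * w := Nat.mul_le_mul_left _ hm'.2
        _ = w * w * K := by ring
        _ ≤ N := hwK
    set x := N / m with hxdef
    have hwx : w ≤ x := (Nat.le_mul_of_pos_left w hK1).trans hx
    have h1 := hT x (hwN₀.trans hwx)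
    have h2 := sum_log_filter_le hS w
    have h3 : ∑ p ∈ Finset.Icc 1 x, (if S p then Real.log p else 0) =
        ∑ p ∈ Finset.Icc 1 w, (if S p then Real.log p else 0) + ∑ p ∈ Q m, Real.log p := by
      rw [hQ, Finset.sum_filter, ← Finset.sum_union]
      · congr 1
        ext k
        rw [Finset.mem_union, Finset.mem_Icc, Finset.mem_Icc, Finset.mem_Ioc]
        omega
      · rw [Finset.disjoint_left]
        intro k hk hk'
        rw [Finset.mem_Icc] at hk
        rw [Finset.mem_Ioc] at hk'
        omega
    have h4 : ∑ p ∈ Q m, Real.log p ≤ (Q m).card * Real.log N := by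
      rw [← nsmul_eq_mul]
      refine Finset.sum_le_card_nsmul _ _ _ fun p hp => ?_
      rw [hQ, Finset.mem_filter, Finset.mem_Ioc] at hp
      have hp0 : (0 : ℝ) < p := by exact_mod_cast (by omega : 0 < p)
      exact Real.log_le_log hp0 (by exact_mod_cast hp.1.2.trans (Nat.div_le_self N m))
    have h5 : (K : ℝ) * w ≤ x := by exact_mod_cast hx
    have h6 : (N : ℝ) ≤ 2 * (x * m) := by
      have h7 : N < m * (N / m) + m := Nat.lt_mul_div_succ N hm'.1
      have h8 : m ≤ m * x := Nat.le_mul_of_pos_right m (by omega)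
      have h9 : N ≤ 2 * (x * m) := by
        rw [← hxdef] at h7
        rw [mul_comm x m]
        omega
      exact_mod_cast h9
    rw [div_mul_eq_mul_div, div_le_iff₀ hlN, ← div_eq_mul_inv, div_le_iff₀ hm0]
    have h10 : c / 2 * x ≤ (Q m).card * Real.log N := by nlinarith
    have h11 := mul_le_mul_of_nonneg_right h10 hm0.le
    nlinarith
  have hcard : ∑ m ∈ squarefreeUpTo S w, (Q m).card ≤ (squarefreeUpTo S N).card := by
    rw [← Finset.card_sigma]
    refine Finset.card_le_card_of_injOn (fun q => q.1 * q.2) ?_ ?_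
    · rintro ⟨m, p⟩ hq
      rw [Finset.mem_coe, Finset.mem_sigma, hQ, Finset.mem_filter, Finset.mem_Ioc] at hq
      refine mul_mem_squarefreeUpTo hS hq.1 hq.2.2 hq.2.1.1 ?_
      rw [mul_comm]
      exact (Nat.le_div_iff_mul_le (mem_squarefreeUpTo.mp hq.1).1.1).mp hq.2.1.2
    · rintro ⟨m, p⟩ hq ⟨m', p'⟩ hq' he
      rw [Finset.mem_coe, Finset.mem_sigma, hQ, Finset.mem_filter, Finset.mem_Ioc] at hq hq'
      obtain ⟨e1, e2⟩ := eq_of_mul_prime_eq (mem_squarefreeUpTo.mp hq'.1).1 (hS p hq.2.2)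
        (hS p' hq'.2.2) hq.2.1.1 he
      subst e1 e2
      rfl
  have hsum : c / 4 * N / Real.log N * ∑ m ∈ squarefreeUpTo S w, (m : ℝ)⁻¹ ≤
      ((squarefreeUpTo S N).card : ℝ) := by
    rw [Finset.mul_sum]
    refine (Finset.sum_le_sum hcount).trans ?_
    exact_mod_cast hcard
  refine le_trans ?_ hsum
  have hlw : 1 / 4 * Real.log N ≤ Real.log w := by
    have h1 : (N : ℝ) ≤ (w : ℝ) ^ 4 := by exact_mod_cast hNw
    have h2 := Real.log_le_log hN0 h1
    rw [Real.log_pow] at h2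
    push_cast at h2
    linarith
  have h1 : a * ((1 / 4) ^ η * Real.log N ^ η) ≤ ∑ m ∈ squarefreeUpTo S w, (m : ℝ)⁻¹ := by
    refine le_trans ?_ (hL w hwz₁)
    rw [← Real.mul_rpow (by norm_num) hlN.le]
    have := Real.rpow_le_rpow (by positivity) hlw hη0.le
    gcongr
  refine le_trans (le_of_eq ?_) (mul_le_mul_of_nonneg_left h1 (by positivity))
  rw [Real.rpow_sub hlN, Real.rpow_one]
  field_simp

open NumberField in
theorem exists_card_squarefreeUpTo_numberField_ge (K : Type*) [Field K] [NumberField K] (P : ℕ) :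
    ∃ γ a : ℝ, 0 ≤ γ ∧ γ < 1 ∧ 0 < a ∧ ∃ N₁ : ℕ, ∀ N, N₁ ≤ N →
      a * N / Real.log N ^ γ ≤
        ((squarefreeUpTo (fun p => p.Prime ∧ P < p ∧ Nonempty (𝓞 K →+* ZMod p)) N).card : ℝ) := by
  classical
  obtain ⟨c, hc, N₀, hge⟩ := exists_mul_le_sum_log_prime K
  set B : ℝ := ∑ p ∈ Finset.Icc 1 P, Real.log p with hB
  obtain ⟨N₁, hN₁⟩ := exists_nat_ge (2 * B / c)
  rw [div_le_iff₀ hc] at hN₁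
  refine exists_card_squarefreeUpTo_ge (c := c / 2) (N₀ := max N₀ N₁) (fun p hp => hp.1)
    (by positivity) fun n hn => ?_
  have h1 := hge n ((le_max_left _ _).trans hn)
  have h2 : (N₁ : ℝ) ≤ n := by exact_mod_cast (le_max_right _ _).trans hn
  have h3 : ∑ p ∈ Finset.Icc 1 n with p.Prime ∧ Nonempty (𝓞 K →+* ZMod p), Real.log p ≤
      ∑ p ∈ Finset.Icc 1 n,
        (if p.Prime ∧ P < p ∧ Nonempty (𝓞 K →+* ZMod p) then Real.log p else 0) + B := by
    rw [← Finset.sum_filter, ← Finset.sum_filter_add_sum_filter_not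
      ((Finset.Icc 1 n).filter fun p => p.Prime ∧ Nonempty (𝓞 K →+* ZMod p)) (fun p => P < p)]
    refine add_le_add ?_ ?_
    · refine Finset.sum_le_sum_of_subset_of_nonneg (fun p hp => ?_)
        fun p _ _ => Real.log_natCast_nonneg p
      simp only [Finset.mem_filter] at hp ⊢
      exact ⟨hp.1.1, hp.1.2.1, hp.2, hp.1.2.2⟩
    · refine Finset.sum_le_sum_of_subset_of_nonneg (fun p hp => ?_)
        fun p _ _ => Real.log_natCast_nonneg p
      simp only [Finset.mem_filter, Finset.mem_Icc] at hp ⊢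
      exact ⟨hp.1.1.1, not_lt.mp hp.2⟩
  have h4 : N₁ * c ≤ n * c := mul_le_mul_of_nonneg_right h2 hc.le
  have h5 : c / 2 * n ≤ ∑ p ∈ Finset.Icc 1 n,
      (if p.Prime ∧ P < p ∧ Nonempty (𝓞 K →+* ZMod p) then Real.log p else 0) := by
    linarith
  convert h5

theorem exists_nthPowerFree_mul_pow {n : ℕ} (hn : 1 ≤ n) :
    ∀ F : ℤ, F ≠ 0 → ∃ d z : ℤ, NthPowerFree n d ∧ F = d * z ^ n := by
  intro F
  induction hk : F.natAbs using Nat.strong_induction_on generalizing F with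
  | _ k ih =>
    intro hF
    by_cases h : ∀ p : ℕ, p.Prime → ¬ ((p : ℤ) ^ n ∣ F)
    · exact ⟨F, 1, ⟨hF, h⟩, by simp⟩
    · push Not at h
      obtain ⟨p, hp, F', hF'⟩ := h
      have hF'0 : F' ≠ 0 := by
        rintro rfl
        exact hF (by rw [hF', mul_zero])
      have hlt : F'.natAbs < k := by
        have h1 : F.natAbs = p ^ n * F'.natAbs := by
          rw [hF', Int.natAbs_mul, Int.natAbs_pow, Int.natAbs_natCast]
        have h2 : 1 < p ^ n := Nat.one_lt_pow (by omega) hp.one_lt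
        have h3 : 0 < F'.natAbs := Int.natAbs_pos.mpr hF'0
        rw [← hk, h1]
        exact lt_mul_of_one_lt_left h3 h2
      obtain ⟨d, z, hd, hz⟩ := ih _ hlt F' rfl hF'0
      exact ⟨d, p * z, hd, by rw [hF', hz]; ring⟩

theorem hasTwistPoint_of_pow_eq {n : ℕ} {f : ℤ[X]} {K : Type} [Field K] [CharZero K]
    {d₀ z x₀ : ℤ} {m : ℕ} (hm : m ≠ 0) (h : f.eval x₀ = d₀ * z ^ n) {w : K}
    (hw : w ^ n = m) : HasTwistPoint n f (d₀ * m) K := by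
  refine ⟨x₀, z / w, ?_⟩
  have hmK : (m : K) ≠ 0 := Nat.cast_ne_zero.mpr hm
  have e : aeval (x₀ : K) f = ((f.eval x₀ : ℤ) : K) := by
    rw [← eq_intCast (algebraMap ℤ K) x₀, aeval_algebraMap_apply, coe_aeval_eq_eval, eq_intCast]
  rw [e, h, div_pow, hw]
  push_cast
  field_simp

section Padic

variable {p : ℕ} [Fact p.Prime]

theorem PadicInt.toZMod_eq_zero_iff_norm_lt_one (z : ℤ_[p]) : PadicInt.toZMod z = 0 ↔ ‖z‖ < 1 := by
  rw [← RingHom.mem_ker, PadicInt.ker_toZMod, IsLocalRing.mem_maximalIdeal, PadicInt.mem_nonunits]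

theorem PadicInt.exists_eval_eq_zero_of_toZMod (g : ℤ_[p][X]) (a : ℤ_[p])
    (h0 : PadicInt.toZMod (g.eval a) = 0) (h1 : PadicInt.toZMod ((derivative g).eval a) ≠ 0) :
    ∃ z : ℤ_[p], g.eval z = 0 := by
  rw [PadicInt.toZMod_eq_zero_iff_norm_lt_one] at h0
  rw [Ne, PadicInt.toZMod_eq_zero_iff_norm_lt_one, not_lt] at h1
  have h1' : ‖(derivative g).eval a‖ = 1 := le_antisymm (PadicInt.norm_le_one _) h1
  obtain ⟨z, hz, -⟩ := hensels_lemma (F := g) (a := a) (by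
    rw [coe_aeval_eq_eval, h1', one_pow]; exact h0)
  exact ⟨z, by rwa [coe_aeval_eq_eval] at hz⟩

theorem PadicInt.exists_pow_eq_natCast {n m : ℕ} (hn : 1 ≤ n) (h : m ≡ 1 [MOD n ^ 2 * p]) :
    ∃ w : ℤ_[p], w ^ n = m := by
  have hn0 : (n : ℤ_[p]) ≠ 0 := Nat.cast_ne_zero.mpr (by omega)
  obtain ⟨t, ht⟩ : ((n ^ 2 * p : ℕ) : ℤ) ∣ 1 - (m : ℤ) := by
    have := Nat.modEq_iff_dvd.mp h
    exact_mod_cast this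
  have e : (1 : ℤ_[p]) - m = (n : ℤ_[p]) ^ 2 * p * t := by
    have := congrArg (Int.cast (R := ℤ_[p])) ht
    push_cast at this
    exact this
  obtain ⟨z, hz, -⟩ := hensels_lemma (p := p) (F := (X ^ n - C (m : ℤ_[p]) : ℤ_[p][X])) (a := 1) (by
    simp only [map_sub, map_pow, aeval_X, one_pow, aeval_C, Algebra.algebraMap_self_apply,
      derivative_X_pow, derivative_C, sub_zero, map_mul, mul_one]
    rw [e, norm_mul, norm_mul, norm_pow, PadicInt.norm_p]
    have h1 : 0 < ‖(n : ℤ_[p])‖ ^ 2 := by positivity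
    have hp : ((p : ℝ))⁻¹ < 1 := inv_lt_one_of_one_lt₀
      (by exact_mod_cast (Fact.out : p.Prime).one_lt)
    have h2 : ‖(t : ℤ_[p])‖ ≤ 1 := PadicInt.norm_le_one _
    have hp0 : 0 ≤ ((p : ℝ))⁻¹ := by positivity
    have h3 : ((p : ℝ))⁻¹ * ‖(t : ℤ_[p])‖ < 1 := by nlinarith [norm_nonneg (t : ℤ_[p])]
    rw [mul_assoc]
    exact mul_lt_of_lt_one_right h1 h3)
  refine ⟨z, ?_⟩
  simp only [map_sub, map_pow, aeval_X, aeval_C, Algebra.algebraMap_self_apply, sub_eq_zero] at hz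
  exact hz

theorem toZMod_eval_map (f : ℤ[X]) (a : ℤ_[p]) :
    PadicInt.toZMod ((f.map (Int.castRingHom ℤ_[p])).eval a) = aeval (PadicInt.toZMod a) f := by
  rw [eval_map, hom_eval₂, aeval_def]
  congr 1
  exact RingHom.ext_int _ _

theorem aeval_padic_coe (f : ℤ[X]) (a : ℤ_[p]) :
    aeval (a : ℚ_[p]) f = (((f.map (Int.castRingHom ℤ_[p])).eval a : ℤ_[p]) : ℚ_[p]) := by
  have h : ∀ z : ℤ_[p], (z : ℚ_[p]) = PadicInt.Coe.ringHom z := fun _ => rfl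
  rw [h, h, eval_map, hom_eval₂, aeval_def]
  congr 1

theorem hasTwistPoint_padic_of_root {n : ℕ} (hn : 1 ≤ n) {f : ℤ[X]} {Δ : ℤ} {u v : ℤ[X]}
    (huv : u * f + v * derivative f = C Δ) (hΔ : ¬ (p : ℤ) ∣ Δ) (d : ℤ) {r : ZMod p}
    (hr : aeval r f = 0) : HasTwistPoint n f d ℚ_[p] := by
  obtain ⟨a, rfl⟩ := ZMod.ringHom_surjective (PadicInt.toZMod (p := p)) r
  obtain ⟨z, hz⟩ := PadicInt.exists_eval_eq_zero_of_toZMod (f.map (Int.castRingHom ℤ_[p])) a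
    (by rw [toZMod_eval_map, hr]) (by
      rw [derivative_map, toZMod_eval_map]
      intro h
      have := congrArg (aeval (PadicInt.toZMod a)) huv
      rw [map_add, map_mul, map_mul, hr, h, mul_zero, mul_zero, add_zero, aeval_C, eq_intCast] at this
      exact hΔ ((ZMod.intCast_zmod_eq_zero_iff_dvd _ _).mp this.symm))
  refine ⟨z, 0, ?_⟩
  rw [aeval_padic_coe, hz, zero_pow (by omega), mul_zero]
  rfl

theorem hasTwistPoint_padic_of_zmod {n : ℕ} (hn : 1 ≤ n) {f : ℤ[X]} {Δ : ℤ} {u v : ℤ[X]}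
    (huv : u * f + v * derivative f = C Δ) (hΔ : ¬ (p : ℤ) ∣ Δ) (hpn : ¬ p ∣ n) {d : ℤ}
    (hd : ¬ (p : ℤ) ∣ d) {x y : ZMod p} (hxy : (d : ZMod p) * y ^ n = aeval x f) :
    HasTwistPoint n f d ℚ_[p] := by
  by_cases hy : y = 0
  · rw [hy, zero_pow (by omega), mul_zero] at hxy
    exact hasTwistPoint_padic_of_root hn huv hΔ d hxy.symm
  obtain ⟨a, rfl⟩ := ZMod.ringHom_surjective (PadicInt.toZMod (p := p)) x
  obtain ⟨b, rfl⟩ := ZMod.ringHom_surjective (PadicInt.toZMod (p := p)) y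
  set c := (f.map (Int.castRingHom ℤ_[p])).eval a with hc
  have hd' : (d : ZMod p) ≠ 0 := fun h => hd ((ZMod.intCast_zmod_eq_zero_iff_dvd _ _).mp h)
  have hn' : (n : ZMod p) ≠ 0 := fun h => hpn ((ZMod.natCast_eq_zero_iff _ _).mp h)
  obtain ⟨z, hz⟩ := PadicInt.exists_eval_eq_zero_of_toZMod (C (d : ℤ_[p]) * X ^ n - C c) b
    (by
      simp only [eval_sub, eval_mul, eval_C, eval_pow, eval_X, map_sub, map_mul, map_pow]
      rw [map_intCast, hxy, hc, toZMod_eval_map, sub_self])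
    (by
      simp only [derivative_sub, derivative_C_mul, derivative_X_pow, derivative_C, sub_zero,
        eval_mul, eval_C, eval_pow, eval_X, map_mul, map_pow]
      rw [map_intCast, map_natCast]
      exact mul_ne_zero hd' (mul_ne_zero hn' (pow_ne_zero _ hy)))
  simp only [eval_sub, eval_mul, eval_C, eval_pow, eval_X, sub_eq_zero] at hz
  refine ⟨a, z, ?_⟩
  rw [aeval_padic_coe, ← hc, ← hz]
  push_cast
  rfl

end Padic

/-- Local solubility of the twists by squarefree products of suitable primes. -/
theorem exists_everywhereLocallySoluble {n : ℕ} (hn : 2 ≤ n) {f : ℤ[X]}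
    (hsf : Squarefree (f.map (Int.castRingHom ℚ))) (hdeg : 0 < f.natDegree) :
    ∃ (d₀ : ℤ) (P M : ℕ), d₀ ≠ 0 ∧ 0 < M ∧ ∀ m : ℕ, Squarefree m →
      (∀ p : ℕ, p.Prime → p ∣ m → P < p ∧ p ≡ 1 [MOD M] ∧ ∃ r : ZMod p, aeval r f = 0) →
      NthPowerFree n (d₀ * m) ∧ EverywhereLocallySoluble n f (d₀ * m) := by
  have hf0 : f ≠ 0 := fun e => by simp [e] at hdeg
  obtain ⟨x₀, hx₀⟩ : ∃ x₀ : ℤ, f.eval x₀ ≠ 0 := by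
    by_contra h
    push Not at h
    exact hf0 (Polynomial.funext fun r => by rw [h r, eval_zero])
  obtain ⟨d₀, z, hd₀, hz⟩ := exists_nthPowerFree_mul_pow (n := n) (by omega) _ hx₀
  obtain ⟨Δ, hΔ, u, v, huv⟩ := exists_bezout_of_squarefree hsf
  obtain ⟨P₀, hP₀⟩ := exists_twist_point_zmod (n := n) (by omega) hsf hdeg
  set P : ℕ := max (max P₀ n) (max d₀.natAbs Δ.natAbs) with hP
  have hPd : ∀ (p : ℕ) (k : ℤ), k ≠ 0 → k.natAbs ≤ P → P < p → ¬ (p : ℤ) ∣ k := by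
    intro p k hk hkP hp hpk
    have := Nat.le_of_dvd (Int.natAbs_pos.mpr hk) (Int.natCast_dvd.mp hpk)
    omega
  have hP1 : P₀ ≤ P := by omega
  have hP2 : n ≤ P := by omega
  have hP3 : d₀.natAbs ≤ P := by omega
  have hP4 : Δ.natAbs ≤ P := by omega
  clear_value P
  refine ⟨d₀, P, n ^ 2 * P.factorial, hd₀.1, by positivity, fun m hm hmp => ⟨⟨?_, ?_⟩, ?_, ?_⟩⟩
  · exact mul_ne_zero hd₀.1 (by exact_mod_cast hm.ne_zero)
  · intro p hp hdvd
    have hp' : Prime (p : ℤ) := Nat.prime_iff_prime_int.mp hp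
    by_cases hpm : p ∣ m
    · have h1 : ¬ (p : ℤ) ∣ d₀ := hPd p d₀ hd₀.1 hP3 (hmp p hp hpm).1
      have h2 : IsCoprime ((p : ℤ) ^ n) d₀ :=
        IsCoprime.pow_left ((hp'.coprime_iff_not_dvd).mpr h1)
      have h3 : p ^ n ∣ m := by exact_mod_cast h2.dvd_of_dvd_mul_left hdvd
      have h4 : p * p ∣ m := by
        rw [← sq]
        exact (pow_dvd_pow p hn).trans h3
      exact hp.one_lt.ne' (Nat.isUnit_iff.mp (hm p h4))
    · have h1 : ¬ (p : ℤ) ∣ (m : ℤ) := by exact_mod_cast hpm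
      have h2 : IsCoprime ((p : ℤ) ^ n) (m : ℤ) :=
        IsCoprime.pow_left ((hp'.coprime_iff_not_dvd).mpr h1)
      exact hd₀.2 p hp (h2.dvd_of_dvd_mul_right hdvd)
  · refine hasTwistPoint_of_pow_eq hm.ne_zero hz (w := (m : ℝ) ^ (n : ℝ)⁻¹) ?_
    exact Real.rpow_inv_natCast_pow (Nat.cast_nonneg _) (by omega)
  · intro p hpf
    have hp := hpf.out
    by_cases hpP : p ≤ P
    · have hcong : m ≡ 1 [MOD n ^ 2 * P.factorial] := by
        rw [← Nat.prod_primeFactors_of_squarefree hm]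
        have : ∏ q ∈ m.primeFactors, q ≡ ∏ q ∈ m.primeFactors, 1 [MOD n ^ 2 * P.factorial] := by
          rw [Nat.modEq_iff_dvd]
          push_cast
          rw [← Int.modEq_iff_dvd]
          refine Int.ModEq.prod fun q hq => ?_
          have := (hmp q (Nat.prime_of_mem_primeFactors hq) (Nat.dvd_of_mem_primeFactors hq)).2.1
          exact_mod_cast (Int.natCast_modEq_iff.mpr this)
        simpa using this
      have hcong' : m ≡ 1 [MOD n ^ 2 * p] :=
        hcong.of_dvd (mul_dvd_mul_left _ (Nat.dvd_factorial hp.pos hpP))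
      obtain ⟨w, hw⟩ := PadicInt.exists_pow_eq_natCast (p := p) (n := n) (by omega) hcong'
      refine hasTwistPoint_of_pow_eq hm.ne_zero hz (w := (w : ℚ_[p])) ?_
      rw [← PadicInt.coe_pow, hw, PadicInt.coe_natCast]
    · push Not at hpP
      have hΔp := hPd p Δ hΔ hP4 hpP
      by_cases hpm : p ∣ m
      · obtain ⟨r, hr⟩ := (hmp p hp hpm).2.2
        exact hasTwistPoint_padic_of_root (by omega) huv hΔp _ hr
      · have hpd : ¬ (p : ℤ) ∣ d₀ * m := by
          intro h
          rcases (Nat.prime_iff_prime_int.mp hp).dvd_or_dvd h with h | h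
          · exact hPd p d₀ hd₀.1 hP3 hpP h
          · exact hpm (by exact_mod_cast h)
        obtain ⟨x, y, hxy⟩ := hP₀ p hp (by omega) ((d₀ * m : ℤ) : ZMod p)
          (fun h => hpd ((ZMod.intCast_zmod_eq_zero_iff_dvd _ _).mp h))
        refine hasTwistPoint_padic_of_zmod (by omega) huv hΔp ?_ hpd hxy
        intro h
        have := Nat.le_of_dvd (by omega) h
        omega

theorem exists_numberField_splits (F : ℚ[X]) :
    ∃ (L : Type) (_ : Field L) (_ : NumberField L), (F.map (algebraMap ℚ L)).Splits := by
  have key : ∀ g : ℚ →+* F.SplittingField, (F.map g).Splits := fun g => by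
    rw [Subsingleton.elim g (algebraMap ℚ F.SplittingField)]
    exact SplittingField.splits F
  have hcz : CharZero F.SplittingField := charZero_of_injective_algebraMap
    (algebraMap ℚ F.SplittingField).injective
  have hnf : NumberField F.SplittingField :=
    { to_charZero := hcz
      to_finiteDimensional := by
        convert (inferInstance : FiniteDimensional ℚ F.SplittingField) }
  refine ⟨F.SplittingField, inferInstance, hnf, key _⟩

open NumberField in
/-- A number field in which `f` has a root and which contains the `M`-th roots of unity detects
primes that are `1` modulo `M` and modulo which `f` has a root. -/
theorem exists_numberField_detecting {f : ℤ[X]} (hdeg : 0 < f.natDegree) {M : ℕ} (hM : 0 < M) :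
    ∃ (L : Type) (_ : Field L) (_ : NumberField L) (P : ℕ), ∀ p : ℕ, p.Prime → P < p →
      Nonempty (𝓞 L →+* ZMod p) → p ≡ 1 [MOD M] ∧ ∃ r : ZMod p, aeval r f = 0 := by
  have hf0 : f ≠ 0 := fun e => by simp [e] at hdeg
  set g : ℚ[X] := f.map (Int.castRingHom ℚ) with hg
  have hgdeg : g.natDegree = f.natDegree :=
    natDegree_map_eq_of_injective (RingHom.injective_int _) _
  have hg0 : g ≠ 0 := fun e => by rw [e, natDegree_zero] at hgdeg; omega
  obtain ⟨F, hF⟩ : ∃ F : ℚ[X], F = g * cyclotomic M ℚ := ⟨_, rfl⟩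
  have hF0 : F ≠ 0 := hF ▸ mul_ne_zero hg0 (cyclotomic_ne_zero M ℚ)
  obtain ⟨L, _, _, hsp⟩ := exists_numberField_splits F
  obtain ⟨θ, hθ⟩ : ∃ θ : L, eval₂ (algebraMap ℚ L) θ g = 0 := by
    have h1 : (g.map (algebraMap ℚ L)).Splits :=
      hsp.of_dvd (Polynomial.map_ne_zero hF0) (by
        exact Polynomial.map_dvd (algebraMap ℚ L) (Dvd.intro _ hF.symm))
    obtain ⟨θ, hθ⟩ := h1.exists_eval_eq_zero (by
      rw [degree_map]
      exact (natDegree_pos_iff_degree_pos.mp (by omega)).ne')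
    exact ⟨θ, by rwa [← eval_map]⟩
  obtain ⟨ζ, hζ⟩ : ∃ ζ : L, eval ζ (cyclotomic M L) = 0 := by
    have h1 : ((cyclotomic M ℚ).map (algebraMap ℚ L)).Splits :=
      hsp.of_dvd (Polynomial.map_ne_zero hF0) (by
        exact Polynomial.map_dvd (algebraMap ℚ L) (Dvd.intro_left _ hF.symm))
    obtain ⟨ζ, hζ⟩ := h1.exists_eval_eq_zero (by
      rw [degree_map, degree_cyclotomic]
      have := Nat.totient_pos.mpr hM
      exact_mod_cast this.ne')
    exact ⟨ζ, by rwa [map_cyclotomic] at hζ⟩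
  have hθ' : aeval θ f = 0 := by
    rw [hg, eval₂_map] at hθ
    rw [aeval_def]
    rw [← hθ]
    congr 1
    exact RingHom.ext_int _ _
  have hθint : IsIntegral ℤ (f.leadingCoeff • θ) := isIntegral_leadingCoeff_smul f θ hθ'
  have hζint : IsIntegral ℤ ζ := by
    refine ⟨cyclotomic M ℤ, cyclotomic.monic M ℤ, ?_⟩
    rw [← eval_map, map_cyclotomic, hζ]
  refine ⟨L, inferInstance, inferInstance, M + f.leadingCoeff.natAbs, fun p hp hlt ⟨φ⟩ => ?_⟩
  have : Fact p.Prime := ⟨hp⟩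
  have inj : Function.Injective (algebraMap (𝓞 L) L) :=
    RingOfIntegers.coe_injective
  constructor
  · have hM0 : NeZero (M : ZMod p) := ⟨fun h => by
      have := Nat.le_of_dvd hM ((ZMod.natCast_eq_zero_iff _ _).mp h)
      omega⟩
    set z : 𝓞 L := ⟨ζ, hζint⟩ with hz
    have hz0 : eval z (cyclotomic M (𝓞 L)) = 0 := by
      apply inj
      rw [map_zero, ← eval₂_at_apply, ← eval_map, map_cyclotomic]
      exact hζ
    have h2 : eval (φ z) (cyclotomic M (ZMod p)) = 0 := by
      rw [← map_cyclotomic M φ, eval_map, eval₂_at_apply, hz0, map_zero]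
    have hprim := isRoot_cyclotomic_iff.mp h2
    have hne : φ z ≠ 0 := hprim.ne_zero (by omega)
    have h3 : M ∣ p - 1 := hprim.dvd_of_pow_eq_one _ (ZMod.pow_card_sub_one_eq_one hne)
    exact ((Nat.modEq_iff_dvd' hp.one_le).mpr h3).symm
  · have hl : (f.leadingCoeff : ZMod p) ≠ 0 := fun h => by
      have h1 := (ZMod.intCast_zmod_eq_zero_iff_dvd _ _).mp h
      have h2 := Nat.le_of_dvd (Int.natAbs_pos.mpr (leadingCoeff_ne_zero.mpr hf0))
        (Int.natCast_dvd.mp h1)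
      omega
    set a : 𝓞 L := ⟨f.leadingCoeff • θ, hθint⟩ with ha
    have h0 : aeval a (scaleRoots f f.leadingCoeff) = 0 := by
      apply inj
      rw [map_zero, ← aeval_algebraMap_apply]
      have := scaleRoots_aeval_eq_zero (r := f.leadingCoeff) hθ'
      have e : algebraMap (𝓞 L) L a = algebraMap ℤ L f.leadingCoeff * θ :=
        zsmul_eq_mul θ f.leadingCoeff
      rw [e, this]
    have h1 : aeval (φ a) (scaleRoots f f.leadingCoeff) = 0 := by
      have := congrArg φ h0
      rw [map_zero] at this
      rw [← this, aeval_def, aeval_def, hom_eval₂]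
      congr 1
      exact RingHom.ext_int _ _
    refine ⟨φ a / f.leadingCoeff, ?_⟩
    have h4 := scaleRoots_eval₂_mul (p := f) (algebraMap ℤ (ZMod p)) (φ a / f.leadingCoeff)
      f.leadingCoeff
    rw [eq_intCast, mul_div_cancel₀ _ hl, ← aeval_def, h1] at h4
    exact (mul_eq_zero.mp h4.symm).resolve_left (pow_ne_zero _ hl)

theorem exists_forall_mul_rpow_le {C θ c γ : ℝ} (hθ : θ < 1) (hC : 0 < C) (hc : 0 < c) :
    ∃ X₀ : ℝ, ∀ X : ℝ, X₀ ≤ X → C * X ^ θ ≤ c * X / Real.log X ^ γ := by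
  have h1 := isLittleO_log_rpow_rpow_atTop γ (show 0 < 1 - θ by linarith)
  have h2 := h1.bound (show 0 < c / C by positivity)
  obtain ⟨X₁, hX₁⟩ := Filter.eventually_atTop.mp h2
  refine ⟨max X₁ 3, fun X hX => ?_⟩
  have h3 := hX₁ X ((le_max_left _ _).trans hX)
  have hX3 : 3 ≤ X := (le_max_right _ _).trans hX
  have hX0 : 0 < X := by linarith
  have hl : 0 < Real.log X := Real.log_pos (by linarith)
  rw [Real.norm_of_nonneg (by positivity), Real.norm_of_nonneg (by positivity),
    Real.rpow_sub hX0, Real.rpow_one] at h3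
  rw [le_div_iff₀ (by positivity)]
  have hXθ : 0 < X ^ θ := by positivity
  calc C * X ^ θ * Real.log X ^ γ ≤ C * X ^ θ * (c / C * (X / X ^ θ)) := by gcongr
    _ = c * X := by field_simp

theorem finite_setOf_abs_intCast_le (X : ℝ) : {d : ℤ | |(d : ℝ)| ≤ X}.Finite := by
  refine (Set.finite_Icc (-⌊X⌋) ⌊X⌋).subset fun d hd => ?_
  rw [Set.mem_ofPred_eq, abs_le] at hd
  have h1 : d ≤ ⌊X⌋ := Int.le_floor.mpr hd.2
  have h2 : -d ≤ ⌊X⌋ := Int.le_floor.mpr (by push_cast; linarith [hd.1])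
  exact ⟨by linarith, h1⟩

theorem exists_ncard_everywhereLocallySoluble_ge {n : ℕ} (hn : 2 ≤ n) {f : ℤ[X]}
    (hsf : Squarefree (f.map (Int.castRingHom ℚ))) (hdeg : 0 < f.natDegree) :
    ∃ γ c : ℝ, 0 ≤ γ ∧ γ < 1 ∧ 0 < c ∧ ∃ X₀ : ℝ, ∀ X : ℝ, X₀ ≤ X →
      c * X / Real.log X ^ γ ≤
        ({d : ℤ | |(d : ℝ)| ≤ X ∧ NthPowerFree n d ∧ EverywhereLocallySoluble n f d}.ncard : ℝ) := by
  obtain ⟨d₀, P, M, hd₀, hM, hsol⟩ := exists_everywhereLocallySoluble hn hsf hdeg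
  obtain ⟨L, _, _, P', hdet⟩ := exists_numberField_detecting hdeg hM
  obtain ⟨γ, a, hγ0, hγ1, ha, N₁, hN₁⟩ :=
    exists_card_squarefreeUpTo_numberField_ge L (max P P')
  set S : ℕ → Prop := fun p =>
    p.Prime ∧ max P P' < p ∧ Nonempty (NumberField.RingOfIntegers L →+* ZMod p) with hS
  have hδ : (0 : ℝ) < |(d₀ : ℝ)| := abs_pos.mpr (by exact_mod_cast hd₀)
  have hδ1 : (1 : ℝ) ≤ |(d₀ : ℝ)| := by exact_mod_cast Int.one_le_abs hd₀
  set δ : ℝ := |(d₀ : ℝ)| with hδdef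
  refine ⟨γ, a / (2 * δ), hγ0, hγ1, by positivity, δ * (max N₁ 2 : ℕ), fun X hX => ?_⟩
  have hXδ : ((max N₁ 2 : ℕ) : ℝ) ≤ X / δ := by
    rw [le_div_iff₀ hδ, mul_comm]
    exact hX
  set N := ⌊X / δ⌋₊ with hN
  have hNmax : max N₁ 2 ≤ N := Nat.le_floor hXδ
  have hN2 : 2 ≤ N := (le_max_right _ _).trans hNmax
  have hXδ0 : 0 ≤ X / δ := le_trans (by positivity) hXδ
  have hNX : (N : ℝ) ≤ X / δ := Nat.floor_le hXδ0
  have hXN : X / δ ≤ 2 * N := by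
    have h1 := Nat.lt_floor_add_one (X / δ)
    rw [← hN] at h1
    have h2 : (2 : ℝ) ≤ N := by exact_mod_cast hN2
    linarith
  have hNX' : (N : ℝ) * δ ≤ X := (le_div_iff₀ hδ).mp hNX
  have hN0 : (0 : ℝ) < N := by positivity
  have hNX1 : (N : ℝ) ≤ X := by nlinarith
  have hX0 : 0 < X := hN0.trans_le hNX1
  have hlN : 0 < Real.log N := Real.log_pos (by exact_mod_cast hN2)
  have hlX : Real.log N ≤ Real.log X := Real.log_le_log hN0 hNX1
  have hcard : ((squarefreeUpTo S N).card : ℝ) ≤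
      ({d : ℤ | |(d : ℝ)| ≤ X ∧ NthPowerFree n d ∧ EverywhereLocallySoluble n f d}.ncard : ℝ) := by
    rw [Nat.cast_le, ← Set.ncard_coe_finset]
    refine Set.ncard_le_ncard_of_injOn (fun m : ℕ => d₀ * (m : ℤ)) (fun m hm => ?_)
      (fun m _ m' _ h => ?_) ((finite_setOf_abs_intCast_le X).subset fun d hd => hd.1)
    · rw [Finset.mem_coe, mem_squarefreeUpTo] at hm
      have h1 := hsol m hm.2.1 fun p hp hpm => by
        obtain ⟨_, h2, h3⟩ := hm.2.2 p hp hpm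
        exact ⟨(le_max_left _ _).trans_lt h2, hdet p hp ((le_max_right _ _).trans_lt h2) h3⟩
      refine ⟨?_, h1⟩
      push_cast
      rw [abs_mul, Nat.abs_cast, mul_comm]
      refine le_trans ?_ hNX'
      have : (m : ℝ) ≤ N := by exact_mod_cast hm.1.2
      gcongr
    · exact_mod_cast mul_left_cancel₀ hd₀ h
  refine le_trans ?_ ((hN₁ N ((le_max_left _ _).trans hNmax)).trans hcard)
  have h1 : a / (2 * δ) * X ≤ a * N := by
    calc a / (2 * δ) * X = a / 2 * (X / δ) := by field_simp
      _ ≤ a / 2 * (2 * N) := by gcongr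
      _ = a * N := by ring
  have h2 : Real.log N ^ γ ≤ Real.log X ^ γ := Real.rpow_le_rpow hlN.le hlX hγ0
  have h3 : 0 < Real.log N ^ γ := by positivity
  exact div_le_div₀ (by positivity) h1 h3 h2

theorem exists_ncard_violatesHasse_ge (habc : ABCConjecture) {n : ℕ} (hn : 2 ≤ n) {f : ℤ[X]}
    (hsf : Squarefree (f.map (Int.castRingHom ℚ)))
    (hdeg : (4 * (n : ℝ) - 2) / ((n : ℝ) - 1) < f.natDegree)
    (hroot : ∀ x : ℚ, aeval x f ≠ 0) :
    ∃ γ : ℝ, 0 ≤ γ ∧ γ < 1 ∧ ∃ c : ℝ, 0 < c ∧ ∃ X₀ : ℝ, ∀ X : ℝ, X₀ ≤ X →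
      c * X / Real.log X ^ γ ≤
        ({d : ℤ | |(d : ℝ)| ≤ X ∧ NthPowerFree n d ∧ ViolatesHasse n f d}.ncard : ℝ) := by
  have hn' : (2 : ℝ) ≤ n := by exact_mod_cast hn
  have hdeg0 : 0 < f.natDegree := by
    have h1 : 0 < (4 * (n : ℝ) - 2) / ((n : ℝ) - 1) := div_pos (by linarith) (by linarith)
    exact_mod_cast h1.trans hdeg
  obtain ⟨C, θ, hC, _, hθ, hrat⟩ := ncard_hasTwistPoint_rat_le habc hn hsf hdeg hroot
  obtain ⟨γ, c, hγ0, hγ1, hc, X₀, hX₀⟩ := exists_ncard_everywhereLocallySoluble_ge hn hsf hdeg0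
  obtain ⟨X₁, hX₁⟩ := exists_forall_mul_rpow_le (γ := γ) hθ hC (show 0 < c / 2 by positivity)
  refine ⟨γ, hγ0, hγ1, c / 2, by positivity, max (max X₀ X₁) 1, fun X hX => ?_⟩
  have h1 := hX₀ X ((le_max_left _ _).trans ((le_max_left _ _).trans hX))
  have h2 := hX₁ X ((le_max_right _ _).trans ((le_max_left _ _).trans hX))
  obtain ⟨hfin, h3⟩ := hrat X ((le_max_right _ _).trans hX)
  have h4 : {d : ℤ | |(d : ℝ)| ≤ X ∧ NthPowerFree n d ∧ EverywhereLocallySoluble n f d} ⊆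
      {d : ℤ | |(d : ℝ)| ≤ X ∧ NthPowerFree n d ∧ ViolatesHasse n f d} ∪
      {d : ℤ | |(d : ℝ)| ≤ X ∧ NthPowerFree n d ∧ HasTwistPoint n f d ℚ} := by
    rintro d ⟨hd1, hd2, hd3⟩
    by_cases h : HasTwistPoint n f d ℚ
    · exact Or.inr ⟨hd1, hd2, h⟩
    · exact Or.inl ⟨hd1, hd2, hd3, h⟩
  have hfin' : {d : ℤ | |(d : ℝ)| ≤ X ∧ NthPowerFree n d ∧ ViolatesHasse n f d}.Finite :=
    (finite_setOf_abs_intCast_le X).subset fun d hd => hd.1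
  have h5 := (Set.ncard_le_ncard h4 (hfin'.union hfin)).trans (Set.ncard_union_le _ _)
  have h6 : ({d : ℤ | |(d : ℝ)| ≤ X ∧ NthPowerFree n d ∧
      EverywhereLocallySoluble n f d}.ncard : ℝ) ≤
      ({d : ℤ | |(d : ℝ)| ≤ X ∧ NthPowerFree n d ∧ ViolatesHasse n f d}.ncard : ℝ) +
      ({d : ℤ | |(d : ℝ)| ≤ X ∧ NthPowerFree n d ∧ HasTwistPoint n f d ℚ}.ncard : ℝ) := by
    exact_mod_cast h5
  have h7 : c * X / Real.log X ^ γ = 2 * (c / 2 * X / Real.log X ^ γ) := by ring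
  linarith

/-- Conditionally on the abc conjecture, a superelliptic curve `y^n = f(x)` of
sufficiently large degree has (many) twists violating the Hasse principle iff
`f` has no rational root. -/
theorem stmt_0 (habc : ABCConjecture) (n : ℕ) (hn : 2 ≤ n) (f : Polynomial ℤ)
    (hsf : Squarefree (f.map (Int.castRingHom ℚ)))
    (hdeg : (4 * (n : ℝ) - 2) / ((n : ℝ) - 1) < f.natDegree) :
    List.TFAE [
      ¬ ∃ x : ℚ, Polynomial.aeval x f = 0,
      ∃ γ : ℝ, 0 ≤ γ ∧ γ < 1 ∧ ∃ c : ℝ, 0 < c ∧ ∃ X₀ : ℝ, ∀ X : ℝ, X₀ ≤ X →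
        c * X / (Real.log X) ^ γ ≤
          ({d : ℤ | |(d : ℝ)| ≤ X ∧ NthPowerFree n d ∧ ViolatesHasse n f d}.ncard : ℝ),
      ∃ d : ℤ, NthPowerFree n d ∧ ViolatesHasse n f d] := by
  tfae_have 1 → 2 := fun h => exists_ncard_violatesHasse_ge habc hn hsf hdeg (not_exists.mp h)
  tfae_have 2 → 3 := by
    rintro ⟨γ, _, _, c, hc, X₀, h⟩
    have h1 := h (max X₀ 3) (le_max_left _ _)
    have hX3 : (3 : ℝ) ≤ max X₀ 3 := le_max_right _ _
    have hl : 0 < Real.log (max X₀ 3) := Real.log_pos (by linarith)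
    have h2 : 0 < c * max X₀ 3 / Real.log (max X₀ 3) ^ γ := by positivity
    have h3 := Nat.cast_pos.mp (h2.trans_le h1)
    obtain ⟨d, hd⟩ := Set.nonempty_of_ncard_ne_zero h3.ne'
    exact ⟨d, hd.2⟩
  tfae_have 3 → 1 := by
    rintro ⟨d, _, _, hd⟩ ⟨x, hx⟩
    exact hd ⟨x, 0, by rw [hx, zero_pow (by omega), mul_zero]⟩
  tfae_finish
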